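/- Let G be a finite group with a bicyclic Sylow 2-subgroup P. If the commutator subgroup of P is not cyclic, then P has a normal complement in G, i.e., there exists a normal subgroup N of G with N ∩ P = 1 and N·P = G. -/

import Mathlib

/-- A group is bicyclic if it is the product of two cyclic subgroups. -/
def IsBicyclic (P : Type*) [Group P] : Prop :=
  ∃ x y : P, ∀ g : P, ∃ i j : ℤ, g = x ^ i * y ^ j

/-- A central extension of the target of `β : G → H` that splits over a Sylow subgroup of `G`
splits after pulling it back to `G`, by transfer. -/
theorem exists_splitting_of_sylow_lift {G Q H : Type*} [Group G] [Group Q] [Group H]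
    [Finite G] [Finite Q] {p : ℕ} [Fact p.Prime] (hQ : IsPGroup p Q) (P : Sylow p G)
    (α : Q →* H) (β : G →* H) (hc : α.ker ≤ Subgroup.center Q) (σ : P →* Q)
    (hσ : ∀ u, α (σ u) = β u) (hs : ∀ g, ∃ q, α q = β g) :
    ∃ Γ : Subgroup (G × Q), (∀ x ∈ Γ, β x.1 = α x.2) ∧ (∀ z, (1, z) ∈ Γ → z = 1) ∧
      ∀ g q, β g = α q → ∃ z, α z = 1 ∧ (g, q * z) ∈ Γ := by
  classical
  let D : Subgroup (G × Q) :=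
    (β.comp (MonoidHom.fst G Q)).eqLocus (α.comp (MonoidHom.snd G Q))
  let π : D →* G := (MonoidHom.fst G Q).comp D.subtype
  have hD : ∀ g q, (g, q) ∈ D ↔ β g = α q := fun g q => Iff.rfl
  let T : Subgroup D := (P : Subgroup G).comap π
  let ρ : T →* Q := σ.comp ((π.comp T.subtype).codRestrict (P : Subgroup G) fun t => t.2)
  have hρ : ∀ t : T, α (ρ t) = β (t : D).1.1 := fun t => hσ _
  let _ : CommGroup α.ker :=
    { (inferInstance : Group α.ker) with
      mul_comm := fun a b => Subtype.ext
        ((Subgroup.mem_center_iff.1 (hc a.2) b).symm) }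
  have hcen : ∀ z ∈ α.ker, ∀ q, q * z = z * q := fun z hz q =>
    Subgroup.mem_center_iff.1 (hc hz) q
  have hmemδ : ∀ t : T, (t : D).1.2 * (ρ t)⁻¹ ∈ α.ker := by
    intro t
    have h := (t : D).2
    rw [MonoidHom.mem_ker, map_mul, map_inv, hρ, mul_inv_eq_one]
    exact ((hD _ _).1 h).symm
  let δ : T →* α.ker :=
    { toFun := fun t => ⟨_, hmemδ t⟩
      map_one' := by
        ext
        simp
      map_mul' := by
        intro s t
        ext
        have c := hcen _ (hmemδ t) (ρ s)⁻¹
        simp only [map_mul, Subgroup.coe_mul, Prod.snd_mul]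
        rw [mul_inv_rev, mul_assoc, ← mul_assoc (t : D).1.2, ← c, mul_assoc] }
  have hδ : ∀ t : T, ((δ t : α.ker) : Q) = (t : D).1.2 * (ρ t)⁻¹ :=
    fun t => rfl
  let τ : D →* α.ker := MonoidHom.transfer δ
  have hsurj : Function.Surjective π := by
    intro g
    obtain ⟨q, hq⟩ := hs g
    exact ⟨⟨(g, q), hq.symm⟩, rfl⟩
  have hidx : T.index = (P : Subgroup G).index := Subgroup.index_comap_of_surjective _ hsurj
  have hndvd : ¬ p ∣ T.index := by rw [hidx]; exact P.not_dvd_index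
  have hK : IsPGroup p α.ker := hQ.to_subgroup _
  have hz : ∀ z : α.ker, ((1 : G), (z : Q)) ∈ D := fun z => by
    rw [hD, map_one]; exact (MonoidHom.mem_ker.1 z.2).symm
  have hτ : ∀ z : α.ker, τ ⟨(1, z), hz z⟩ = z ^ T.index := by
    intro z
    have key : ∀ (k : ℕ) (g₀ : D), g₀⁻¹ * (⟨(1, z), hz z⟩ : D) ^ k * g₀ ∈ T →
        g₀⁻¹ * (⟨(1, z), hz z⟩ : D) ^ k * g₀ = (⟨(1, z), hz z⟩ : D) ^ k := by
      intro k g₀ _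
      have hcom : g₀ * (⟨(1, z), hz z⟩ : D) = (⟨(1, z), hz z⟩ : D) * g₀ := by
        ext
        · simp
        · simp [hcen z z.2]
      have := (show Commute g₀ (⟨(1, z), hz z⟩ : D) from hcom).pow_right k
      rw [mul_assoc, ← this.eq, inv_mul_cancel_left]
    have hmem : (⟨(1, z), hz z⟩ : D) ∈ T := by
      change (1 : G) ∈ (P : Subgroup G)
      exact one_mem _
    rw [show τ ⟨(1, z), hz z⟩ = _ from MonoidHom.transfer_eq_pow δ _ key]
    rw [show (⟨(⟨(1, z), hz z⟩ : D) ^ T.index, _⟩ : T) = ⟨_, hmem⟩ ^ T.index from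
      Subtype.ext rfl, map_pow]
    congr 1
    ext
    rw [hδ]
    have : ρ ⟨_, hmem⟩ = 1 := by
      rw [show ρ ⟨_, hmem⟩ = σ 1 from rfl, map_one]
    simp [this]
  refine ⟨τ.ker.map D.subtype, ?_, ?_, ?_⟩
  · rintro _ ⟨x, _, rfl⟩
    exact x.2
  · rintro z ⟨x, hx, hxz⟩
    have hzk : z ∈ α.ker := by
      have h := x.2
      rw [show (x : G × Q) = (1, z) from hxz, hD, map_one] at h
      exact h.symm
    have hx' : x = ⟨(1, ((⟨z, hzk⟩ : α.ker) : Q)), hz ⟨z, hzk⟩⟩ := Subtype.ext hxz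
    have h1 : τ x = 1 := hx
    rw [hx', hτ] at h1
    have := (hK.powEquiv' hndvd).injective (a₁ := ⟨z, hzk⟩) (a₂ := 1) (by simpa using h1)
    exact congrArg Subtype.val this
  · intro g q hgq
    obtain ⟨z, hzz⟩ := (hK.powEquiv' hndvd).surjective (τ ⟨(g, q), hgq⟩)
    have hzz' : z ^ T.index = τ ⟨(g, q), hgq⟩ := by simpa using hzz
    refine ⟨z⁻¹, ?_, ⟨⟨(g, q), hgq⟩ * ⟨(1, z), hz z⟩⁻¹, ?_, ?_⟩⟩
    · rw [map_inv, show α z = 1 from z.2, inv_one]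
    · change τ _ = 1
      rw [map_mul, map_inv, hτ, hzz', mul_inv_cancel]
    · simp

theorem commutator_top_lt_of_isNilpotent {P : Type*} [Group P] [Group.IsNilpotent P]
    (D : Subgroup P) [D.Normal] (hD : D ≠ ⊥) : ∃ d ∈ D, d ∉ ⁅D, (⊤ : Subgroup P)⁆ := by
  by_contra! h
  have h' : D ≤ ⁅D, (⊤ : Subgroup P)⁆ := h
  obtain ⟨n, hn⟩ := Subgroup.nilpotent_iff_lowerCentralSeries.1 ‹Group.IsNilpotent P›
  have : ∀ n, D ≤ (⊤ : Subgroup P).lowerCentralSeries n := by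
    intro n
    induction n with
    | zero => simp
    | succ k ih =>
      exact h'.trans (Subgroup.commutator_mono ih le_rfl)
  exact hD (le_bot_iff.1 ((this n).trans hn.le))

/-- A form of Tate's theorem: if the focal subgroup of a Sylow subgroup consists of
non-generators, then there is a normal complement. -/
theorem Sylow.exists_normal_complement_of_fusion {G : Type*} [Group G] [Finite G] {p : ℕ}
    [Fact p.Prime] (P : Sylow p G) (Φ : Subgroup P) (hΦ : ∀ K : Subgroup P, K ⊔ Φ = ⊤ → K = ⊤)
    (hfus : ∀ (u v : P) (g : G), g * u * g⁻¹ = v → u⁻¹ * v ∈ Φ) :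
    ∃ N : Subgroup G, N.Normal ∧ N ⊓ (P : Subgroup G) = ⊥ ∧ N ⊔ (P : Subgroup G) = ⊤ := by
  classical
  have hfoc : ∀ u : P, (u : G) ∈ (P : Subgroup G).focalSubgroup → u ∈ Φ := by
    intro u hu
    have : (P : Subgroup G).focalSubgroup ≤ Φ.map (P : Subgroup G).subtype := by
      rw [Subgroup.focalSubgroup_def, Subgroup.closure_le]
      rintro g ⟨hg, x, hx, w, rfl⟩
      have hm : w * x⁻¹ * w⁻¹ ∈ (P : Subgroup G) := by
        have := mul_mem (inv_mem hx) hg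
        simpa [commutatorElement_def, mul_assoc] using this
      have := hfus (⟨x, hx⟩⁻¹) ⟨_, hm⟩ w (by simp)
      refine ⟨_, this, ?_⟩
      simp [commutatorElement_def, mul_assoc]
    obtain ⟨v, hv, hvu⟩ := this hu
    rwa [← Subtype.ext (show (v : G) = u from hvu)]
  let good : Subgroup G → Prop := fun L => L.Normal ∧ ∀ g : G, ∃ k : ℕ, g ^ p ^ k ∈ L
  obtain ⟨L, ⟨hLn, hLp⟩, hmin⟩ := WellFounded.has_min
    (wellFounded_lt : WellFounded ((· < ·) : Subgroup G → Subgroup G → Prop))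
    {L | good L} ⟨⊤, inferInstance, fun g => ⟨0, Subgroup.mem_top _⟩⟩
  have hPsup : L ⊔ (P : Subgroup G) = ⊤ := by
    have h1 : IsPGroup p (G ⧸ L) := by
      intro x
      obtain ⟨g, rfl⟩ := QuotientGroup.mk_surjective x
      obtain ⟨k, hk⟩ := hLp g
      exact ⟨k, by rw [← QuotientGroup.mk_pow]; exact (QuotientGroup.eq_one_iff _).2 hk⟩
    rw [← Subgroup.index_eq_one]
    obtain ⟨n, hn⟩ := h1.exists_card_eq
    have h2 : (L ⊔ (P : Subgroup G)).index ∣ p ^ n := by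
      rw [← hn]; exact Subgroup.index_dvd_of_le le_sup_left
    have h3 : (L ⊔ (P : Subgroup G)).index ∣ (P : Subgroup G).index :=
      Subgroup.index_dvd_of_le le_sup_right
    obtain ⟨m, -, hm⟩ := (Nat.dvd_prime_pow Fact.out).1 h2
    rcases Nat.eq_zero_or_pos m with rfl | hm0
    · simpa using hm
    · exact absurd (((dvd_pow_self p hm0.ne').trans (dvd_of_eq hm.symm)).trans h3) P.not_dvd_index
  refine ⟨L, hLn, ?_, hPsup⟩
  set D : Subgroup P := L.subgroupOf P with hDdef
  suffices hDb : D = ⊥ by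
    rw [hDdef, Subgroup.subgroupOf_eq_bot] at hDb
    exact hDb.eq_bot
  by_contra hDne
  have hLfoc : L ≤ P.transferFocal.ker := by
    have hg : good (L ⊓ P.transferFocal.ker) := by
      refine ⟨inferInstance, fun g => ?_⟩
      obtain ⟨k, hk⟩ := hLp g
      have h2 : IsPGroup p (P ⧸ (P : Subgroup G).focalSubgroupOf) := P.2.to_quotient _
      obtain ⟨l, hl⟩ := h2 (P.transferFocal g)
      refine ⟨k + l, ?_, ?_⟩
      · rw [pow_add, pow_mul]; exact pow_mem hk _
      · change P.transferFocal _ = 1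
        rw [map_pow, add_comm, pow_add, pow_mul, hl, one_pow]
    have := hmin _ hg
    by_contra hcon
    exact this (lt_of_le_of_ne inf_le_left (fun h => hcon (inf_eq_left.1 h)))
  have hDΦ : D ≤ Φ := by
    intro u hu
    apply hfoc
    rw [← Subgroup.ker_transferFocal_inf_eq_focalSubgroup P]
    exact ⟨hLfoc hu, u.2⟩
  have hPp : IsPGroup p P := P.2
  have : Group.IsNilpotent P := hPp.isNilpotent
  obtain ⟨d, hd, hdE⟩ := commutator_top_lt_of_isNilpotent D hDne
  set E : Subgroup P := ⁅D, (⊤ : Subgroup P)⁆ with hE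
  have hED : E ≤ D := Subgroup.commutator_le_left _ _
  let α : P ⧸ E →* G ⧸ L := QuotientGroup.lift E ((QuotientGroup.mk' L).comp (P : Subgroup G).subtype)
    (fun u hu => (QuotientGroup.eq_one_iff _).2 (hED hu))
  have hα : ∀ u : P, α (QuotientGroup.mk u) = QuotientGroup.mk (u : G) := fun u => rfl
  have hker : ∀ u : P, α (QuotientGroup.mk u) = 1 ↔ u ∈ D := fun u => by
    rw [hα]; exact QuotientGroup.eq_one_iff _
  obtain ⟨Γ, h1, h2, h3⟩ := exists_splitting_of_sylow_lift (hPp.to_quotient E) P α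
    (QuotientGroup.mk' L) (by
      intro q hq
      obtain ⟨u, rfl⟩ := QuotientGroup.mk_surjective q
      have hu := (hker u).1 hq
      rw [Subgroup.mem_center_iff]
      intro r
      obtain ⟨v, rfl⟩ := QuotientGroup.mk_surjective r
      rw [← QuotientGroup.mk_mul, ← QuotientGroup.mk_mul, QuotientGroup.eq]
      have := Subgroup.commutator_mem_commutator (inv_mem hu) (Subgroup.mem_top v⁻¹)
      simpa [commutatorElement_def, mul_assoc] using this) (QuotientGroup.mk' E) (fun u => rfl) (by
      intro g
      have hg : g ∈ L ⊔ (P : Subgroup G) := hPsup ▸ Subgroup.mem_top g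
      obtain ⟨l, hl, u, hu, rfl⟩ := Subgroup.mem_sup_of_normal_left.1 hg
      refine ⟨QuotientGroup.mk ⟨u, hu⟩, ?_⟩
      rw [hα, map_mul, QuotientGroup.mk'_apply, QuotientGroup.mk'_apply,
        (QuotientGroup.eq_one_iff l).2 hl, one_mul])
  have hsec : ∀ g, ∃ q, (g, q) ∈ Γ := by
    intro g
    have hg : g ∈ L ⊔ (P : Subgroup G) := hPsup ▸ Subgroup.mem_top g
    obtain ⟨l, hl, u, hu, rfl⟩ := Subgroup.mem_sup_of_normal_left.1 hg
    obtain ⟨z, -, hz⟩ := h3 (l * u) (QuotientGroup.mk ⟨u, hu⟩) (by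
      rw [hα, map_mul, QuotientGroup.mk'_apply, QuotientGroup.mk'_apply,
        (QuotientGroup.eq_one_iff l).2 hl, one_mul])
    exact ⟨_, hz⟩
  let L₁ : Subgroup G := Γ.comap (MonoidHom.inl G (P ⧸ E))
  have hL₁ : ∀ g, g ∈ L₁ ↔ (g, 1) ∈ Γ := fun g => Iff.rfl
  have hL₁L : L ≤ L₁ := by
    have hle : L₁ ≤ L := by
      intro g hg
      have := h1 _ ((hL₁ g).1 hg)
      exact (QuotientGroup.eq_one_iff _).1 (by simpa using this)
    have hg : good L₁ := by
      refine ⟨⟨fun g hg h => ?_⟩, fun g => ?_⟩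
      · obtain ⟨q, hq⟩ := hsec h
        have := mul_mem (mul_mem hq hg) (inv_mem hq)
        rw [hL₁]
        simpa using this
      · obtain ⟨q, hq⟩ := hsec g
        obtain ⟨k, hk⟩ := (hPp.to_quotient E) q
        refine ⟨k, ?_⟩
        have := pow_mem hq (p ^ k)
        rw [hL₁]
        simpa [hk] using this
    have := hmin _ hg
    by_contra hcon
    exact this (lt_of_le_of_ne hle (fun h => hcon h.ge))
  have htop := hΦ ((Γ.map (MonoidHom.snd G (P ⧸ E))).comap (QuotientGroup.mk' E)) (by
    rw [eq_top_iff]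
    intro u _
    obtain ⟨z, hz1, hz⟩ := h3 u (QuotientGroup.mk u) rfl
    obtain ⟨w, rfl⟩ := QuotientGroup.mk_surjective z
    have hw := hDΦ ((hker w).1 hz1)
    have : u * w ∈ (Γ.map (MonoidHom.snd G (P ⧸ E))).comap (QuotientGroup.mk' E) := ⟨_, hz, rfl⟩
    have h := mul_mem (Subgroup.mem_sup_left (T := Φ) this) (Subgroup.mem_sup_right (inv_mem hw))
    simpa using h)
  have hdm : d ∈ (Γ.map (MonoidHom.snd G (P ⧸ E))).comap (QuotientGroup.mk' E) :=
    by rw [htop]; exact Subgroup.mem_top d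
  obtain ⟨⟨g, q⟩, hgq, hq⟩ := hdm
  have hq' : q = QuotientGroup.mk d := hq
  subst hq'
  have hgL : g ∈ L := by
    have := h1 _ hgq
    simp only [QuotientGroup.mk'_apply] at this
    rw [(hker d).2 hd] at this
    exact (QuotientGroup.eq_one_iff _).1 this
  have h5 := mul_mem (inv_mem ((hL₁ g).1 (hL₁L hgL))) hgq
  have h6 := h2 (QuotientGroup.mk d) (by simpa using h5)
  exact hdE ((QuotientGroup.eq_one_iff _).1 h6)

open scoped Pointwise in
theorem IsPGroup.exists_conj_mem {G : Type*} [Group G] [Finite G] {p : ℕ} [Fact p.Prime]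
    {S K : Subgroup G} (hS : IsPGroup p S) (hi : ¬ p ∣ S.index) (hK : IsPGroup p K) :
    ∃ g : G, ∀ x ∈ K, g * x * g⁻¹ ∈ S := by
  obtain ⟨T, hT⟩ := hK.exists_le_sylow
  obtain ⟨g, hg⟩ := MulAction.exists_smul_eq G T (hS.toSylow hi)
  refine ⟨g, fun x hx => ?_⟩
  have h1 : MulAut.conj g • x ∈ MulAut.conj g • (T : Subgroup G) :=
    Subgroup.smul_mem_pointwise_smul _ _ _ (hT hx)
  rw [← Sylow.coe_subgroup_smul, hg] at h1
  exact h1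

theorem IsPGroup.exists_conj_mem_of_relIndex {G : Type*} [Group G] [Finite G] {p : ℕ}
    [Fact p.Prime] {S K N : Subgroup G} (hS : IsPGroup p S) (hi : ¬ p ∣ S.relIndex N)
    (hK : IsPGroup p K) (hKN : K ≤ N) : ∃ g ∈ N, ∀ x ∈ K, g * x * g⁻¹ ∈ S := by
  have h1 : IsPGroup p (S.subgroupOf N) := hS.comap_of_injective _ N.subtype_injective
  have h2 : IsPGroup p (K.subgroupOf N) := hK.comap_of_injective _ N.subtype_injective
  obtain ⟨g, hg⟩ := h1.exists_conj_mem hi h2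
  exact ⟨g, g.2, fun x hx => hg ⟨x, hKN hx⟩ hx⟩

theorem Subgroup.card_lt_card_inf_normalizer {G : Type*} [Group G] [Finite G] {p : ℕ}
    [Fact p.Prime] {P A : Subgroup G} (hP : IsPGroup p P) (hA : A < P) :
    Nat.card A < Nat.card (P ⊓ normalizer (A : Set G) : Subgroup G) := by
  have : Group.IsNilpotent P := hP.isNilpotent
  have h1 := Group.normalizerCondition_of_isNilpotent (G := P) (A.subgroupOf P) (by
    rw [lt_top_iff_ne_top, ne_eq, Subgroup.subgroupOf_eq_top]
    exact fun h => hA.not_ge h)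
  rw [← Subgroup.subgroupOf_normalizer_eq hA.le] at h1
  obtain ⟨x, hx, hxA⟩ := SetLike.exists_of_lt h1
  have hle : A ≤ P ⊓ normalizer (A : Set G) := le_inf hA.le Subgroup.le_normalizer
  by_contra hcon
  have h2 := Subgroup.eq_of_le_of_card_ge hle (not_lt.1 hcon)
  have h3 : (x : G) ∈ P ⊓ normalizer (A : Set G) := ⟨x.2, hx⟩
  rw [← h2] at h3
  exact hxA h3

/-- Every subgroup of a Sylow subgroup `P` can be moved inside `P` to a fully normalised one. -/
theorem Sylow.exists_conj_fullyNormalized {G : Type*} [Group G] [Finite G] {p : ℕ}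
    [Fact p.Prime] (P : Sylow p G) (A : Subgroup G) :
    ∃ g : G, (∀ x ∈ (P : Subgroup G) ⊓ Subgroup.normalizer (A : Set G), g * x * g⁻¹ ∈ P) ∧
      ¬ p ∣ (P : Subgroup G).relIndex
        (Subgroup.normalizer (A.map (MulAut.conj g).toMonoidHom : Set G)) := by
  set N := Subgroup.normalizer (A : Set G)
  have h1 : IsPGroup p ((P : Subgroup G).subgroupOf N) :=
    P.2.comap_of_injective _ N.subtype_injective
  obtain ⟨T, hT⟩ := h1.exists_le_sylow
  have h2 : IsPGroup p ((T : Subgroup N).map N.subtype) := T.2.map _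
  obtain ⟨g, hg⟩ := IsPGroup.exists_conj_mem P.2 P.not_dvd_index h2
  refine ⟨g, fun x hx => hg x ⟨⟨x, hx.2⟩, hT hx.1, rfl⟩, ?_⟩
  rw [← Subgroup.map_equiv_normalizer_eq]
  intro hd
  have h3 : ((T : Subgroup N).map N.subtype).map (MulAut.conj g).toMonoidHom ≤ P := by
    rintro _ ⟨x, hx, rfl⟩
    exact hg x hx
  have h4 := hd.trans (Subgroup.relIndex_dvd_of_le_left _ h3)
  rw [Subgroup.relIndex_map_map_of_injective _ _ (MulAut.conj g).injective] at h4
  have h5 : ((T : Subgroup N).map N.subtype).relIndex N = (T : Subgroup N).index :=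
    congrArg Subgroup.index
      (Subgroup.comap_map_eq_self_of_injective N.subtype_injective (T : Subgroup N))
  exact T.not_dvd_index (h5 ▸ h4)

/-- A weak form of Alperin's fusion theorem. -/
theorem Sylow.fusion_of_normalizers {G : Type*} [Group G] [Finite G] {p : ℕ}
    [Fact p.Prime] (P : Sylow p G) (Φ : Subgroup G)
    (hloc : ∀ A : Subgroup G, A ≤ P →
      ¬ p ∣ (P : Subgroup G).relIndex (Subgroup.normalizer (A : Set G)) →
      (∀ B : Subgroup G, B ≤ P → Nat.card A < Nat.card B →
        ∀ h : G, (∀ u ∈ B, h * u * h⁻¹ ∈ P) → ∀ u ∈ B, u⁻¹ * (h * u * h⁻¹) ∈ Φ) →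
      ∀ n ∈ Subgroup.normalizer (A : Set G), ∀ u ∈ A, u⁻¹ * (n * u * n⁻¹) ∈ Φ)
    (A : Subgroup G) (hA : A ≤ P) (g : G) (hg : ∀ u ∈ A, g * u * g⁻¹ ∈ P) :
    ∀ u ∈ A, u⁻¹ * (g * u * g⁻¹) ∈ Φ := by
  induction hk : Nat.card P - Nat.card A using Nat.strong_induction_on generalizing A g with
  | _ k ih =>
  have hcard : ∀ B : Subgroup G, B ≤ P → Nat.card B ≤ Nat.card P := fun B hB =>
    Subgroup.card_le_of_le hB
  have ih' : ∀ B : Subgroup G, B ≤ P → Nat.card A < Nat.card B →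
        ∀ h : G, (∀ u ∈ B, h * u * h⁻¹ ∈ P) → ∀ u ∈ B, u⁻¹ * (h * u * h⁻¹) ∈ Φ := by
    intro B hB hlt h hh
    exact ih _ (by have := hcard B hB; omega) B hB h hh rfl
  have hcm : ∀ (h : G) (B : Subgroup G),
      Nat.card (B.map (MulAut.conj h).toMonoidHom) = Nat.card B := fun h B =>
    (Subgroup.card_map_of_injective (MulAut.conj h).injective)
  have hmm : ∀ (h : G) (B : Subgroup G), ∀ u ∈ B,
      h * u * h⁻¹ ∈ B.map (MulAut.conj h).toMonoidHom := fun h B u hu => ⟨u, hu, rfl⟩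
  by_cases hAP : A = P
  · subst hAP
    refine hloc _ le_rfl ?_ ih' g ?_
    · intro hd
      exact P.not_dvd_index (hd.trans (Subgroup.relIndex_dvd_index_of_le Subgroup.le_normalizer))
    · have h1 : (P : Subgroup G).map (MulAut.conj g).toMonoidHom = P := by
        refine Subgroup.eq_of_le_of_card_ge ?_ (hcm g P).ge
        rintro _ ⟨u, hu, rfl⟩
        exact hg u hu
      rw [Subgroup.mem_normalizer_iff]
      intro h
      constructor
      · exact hg h
      · intro hh
        change g * h * g⁻¹ ∈ (P : Subgroup G) at hh
        rw [← h1] at hh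
        obtain ⟨v, hv, hvh⟩ := hh
        have : v = h := by
          apply (MulAut.conj g).injective
          exact hvh
        exact this ▸ hv
  have hlt : ∀ B : Subgroup G, B ≤ P → Nat.card B = Nat.card A →
      Nat.card A < Nat.card ((P : Subgroup G) ⊓ Subgroup.normalizer (B : Set G) : Subgroup G) := by
    intro B hB hBA
    rw [← hBA]
    refine Subgroup.card_lt_card_inf_normalizer P.2 (lt_of_le_of_ne hB ?_)
    rintro rfl
    exact hAP (Subgroup.eq_of_le_of_card_ge hA hBA.le)
  have hself : ∀ B : Subgroup G, B ≤ P →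
      B ≤ (P : Subgroup G) ⊓ Subgroup.normalizer (B : Set G) := fun B hB =>
    le_inf hB Subgroup.le_normalizer
  set A' := A.map (MulAut.conj g).toMonoidHom
  have hA' : A' ≤ P := by
    rintro _ ⟨u, hu, rfl⟩
    exact hg u hu
  obtain ⟨g₁, hg₁, hf₁⟩ := P.exists_conj_fullyNormalized A
  obtain ⟨g₂, hg₂, hf₂⟩ := P.exists_conj_fullyNormalized A'
  have good₁ := ih' _ inf_le_left (hlt A hA rfl) g₁ hg₁
  have good₂ := ih' _ inf_le_left (hlt A' hA' (hcm _ _)) g₂ hg₂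
  set A₁ := A.map (MulAut.conj g₁).toMonoidHom with hA₁d
  set A₂ := A'.map (MulAut.conj g₂).toMonoidHom with hA₂d
  have hA₁ : A₁ ≤ P := by
    rintro _ ⟨u, hu, rfl⟩
    exact hg₁ u (hself A hA hu)
  have hA₂ : A₂ ≤ P := by
    rintro _ ⟨u, hu, rfl⟩
    exact hg₂ u (hself A' hA' hu)
  set h := g₂ * g * g₁⁻¹ with hh
  have hmap : A₁.map (MulAut.conj h).toMonoidHom = A₂ := by
    rw [hA₁d, hA₂d, Subgroup.map_map, Subgroup.map_map]
    congr 1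
    ext u
    simp [hh, mul_assoc]
  set B := (P : Subgroup G) ⊓ Subgroup.normalizer (A₁ : Set G)
  have hBp : IsPGroup p B := P.2.to_le inf_le_left
  obtain ⟨k, hkN, hk'⟩ := IsPGroup.exists_conj_mem_of_relIndex P.2 hf₂
    (K := B.map (MulAut.conj h).toMonoidHom) (hBp.map _) (by
      rw [← hmap, ← Subgroup.map_equiv_normalizer_eq]
      exact Subgroup.map_mono inf_le_right)
  have good₃ := ih' _ inf_le_left (hlt A₁ hA₁ (hcm _ _)) (k * h) (by
    intro u hu
    have := hk' _ (hmm h B u hu)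
    change _ ∈ (P : Subgroup G)
    simpa [mul_assoc] using this)
  have good₄ := hloc A₂ hA₂ hf₂ (fun C hC hlt' => ih' C hC (by
    rwa [hA₂d, hcm, hcm] at hlt')) k hkN
  intro u hu
  have e₁ := good₁ u (hself A hA hu)
  have m₁ := hmm g₁ A u hu
  have e₃ := good₃ _ (hself A₁ hA₁ m₁)
  have m₂ := hmm h A₁ _ m₁
  rw [hmap] at m₂
  have e₄ := good₄ _ m₂
  have e₂ := good₂ _ (hself A' hA' (hmm g A u hu))
  have := mul_mem (mul_mem (mul_mem e₁ e₃) (inv_mem e₄)) (inv_mem e₂)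
  have e : u⁻¹ * (g * u * g⁻¹) = u⁻¹ * (g₁ * u * g₁⁻¹) *
      ((g₁ * u * g₁⁻¹)⁻¹ * (k * h * (g₁ * u * g₁⁻¹) * (k * h)⁻¹)) *
      ((h * (g₁ * u * g₁⁻¹) * h⁻¹)⁻¹ * (k * (h * (g₁ * u * g₁⁻¹) * h⁻¹) * k⁻¹))⁻¹ *
      ((g * u * g⁻¹)⁻¹ * (g₂ * (g * u * g⁻¹) * g₂⁻¹))⁻¹ := by
    rw [hh]; group
  rw [e]
  exact this

/-- The elements of the normaliser of `A` acting trivially on `A` modulo `Y`. -/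
def Subgroup.actsTriviallyMod {G : Type*} [Group G] (A Y : Subgroup G) : Subgroup G where
  carrier := {n | n ∈ normalizer (A : Set G) ∧ ∀ a ∈ A, a⁻¹ * (n * a * n⁻¹) ∈ Y}
  one_mem' := ⟨one_mem _, fun a _ => by simp⟩
  mul_mem' := by
    rintro n m ⟨hn, hn'⟩ ⟨hm, hm'⟩
    refine ⟨mul_mem hn hm, fun a ha => ?_⟩
    have := mul_mem (hm' a ha) (hn' _ ((mem_normalizer_iff.1 hm a).1 ha))
    simpa [mul_assoc] using this
  inv_mem' := by
    rintro n ⟨hn, hn'⟩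
    refine ⟨inv_mem hn, fun a ha => ?_⟩
    have h1 := (mem_normalizer_iff.1 (inv_mem hn) a).1 ha
    have := inv_mem (hn' _ h1)
    simpa [mul_assoc] using this

/-- The situation met when checking that the normaliser of a fully normalised subgroup `A` of
`P` acts trivially modulo `Φ`, the fusion of larger subgroups being already controlled. -/
structure LocalFusion {G : Type*} [Group G] (P Φ A : Subgroup G) : Prop where
  isPGroup : IsPGroup 2 P
  le : A ≤ P
  conj_mem : ∀ u ∈ P, ∀ s ∈ P, u⁻¹ * (s * u * s⁻¹) ∈ Φ
  not_dvd : ¬ 2 ∣ P.relIndex (Subgroup.normalizer (A : Set G))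
  extend : ∀ B : Subgroup G, B ≤ P → A < B → ∀ h : G, (∀ u ∈ B, h * u * h⁻¹ ∈ P) →
    ∀ u ∈ B, u⁻¹ * (h * u * h⁻¹) ∈ Φ

theorem not_dvd_relIndex_of_normalized {G : Type*} [Group G] [Finite G] {p : ℕ} [Fact p.Prime]
    {P N K : Subgroup G} (hP : IsPGroup p P) (hN : ¬ p ∣ P.relIndex N) (hK : K ≤ N)
    (hinv : ∀ n ∈ N, ∀ m ∈ K, n * m * n⁻¹ ∈ K) : ¬ p ∣ P.relIndex K := by
  have h1 : IsPGroup p (P.subgroupOf K) := hP.comap_of_injective _ K.subtype_injective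
  obtain ⟨T, hT⟩ := h1.exists_le_sylow
  obtain ⟨n, hn, hn'⟩ := hP.exists_conj_mem_of_relIndex hN
    (K := (T : Subgroup K).map K.subtype) (T.2.map _) (by
      rintro _ ⟨x, -, rfl⟩
      exact hK x.2)
  have h2 : P.subgroupOf K = T := by
    refine Subgroup.eq_of_le_of_card_ge hT ?_
    refine Nat.card_le_card_of_injective
      (fun t : T => (⟨⟨n * (t : K) * n⁻¹, hinv n hn _ (t : K).2⟩,
        hn' _ ⟨t, t.2, rfl⟩⟩ : P.subgroupOf K)) ?_
    intro s t hst
    have h3 : n * ((s : K) : G) * n⁻¹ = n * ((t : K) : G) * n⁻¹ :=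
      congrArg (fun z : P.subgroupOf K => ((z : K) : G)) hst
    exact Subtype.ext (Subtype.ext (mul_left_cancel (mul_right_cancel h3)))
  have h3 : P.relIndex K = (T : Subgroup K).index := congrArg Subgroup.index h2
  rw [h3]
  exact T.not_dvd_index

namespace LocalFusion

variable {G : Type*} [Group G] [Finite G] {P Φ A : Subgroup G}

theorem exists_conj_mem (h : LocalFusion P Φ A) {K : Subgroup G}
    (hK : K ≤ Subgroup.normalizer (A : Set G))
    (hinv : ∀ n ∈ Subgroup.normalizer (A : Set G), ∀ m ∈ K, n * m * n⁻¹ ∈ K)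
    {n : G} (hn : n ∈ K) {k : ℕ} (hk : n ^ 2 ^ k = 1) : ∃ m ∈ K, m * n * m⁻¹ ∈ P := by
  obtain ⟨m, hm, hm'⟩ := h.isPGroup.exists_conj_mem_of_relIndex
    (not_dvd_relIndex_of_normalized h.isPGroup h.not_dvd hK hinv)
    (K := Subgroup.zpowers n) (by
      rintro ⟨_, i, rfl⟩
      refine ⟨k, Subtype.ext ?_⟩
      change (n ^ i) ^ 2 ^ k = 1
      rw [← zpow_natCast, zpow_comm, zpow_natCast, hk, one_zpow]) (by simpa using hn)
  exact ⟨m, hm, hm' n (Subgroup.mem_zpowers n)⟩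

theorem of_normal (h : LocalFusion P Φ A) {K : Subgroup G}
    (hK : K ≤ A.actsTriviallyMod Φ)
    (hinv : ∀ n ∈ Subgroup.normalizer (A : Set G), ∀ m ∈ K, n * m * n⁻¹ ∈ K)
    {s : G} (hsP : s ∈ P) (hsK : s ∈ K) (hsA : s ∉ A) :
    Subgroup.normalizer (A : Set G) ≤ A.actsTriviallyMod Φ := by
  intro n hn
  have hKN : K ≤ Subgroup.normalizer (A : Set G) := fun k hk => (hK hk).1
  obtain ⟨m, hm, hm'⟩ := h.isPGroup.exists_conj_mem_of_relIndex
    (not_dvd_relIndex_of_normalized h.isPGroup h.not_dvd hKN hinv)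
    (K := (P ⊓ K).map (MulAut.conj n).toMonoidHom) ((h.isPGroup.to_le inf_le_left).map _) (by
      rintro _ ⟨x, hx, rfl⟩
      exact hinv n hn x hx.2)
  have hmn : m * n ∈ Subgroup.normalizer (A : Set G) := mul_mem (hKN hm) hn
  have hmnΦ : m * n ∈ A.actsTriviallyMod Φ := by
    refine ⟨hmn, fun a ha => ?_⟩
    refine h.extend (A ⊔ (P ⊓ K)) (sup_le h.le inf_le_left) ?_ (m * n) ?_ a
      (Subgroup.mem_sup_left ha)
    · exact left_lt_sup.2 fun hc => hsA (hc ⟨hsP, hsK⟩)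
    · have : A ⊔ (P ⊓ K) ≤ P.comap (MulAut.conj (m * n)).toMonoidHom := by
        refine sup_le (fun a ha => ?_) (fun k hk => ?_)
        · exact h.le ((Subgroup.mem_normalizer_iff.1 hmn a).1 ha)
        · have := hm' _ ⟨k, hk, rfl⟩
          change m * n * k * (m * n)⁻¹ ∈ P
          simpa [mul_assoc] using this
      exact fun u hu => this hu
  have := mul_mem (inv_mem (hK hm)) hmnΦ
  simpa using this

theorem of_invariant (h : LocalFusion P Φ A) {Y : Subgroup G} (hY : Y ≤ Φ)
    (hinv : ∀ n ∈ Subgroup.normalizer (A : Set G), ∀ y ∈ Y, n * y * n⁻¹ ∈ Y)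
    {s : G} (hsP : s ∈ P) (hsA : s ∉ A) (hsN : s ∈ Subgroup.normalizer (A : Set G))
    (hs : ∀ a ∈ A, a⁻¹ * (s * a * s⁻¹) ∈ Y) :
    Subgroup.normalizer (A : Set G) ≤ A.actsTriviallyMod Φ := by
  refine h.of_normal (K := A.actsTriviallyMod Y) (fun n hn => ⟨hn.1, fun a ha => hY (hn.2 a ha)⟩)
    ?_ hsP ⟨hsN, hs⟩ hsA
  rintro n hn m ⟨hm, hm'⟩
  refine ⟨mul_mem (mul_mem hn hm) (inv_mem hn), fun a ha => ?_⟩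
  have h1 := (Subgroup.mem_normalizer_iff.1 (inv_mem hn) a).1 ha
  have := hinv n hn _ (hm' _ h1)
  simpa [mul_assoc] using this

/-- If `A` is not self-centralising in `P`, its normaliser acts trivially modulo `Φ`. -/
theorem of_centralizer (h : LocalFusion P Φ A) {s : G} (hsP : s ∈ P) (hsA : s ∉ A)
    (hs : ∀ a ∈ A, s * a = a * s) :
    Subgroup.normalizer (A : Set G) ≤ A.actsTriviallyMod Φ := by
  have hs' : ∀ a ∈ A, s * a * s⁻¹ = a := fun a ha => by rw [hs a ha, mul_inv_cancel_right]
  have hs'' : ∀ a ∈ A, s⁻¹ * a * s = a := fun a ha => by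
    rw [mul_assoc, ← hs a ha, inv_mul_cancel_left]
  refine h.of_invariant (Y := ⊥) bot_le (by simp) hsP hsA ?_ (by
    intro a ha; rw [hs' a ha]; simp)
  rw [Subgroup.mem_normalizer_iff]
  refine fun a => ⟨fun ha => by rwa [hs' a ha], fun ha => ?_⟩
  have := hs'' _ ha
  have e : a = s * a * s⁻¹ := by simpa [mul_assoc] using this
  rw [e]; exact ha

end LocalFusion

/-- The structure of a bicyclic `2`-group `P` whose commutator subgroup `e R` is not cyclic.
Here `M` is a subgroup of index `2` in `P` and `Φ` is the Frattini subgroup of `P`. -/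
structure BicyclicModel {G R : Type*} [Group G] [CommRing R] (P M Φ : Subgroup G) (e : R → G)
    (x b : G) (ξ : R) (μ : ℕ) : Prop where
  e_add : ∀ r s, e (r + s) = e r * e s
  e_inj : Function.Injective e
  e_mem : ∀ r, e r ∈ Φ
  M_le : M ≤ P
  Φ_le : Φ ≤ M
  x_mem : x ∈ P
  b_mem : b ∈ M
  x_not_mem : x ∉ M
  b_not_mem : b ∉ Φ
  x_sq_mem : x * x ∈ Φ
  index_M : ∀ u ∈ P, ∀ v ∈ P, u ∉ M → v ∉ M → u⁻¹ * v ∈ M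
  index_Φ : ∀ u ∈ M, ∀ v ∈ M, u ∉ Φ → v ∉ Φ → u⁻¹ * v ∈ Φ
  frattini : ∀ K : Subgroup G, K ≤ P → P ≤ K ⊔ Φ → P ≤ K
  comm : ∀ u ∈ P, ∀ v ∈ P, ∃ r, u * v * u⁻¹ * v⁻¹ = e r
  e_comm : ∀ r, e r ∈ ⁅P, P⁆
  x_conj : ∀ r, x * e r * x⁻¹ = e ((1 + ξ) * r)
  b_conj : ∃ ρ, ∀ r, b * e r * b⁻¹ = e ((-1 + 2 * ξ * ρ) * r)
  x_b : ∃ t, IsUnit t ∧ x * b * x⁻¹ = e t * b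
  b_sq : ∃ β, b * b = e β
  two_le : 2 ≤ μ
  x_pow : ∃ η, x ^ 2 ^ μ = e (ξ + 2 * η)
  dvd_of_x_pow : ∀ (k : ℕ) r, x ^ k = e r → 2 ^ μ ∣ k
  rep : ∀ u ∈ P, ∃ (k : ℕ) (r : R), u = x ^ k * e r ∨ u = x ^ k * b * e r
  ξ_sq : ∃ σ, ξ ^ 2 = 2 * ξ * σ
  span : ∀ r : R, ∃ m n : ℤ, r = m + n * ξ
  indep : ∀ (m n : ℤ) (s : R), (m + n * ξ : R) = 2 * s → 2 ∣ m ∧ 2 ∣ n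
  nil : IsNilpotent (2 : R)

namespace BicyclicModel

variable {G R : Type*} [Group G] [CommRing R] {P M Φ : Subgroup G} {e : R → G} {x b : G}
  {ξ : R} {μ : ℕ}

section ring

variable (h : BicyclicModel P M Φ e x b ξ μ)
include h

theorem nil_ξ : IsNilpotent ξ := by
  obtain ⟨σ, hσ⟩ := h.ξ_sq
  have : IsNilpotent (ξ ^ 2) := by
    rw [hσ, mul_assoc]; exact (Commute.all _ _).isNilpotent_mul_right h.nil
  exact (IsNilpotent.pow_iff_pos two_ne_zero).1 this

theorem nontrivial : Nontrivial R := by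
  refine ⟨1, 0, fun h1 => ?_⟩
  have := h.indep 1 0 0 (by simp [h1])
  omega

theorem nil_two_mul_add (r s : R) : IsNilpotent (2 * r + ξ * s) :=
  (Commute.all _ _).isNilpotent_add ((Commute.all _ _).isNilpotent_mul_right h.nil)
    ((Commute.all _ _).isNilpotent_mul_right h.nil_ξ)

theorem isUnit_add {t : R} (ht : IsUnit t) (r s : R) : IsUnit (t + (2 * r + ξ * s)) :=
  (h.nil_two_mul_add r s).isUnit_add_left_of_commute ht (Commute.all _ _)

theorem isUnit_or (r : R) : (∃ s t, r = 2 * s + ξ * t) ∨ IsUnit r := by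
  obtain ⟨m, n, rfl⟩ := h.span r
  rcases Int.even_or_odd' m with ⟨k, rfl | rfl⟩
  · left; exact ⟨k, n, by push_cast; ring⟩
  · right
    convert h.isUnit_add isUnit_one k n using 1
    push_cast; ring

theorem not_isUnit (s t : R) : ¬ IsUnit (2 * s + ξ * t) := by
  have := h.nontrivial
  exact fun hu => (h.nil_two_mul_add s t).not_isUnit hu

theorem unit_form {t : R} (ht : IsUnit t) : ∃ s v, t = 1 + (2 * s + ξ * v) := by
  obtain ⟨m, n, rfl⟩ := h.span t
  rcases Int.even_or_odd' m with ⟨k, rfl | rfl⟩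
  · exfalso
    refine h.not_isUnit k n ?_
    convert ht using 1
    push_cast; ring
  · exact ⟨k, n, by push_cast; ring⟩

theorem ξ_mul_unit {t : R} (ht : IsUnit t) : ∃ s, ξ * t = ξ + 2 * s := by
  obtain ⟨s, v, rfl⟩ := h.unit_form ht
  obtain ⟨σ, hσ⟩ := h.ξ_sq
  exact ⟨ξ * s + ξ * σ * v, by linear_combination v * hσ⟩

theorem ξ_ne (s : R) : ξ ≠ 2 * s := by
  intro h1
  have := h.indep 0 1 s (by simpa using h1)
  omega

theorem ξ_mul_unit_ne {t : R} (ht : IsUnit t) (s : R) : ξ * t ≠ 2 * s := by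
  obtain ⟨v, hv⟩ := h.ξ_mul_unit ht
  intro h1
  exact h.ξ_ne (s - v) (by linear_combination h1 - hv)

theorem one_add_pow_two_mul (k : ℕ) : ∃ ω, (1 + ξ) ^ (2 * k) = 1 + 2 * ξ * ω := by
  obtain ⟨σ, hσ⟩ := h.ξ_sq
  induction k with
  | zero => exact ⟨0, by simp⟩
  | succ k ih =>
    obtain ⟨ω, hω⟩ := ih
    refine ⟨ω * (1 + ξ) ^ 2 + (1 + σ), ?_⟩
    rw [mul_add, pow_add, hω]
    linear_combination hσ

theorem one_add_pow_odd (k : ℕ) :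
    ∃ ω, IsUnit ω ∧ (1 + ξ) ^ (2 * k + 1) = 1 + ξ * ω := by
  obtain ⟨ω, hω⟩ := h.one_add_pow_two_mul k
  refine ⟨1 + (2 * (ω * (1 + ξ)) + ξ * 0), h.isUnit_add isUnit_one _ _, ?_⟩
  rw [pow_succ, hω]; ring

theorem isUnit_one_add : IsUnit (1 + ξ) := by
  simpa using h.isUnit_add isUnit_one 0 1

end ring

section elements

theorem conj_mul_e {u v : G} {a c : R} (hu : ∀ r, u * e r * u⁻¹ = e (a * r))
    (hv : ∀ r, v * e r * v⁻¹ = e (c * r)) (r : R) :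
    (u * v) * e r * (u * v)⁻¹ = e (a * c * r) := by
  rw [mul_assoc a, ← hu, ← hv]; group

variable (h : BicyclicModel P M Φ e x b ξ μ)
include h

theorem e_zero : e 0 = 1 := by
  have := h.e_add 0 0
  simpa using this

theorem e_neg (r : R) : e (-r) = (e r)⁻¹ := by
  rw [eq_inv_iff_mul_eq_one, ← h.e_add, neg_add_cancel, h.e_zero]

theorem e_nsmul (n : ℕ) (r : R) : e (n * r) = e r ^ n := by
  induction n with
  | zero => simp [h.e_zero]
  | succ n ih => rw [pow_succ, ← ih, ← h.e_add]; congr 1; push_cast; ring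

theorem e_eq_one {r : R} : e r = 1 ↔ r = 0 := by
  rw [← h.e_zero]; exact h.e_inj.eq_iff

theorem e_comm' (r s : R) : e r * e s = e s * e r := by
  rw [← h.e_add, add_comm, h.e_add]

theorem Φ_le_P : Φ ≤ P := h.Φ_le.trans h.M_le

theorem x_pow_conj (k : ℕ) (r : R) : x ^ k * e r * (x ^ k)⁻¹ = e ((1 + ξ) ^ k * r) := by
  induction k generalizing r with
  | zero => simp
  | succ k ih =>
    calc x ^ (k + 1) * e r * (x ^ (k + 1))⁻¹ = x ^ k * (x * e r * x⁻¹) * (x ^ k)⁻¹ := by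
          rw [pow_succ]; group
      _ = _ := by rw [h.x_conj, ih]; congr 1; ring

theorem x_pow_even_mem (k : ℕ) : x ^ (2 * k) ∈ Φ := by
  rw [pow_mul, pow_two]; exact pow_mem h.x_sq_mem k

theorem x_pow_mem_M {k : ℕ} (hk : x ^ k ∈ M) : Even k := by
  by_contra hc
  obtain ⟨j, rfl⟩ := Nat.not_even_iff_odd.1 hc
  rw [pow_succ] at hk
  exact h.x_not_mem ((Subgroup.mul_mem_cancel_left M (h.Φ_le (h.x_pow_even_mem j))).1 hk)

theorem Φ_form {u : G} (hu : u ∈ Φ) : ∃ (k : ℕ) (r : R), u = x ^ (2 * k) * e r := by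
  obtain ⟨k, r, rfl | rfl⟩ := h.rep u (h.Φ_le_P hu)
  · obtain ⟨j, hj⟩ := h.x_pow_mem_M (h.Φ_le ((Subgroup.mul_mem_cancel_right Φ (h.e_mem r)).1 hu))
    exact ⟨j, r, by rw [hj]; congr 2; ring⟩
  · have h1 := (Subgroup.mul_mem_cancel_right Φ (h.e_mem r)).1 hu
    obtain ⟨j, hj⟩ := h.x_pow_mem_M ((Subgroup.mul_mem_cancel_right M h.b_mem).1 (h.Φ_le h1))
    have h2 : x ^ k ∈ Φ := by
      have := h.x_pow_even_mem j
      rwa [show 2 * j = k by omega] at this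
    exact absurd ((Subgroup.mul_mem_cancel_left Φ h2).1 h1) h.b_not_mem

theorem M_form {u : G} (hu : u ∈ M) (hu' : u ∉ Φ) :
    ∃ (k : ℕ) (r : R), u = x ^ (2 * k) * b * e r := by
  obtain ⟨k, r, rfl | rfl⟩ := h.rep u (h.M_le hu)
  · obtain ⟨j, hj⟩ :=
      h.x_pow_mem_M ((Subgroup.mul_mem_cancel_right M (h.Φ_le (h.e_mem r))).1 hu)
    refine absurd (mul_mem ?_ (h.e_mem r)) hu'
    have := h.x_pow_even_mem j
    rwa [show 2 * j = k by omega] at this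
  · have h1 := (Subgroup.mul_mem_cancel_right M (h.Φ_le (h.e_mem r))).1 hu
    obtain ⟨j, hj⟩ := h.x_pow_mem_M ((Subgroup.mul_mem_cancel_right M h.b_mem).1 h1)
    exact ⟨j, r, by rw [hj]; congr 3; ring⟩

theorem P_form {u : G} (hu : u ∈ P) (hu' : u ∉ M) :
    ∃ (k : ℕ) (r : R), u = x ^ (2 * k + 1) * e r ∨ u = x ^ (2 * k + 1) * b * e r := by
  obtain ⟨k, r, hkr⟩ := h.rep u hu
  have hodd : Odd k := by
    by_contra hc
    obtain ⟨j, hj⟩ := Nat.not_odd_iff_even.1 hc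
    have h1 : x ^ k ∈ M := by
      have := h.Φ_le (h.x_pow_even_mem j)
      rwa [show 2 * j = k by omega] at this
    apply hu'
    rcases hkr with rfl | rfl
    · exact mul_mem h1 (h.Φ_le (h.e_mem r))
    · exact mul_mem (mul_mem h1 h.b_mem) (h.Φ_le (h.e_mem r))
  obtain ⟨j, rfl⟩ := hodd
  exact ⟨j, r, hkr⟩

theorem conj_e_mul {u : G} {a : R} (hu : ∀ r, u * e r * u⁻¹ = e (a * r)) (s r : R) :
    (u * e s) * e r * (u * e s)⁻¹ = e (a * r) := by
  rw [← hu r]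
  have := h.e_comm' s r
  calc (u * e s) * e r * (u * e s)⁻¹ = u * (e s * e r) * (e s)⁻¹ * u⁻¹ := by group
    _ = _ := by rw [this]; group

theorem conj_of_mem_Φ {u : G} (hu : u ∈ Φ) :
    ∃ ω, ∀ r, u * e r * u⁻¹ = e ((1 + 2 * ξ * ω) * r) := by
  obtain ⟨k, s, rfl⟩ := h.Φ_form hu
  obtain ⟨ω, hω⟩ := h.one_add_pow_two_mul k
  exact ⟨ω, h.conj_e_mul (fun r => by rw [h.x_pow_conj, hω]) s⟩

theorem conj_of_mem_M {u : G} (hu : u ∈ M) (hu' : u ∉ Φ) :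
    ∃ ω, ∀ r, u * e r * u⁻¹ = e ((-1 + 2 * ξ * ω) * r) := by
  obtain ⟨k, s, rfl⟩ := h.M_form hu hu'
  obtain ⟨ω, hω⟩ := h.one_add_pow_two_mul k
  obtain ⟨ρ, hρ⟩ := h.b_conj
  refine ⟨ρ - ω + 2 * ξ * ω * ρ, fun r => ?_⟩
  rw [h.conj_e_mul (conj_mul_e (fun r => by rw [h.x_pow_conj, hω]) hρ) s]
  congr 1; ring

theorem conj_of_not_mem_M {u : G} (hu : u ∈ P) (hu' : u ∉ M) :
    ∃ ω, IsUnit ω ∧ ((∀ r, u * e r * u⁻¹ = e ((1 + ξ * ω) * r)) ∨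
      (∀ r, u * e r * u⁻¹ = e (-(1 + ξ * ω) * r))) := by
  obtain ⟨k, s, hks⟩ := h.P_form hu hu'
  obtain ⟨ω, hωu, hω⟩ := h.one_add_pow_odd k
  obtain ⟨ρ, hρ⟩ := h.b_conj
  rcases hks with rfl | rfl
  · exact ⟨ω, hωu, Or.inl (h.conj_e_mul (fun r => by rw [h.x_pow_conj, hω]) s)⟩
  · refine ⟨ω + (2 * (-ρ * (1 + ξ * ω)) + ξ * 0), h.isUnit_add hωu _ _, Or.inr fun r => ?_⟩
    rw [h.conj_e_mul (conj_mul_e (fun r => by rw [h.x_pow_conj, hω]) hρ) s]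
    congr 1; ring

/-- Elements of `P` act on the commutator subgroup by ring elements congruent to `1`
modulo the maximal ideal. -/
theorem conj_form {u : G} (hu : u ∈ P) :
    ∃ s t, ∀ r, u * e r * u⁻¹ = e ((1 + (2 * s + ξ * t)) * r) := by
  by_cases hM : u ∈ M
  · by_cases hΦ : u ∈ Φ
    · obtain ⟨ω, hω⟩ := h.conj_of_mem_Φ hΦ
      exact ⟨ξ * ω, 0, fun r => by rw [hω]; congr 1; ring⟩
    · obtain ⟨ω, hω⟩ := h.conj_of_mem_M hM hΦ
      exact ⟨-1 + ξ * ω, 0, fun r => by rw [hω]; congr 1; ring⟩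
  · obtain ⟨ω, -, hω | hω⟩ := h.conj_of_not_mem_M hu hM
    · exact ⟨0, ω, fun r => by rw [hω]; congr 1; ring⟩
    · exact ⟨-1, -ω, fun r => by rw [hω]; congr 1; ring⟩

theorem conj_e_exists {u : G} (hu : u ∈ P) (r : R) : ∃ s, u * e r = e s * u := by
  obtain ⟨a, c, hac⟩ := h.conj_form hu
  exact ⟨_, by rw [← hac r]; group⟩

/-- Elements of order dividing two in the commutator subgroup commute with `M`. -/
theorem commute_of_two_mul {u : G} (hu : u ∈ M) {r : R} (hr : 2 * r = 0) :
    u * e r = e r * u := by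
  have key : u * e r * u⁻¹ = e r := by
    by_cases hΦ : u ∈ Φ
    · obtain ⟨ω, hω⟩ := h.conj_of_mem_Φ hΦ
      rw [hω]; congr 1; linear_combination ξ * ω * hr
    · obtain ⟨ω, hω⟩ := h.conj_of_mem_M hu hΦ
      rw [hω]; congr 1; linear_combination (ξ * ω - 1) * hr
  rw [← mul_inv_eq_iff_eq_mul, key]

theorem two_mul_of_commute {u : G} (hu : u ∈ M) (hu' : u ∉ Φ) {r : R}
    (hr : u * e r = e r * u) : 2 * r = 0 := by
  obtain ⟨ω, hω⟩ := h.conj_of_mem_M hu hu'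
  have h1 := hω r
  rw [hr, mul_inv_cancel_right] at h1
  have h2 := h.e_inj h1
  have hunit : IsUnit (1 + (2 * 0 + ξ * (-ω))) := h.isUnit_add isUnit_one _ _
  have h3 : (1 + (2 * 0 + ξ * (-ω))) * (2 * r) = 0 := by linear_combination h2
  exact (hunit.mul_right_eq_zero).1 h3

/-- Conjugates of elements of `M` outside `Φ`. -/
theorem x_conj_M {u : G} (hu : u ∈ M) (hu' : u ∉ Φ) :
    ∃ t, IsUnit t ∧ x * u * x⁻¹ = e t * u := by
  obtain ⟨ω, hω⟩ := h.conj_of_mem_M hu hu'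
  obtain ⟨k, r, hk⟩ := h.M_form hu hu'
  obtain ⟨t, ht, hxb⟩ := h.x_b
  refine ⟨(1 + ξ) ^ (2 * k) * t + (2 * 0 + ξ * ((-1 + 2 * ξ * ω) * r)),
    h.isUnit_add ((h.isUnit_one_add.pow _).mul ht) _ _, ?_⟩
  have e1 : (-1 + 2 * ξ * ω) * (ξ * r) = 2 * 0 + ξ * ((-1 + 2 * ξ * ω) * r) := by ring
  rw [← e1, h.e_add, ← hω, ← h.x_pow_conj]
  have e2 : x * u * x⁻¹ = x ^ (2 * k) * (x * b * x⁻¹) * (x * e r * x⁻¹) := by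
    rw [hk]
    calc x * (x ^ (2 * k) * b * e r) * x⁻¹ = (x * x ^ (2 * k)) * b * e r * x⁻¹ := by group
      _ = (x ^ (2 * k) * x) * b * e r * x⁻¹ := by rw [← pow_succ', pow_succ]
      _ = _ := by group
  have e3 : e ((1 + ξ) * r) = e r * e (ξ * r) := by rw [← h.e_add]; congr 1; ring
  rw [e2, hxb, h.x_conj, e3]
  calc x ^ (2 * k) * (e t * b) * (e r * e (ξ * r))
      = x ^ (2 * k) * e t * (x ^ (2 * k))⁻¹ * (x ^ (2 * k) * b * e r) * e (ξ * r) := by group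
    _ = x ^ (2 * k) * e t * (x ^ (2 * k))⁻¹ * u * e (ξ * r) := by rw [← hk]
    _ = _ := by group

theorem x_sq_conj_M {u : G} {t : R} (hxu : x * u * x⁻¹ = e t * u) :
    x ^ 2 * u * (x ^ 2)⁻¹ = e ((2 + ξ) * t) * u := by
  calc x ^ 2 * u * (x ^ 2)⁻¹ = x * (x * u * x⁻¹) * x⁻¹ := by
        rw [pow_two, mul_inv_rev]; simp only [mul_assoc]
    _ = x * (e t * u) * x⁻¹ := by rw [hxu]
    _ = (x * e t * x⁻¹) * (x * u * x⁻¹) := by group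
    _ = _ := by
      rw [hxu, h.x_conj, ← mul_assoc, ← h.e_add]; congr 2; ring

theorem x_pow_even_conj_M (k : ℕ) :
    ∃ a, (1 + ξ) ^ (2 * k) = 1 + ξ * (2 + ξ) * a ∧ ∀ u t, x * u * x⁻¹ = e t * u →
      x ^ (2 * k) * u * (x ^ (2 * k))⁻¹ = e ((2 + ξ) * a * t) * u := by
  induction k with
  | zero => exact ⟨0, by simp, by simp [h.e_zero]⟩
  | succ k ih =>
    obtain ⟨a, ha', ha⟩ := ih
    refine ⟨(1 + ξ) ^ 2 * a + 1, ?_, fun u t hxu => ?_⟩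
    · rw [mul_add, pow_add, ha']; ring
    calc x ^ (2 * (k + 1)) * u * (x ^ (2 * (k + 1)))⁻¹
        = x ^ 2 * (x ^ (2 * k) * u * (x ^ (2 * k))⁻¹) * (x ^ 2)⁻¹ := by
          rw [mul_add, mul_one, add_comm, pow_add]; group
      _ = (x ^ 2 * e ((2 + ξ) * a * t) * (x ^ 2)⁻¹) * (x ^ 2 * u * (x ^ 2)⁻¹) := by
          rw [ha u t hxu]; group
      _ = _ := by
        rw [h.x_pow_conj, h.x_sq_conj_M hxu, ← mul_assoc, ← h.e_add]; congr 2; ring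

/-- Conjugation by an element of `P` outside `M` moves an element of `M` outside `Φ` by a
generator of the commutator subgroup, conjugation by an element of `M` by a non-generator. -/
theorem conj_M {u v : G} (hu : u ∈ M) (hu' : u ∉ Φ) (hv : v ∈ P) :
    ∃ t, v * u * v⁻¹ = e t * u ∧ (IsUnit t ↔ v ∉ M) := by
  obtain ⟨t₁, ht₁, hxu⟩ := h.x_conj_M hu hu'
  obtain ⟨ω, hω⟩ := h.conj_of_mem_M hu hu'
  have hes : ∀ s, e s * u * (e s)⁻¹ = e (2 * ((1 - ξ * ω) * s)) * u := by
    intro s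
    have h1 := hω (-s)
    rw [h.e_neg] at h1
    calc e s * u * (e s)⁻¹ = e s * (u * (e s)⁻¹ * u⁻¹) * u := by group
      _ = _ := by rw [h1, ← h.e_add]; congr 2; ring
  have hΦ : ∀ f ∈ Φ, ∃ s t, f * u * f⁻¹ = e (2 * s + ξ * t) * u := by
    intro f hf
    obtain ⟨k, s, rfl⟩ := h.Φ_form hf
    obtain ⟨a, -, ha⟩ := h.x_pow_even_conj_M k
    refine ⟨(1 + ξ) ^ (2 * k) * ((1 - ξ * ω) * s) + a * t₁, a * t₁, ?_⟩
    calc (x ^ (2 * k) * e s) * u * (x ^ (2 * k) * e s)⁻¹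
        = x ^ (2 * k) * (e s * u * (e s)⁻¹) * (x ^ (2 * k))⁻¹ := by group
      _ = (x ^ (2 * k) * e (2 * ((1 - ξ * ω) * s)) * (x ^ (2 * k))⁻¹) *
          (x ^ (2 * k) * u * (x ^ (2 * k))⁻¹) := by rw [hes]; group
      _ = _ := by rw [h.x_pow_conj, ha u t₁ hxu, ← mul_assoc, ← h.e_add]; congr 2; ring
  have hM : ∀ f ∈ M, ∃ s t, f * u * f⁻¹ = e (2 * s + ξ * t) * u := by
    intro f hf
    by_cases hf' : f ∈ Φ
    · exact hΦ f hf'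
    · have h1 := h.index_Φ f⁻¹ (inv_mem hf) u⁻¹ (inv_mem hu) (by simpa using hf') (by simpa using hu')
      obtain ⟨s, t, hst⟩ := hΦ _ h1
      exact ⟨s, t, by rw [← hst]; group⟩
  by_cases hvM : v ∈ M
  · obtain ⟨s, t, hst⟩ := hM v hvM
    exact ⟨_, hst, by simpa [hvM] using h.not_isUnit s t⟩
  · have h1 := h.index_M x h.x_mem v hv h.x_not_mem hvM
    obtain ⟨s, t, hst⟩ := hM _ h1
    refine ⟨t₁ + (2 * ((1 + ξ) * s) + ξ * ((1 + ξ) * t)), ?_, ?_⟩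
    · calc v * u * v⁻¹ = x * ((x⁻¹ * v) * u * (x⁻¹ * v)⁻¹) * x⁻¹ := by group
        _ = (x * e (2 * s + ξ * t) * x⁻¹) * (x * u * x⁻¹) := by rw [hst]; group
        _ = _ := by rw [h.x_conj, hxu, ← mul_assoc, ← h.e_add]; congr 2; ring
    · simpa [hvM] using h.isUnit_add ht₁ _ _

/-- The conjugacy class of an element of `M` outside `Φ` is a coset of the commutator
subgroup. -/
theorem exists_conj_M {u : G} (hu : u ∈ M) (hu' : u ∉ Φ) (r : R) :
    ∃ v ∈ P, v * u * v⁻¹ = e r * u := by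
  obtain ⟨t, ht, hxu⟩ := h.x_conj_M hu hu'
  obtain ⟨ω, hω⟩ := h.conj_of_mem_M hu hu'
  have hunit : IsUnit (1 + (2 * 0 + ξ * (-ω))) := h.isUnit_add isUnit_one _ _
  obtain ⟨w, hw⟩ := hunit
  have hes : ∀ s, e (↑w⁻¹ * s) * u * (e (↑w⁻¹ * s))⁻¹ = e (2 * s) * u := by
    intro s
    have h1 := hω (-(↑w⁻¹ * s))
    rw [h.e_neg] at h1
    have hw' : (w : R) * (↑w⁻¹ * s) = s := by rw [← mul_assoc, Units.mul_inv, one_mul]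
    calc _ = e (↑w⁻¹ * s) * (u * (e (↑w⁻¹ * s))⁻¹ * u⁻¹) * u := by group
      _ = _ := by
        rw [h1, ← h.e_add]; congr 2; linear_combination 2 * hw' - 2 * (↑w⁻¹ * s) * hw
  have hadj : ∀ v ∈ P, ∀ t s : R, v * u * v⁻¹ = e t * u → ∃ v' ∈ P, v' * u * v'⁻¹ = e (t + 2 * s) * u := by
    intro v hv t s hvt
    refine ⟨e (↑w⁻¹ * s) * v, mul_mem (h.Φ_le_P (h.e_mem _)) hv, ?_⟩
    calc e (↑w⁻¹ * s) * v * u * (e (↑w⁻¹ * s) * v)⁻¹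
        = e (↑w⁻¹ * s) * (v * u * v⁻¹) * (e (↑w⁻¹ * s))⁻¹ := by group
      _ = e (↑w⁻¹ * s) * e t * u * (e (↑w⁻¹ * s))⁻¹ := by rw [hvt]; group
      _ = e t * (e (↑w⁻¹ * s) * u * (e (↑w⁻¹ * s))⁻¹) := by rw [h.e_comm']; group
      _ = _ := by rw [hes, h.e_add]; group
  have hx2 := h.x_sq_conj_M hxu
  obtain ⟨c, hc⟩ := h.ξ_mul_unit ht
  obtain ⟨σ, hσ⟩ := h.ξ_sq
  have hstep : ∀ v ∈ P, ∀ s : R, v * u * v⁻¹ = e s * u →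
      ∃ v' ∈ P, v' * u * v'⁻¹ = e (s + ξ) * u := by
    intro v hv s hvs
    obtain ⟨m, n, hmn⟩ := h.span s
    obtain ⟨v', hv', hvv⟩ := hadj (x ^ 2 * v) (mul_mem (pow_mem h.x_mem 2) hv)
      ((1 + ξ) ^ 2 * s + (2 + ξ) * t) (- (ξ * (1 + σ) * s) - t - c) (by
        calc x ^ 2 * v * u * (x ^ 2 * v)⁻¹ = x ^ 2 * (v * u * v⁻¹) * (x ^ 2)⁻¹ := by group
          _ = (x ^ 2 * e s * (x ^ 2)⁻¹) * (x ^ 2 * u * (x ^ 2)⁻¹) := by rw [hvs]; group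
          _ = _ := by rw [h.x_pow_conj, hx2, ← mul_assoc, ← h.e_add])
    refine ⟨v', hv', ?_⟩
    rw [hvv]; congr 2
    linear_combination s * hσ + hc
  have h0 : (1 : G) * u * 1⁻¹ = e 0 * u := by simp [h.e_zero]
  obtain ⟨m, n, rfl⟩ := h.span r
  obtain ⟨s₁, v₁, hu₁⟩ := h.unit_form ht
  obtain ⟨m₁, n₁, hv₁⟩ := h.span v₁
  have base : ∀ s, (∃ v ∈ P, v * u * v⁻¹ = e s * u) → ∀ n : ℤ, ∃ v ∈ P, v * u * v⁻¹ = e (s + n * ξ) * u := by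
    rintro s ⟨v, hv, hvs⟩ n
    rcases Int.even_or_odd' n with ⟨k, rfl | rfl⟩
    · obtain ⟨v', hv', h'⟩ := hadj v hv s (k * ξ) hvs
      exact ⟨v', hv', by rw [h']; congr 2; push_cast; ring⟩
    · obtain ⟨v'', hv'', h''⟩ := hstep v hv s hvs
      obtain ⟨v', hv', h'⟩ := hadj v'' hv'' _ (k * ξ) h''
      exact ⟨v', hv', by rw [h']; congr 2; push_cast; ring⟩
  apply base
  rcases Int.even_or_odd' m with ⟨k, rfl | rfl⟩
  · obtain ⟨v', hv', h'⟩ := hadj 1 (one_mem _) 0 k h0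
    exact ⟨v', hv', by rw [h']; congr 2; push_cast; ring⟩
  · obtain ⟨v'', hv'', h''⟩ := base t ⟨x, h.x_mem, hxu⟩ (-m₁)
    obtain ⟨v', hv', h'⟩ := hadj v'' hv'' _ (k - s₁ - n₁ * σ * ξ) h''
    refine ⟨v', hv', ?_⟩
    rw [h']; congr 2
    push_cast
    rw [hu₁, hv₁]
    linear_combination n₁ * hσ

theorem mul_pow_form {u v : G} (hu : u ∈ P) (hv : v ∈ P) (n : ℕ) :
    ∃ r, (u * v) ^ n = u ^ n * v ^ n * e r := by
  induction n with
  | zero => exact ⟨0, by simp [h.e_zero]⟩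
  | succ n ih =>
    obtain ⟨r, hr⟩ := ih
    obtain ⟨s, hs⟩ := h.comm (u⁻¹) (inv_mem hu) (v ^ n) (pow_mem hv n)
    obtain ⟨s', hs'⟩ := h.conj_e_exists (inv_mem (mul_mem hu hv)) r
    obtain ⟨s'', hs''⟩ := h.conj_e_exists (inv_mem (mul_mem (pow_mem hv n) hv)) s
    refine ⟨s'' + s', ?_⟩
    have e1 : u⁻¹ * v ^ n * u = e s * v ^ n := by
      rw [← hs]; group
    have e2 : e r * (u * v) = u * v * e s' := by
      have : u * v * ((u * v)⁻¹ * e r) * (u * v) = u * v * (e s' * (u * v)⁻¹) * (u * v) := by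
        rw [hs']
      simpa [mul_assoc] using this
    have e3 : e s * (v ^ n * v) = v ^ n * v * e s'' := by
      have : v ^ n * v * ((v ^ n * v)⁻¹ * e s) * (v ^ n * v) =
        v ^ n * v * (e s'' * (v ^ n * v)⁻¹) * (v ^ n * v) := by rw [hs'']
      simpa [mul_assoc] using this
    calc (u * v) ^ (n + 1) = u ^ n * v ^ n * (e r * (u * v)) := by rw [pow_succ, hr]; group
      _ = u ^ n * u * (u⁻¹ * v ^ n * u) * v * e s' := by rw [e2]; group
      _ = u ^ (n + 1) * (e s * (v ^ n * v)) * e s' := by rw [e1, pow_succ]; group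
      _ = _ := by rw [e3, ← pow_succ, h.e_add]; group

theorem x_pow_dvd {k : ℕ} (hk : 2 ^ μ ∣ k) :
    ∃ (j : ℕ) (η : R), k = 2 ^ μ * j ∧ x ^ k = e (j * ξ + 2 * η) := by
  obtain ⟨j, rfl⟩ := hk
  obtain ⟨η, hη⟩ := h.x_pow
  exact ⟨j, j * η, rfl, by rw [pow_mul, hη, ← h.e_nsmul]; congr 1; ring⟩

/-- Even powers, modulo the commutator subgroup. -/
theorem pow_two_mul_form {u : G} {k : ℕ} {r : R} (hu : u = x ^ k * e r ∨ u = x ^ k * b * e r)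
    (n : ℕ) : ∃ s, u ^ (2 * n) = x ^ (k * (2 * n)) * e s := by
  obtain ⟨β, hβ⟩ := h.b_sq
  have hx := pow_mem h.x_mem k
  have hb := h.M_le h.b_mem
  have he := h.Φ_le_P (h.e_mem r)
  rcases hu with rfl | rfl
  · obtain ⟨s, hs⟩ := h.mul_pow_form hx he (2 * n)
    exact ⟨(2 * n : ℕ) * r + s, by
      rw [hs, ← pow_mul, ← h.e_nsmul, h.e_add, mul_assoc]⟩
  · obtain ⟨s, hs⟩ := h.mul_pow_form (mul_mem hx hb) he (2 * n)
    obtain ⟨s', hs'⟩ := h.mul_pow_form hx hb (2 * n)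
    refine ⟨n * β + s' + ((2 * n : ℕ) * r + s), ?_⟩
    rw [hs, hs', pow_mul b, pow_two, hβ, ← pow_mul, ← h.e_nsmul, ← h.e_nsmul, h.e_add, h.e_add,
      h.e_add]
    group

theorem sq_mem_Φ {u : G} (hu : u ∈ P) : u ^ 2 ∈ Φ := by
  obtain ⟨k, r, hk⟩ := h.rep u hu
  obtain ⟨s, hs⟩ := h.pow_two_mul_form hk 1
  rw [mul_one] at hs
  rw [hs, mul_comm]
  exact mul_mem (h.x_pow_even_mem k) (h.e_mem s)

/-- The involutions of `Φ` lie in the commutator subgroup. -/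
theorem involution_Φ {u : G} (hu : u ∈ Φ) (hu2 : u ^ 2 = 1) : ∃ r, 2 * r = 0 ∧ u = e r := by
  suffices hr : ∃ r, u = e r by
    obtain ⟨r, rfl⟩ := hr
    refine ⟨r, ?_, rfl⟩
    rw [← h.e_nsmul, h.e_eq_one] at hu2
    exact_mod_cast hu2
  obtain ⟨k, r, rfl⟩ := h.Φ_form hu
  obtain ⟨ω, hω⟩ := h.conj_of_mem_Φ (inv_mem (h.x_pow_even_mem k))
  have h1 := hω r
  rw [inv_inv] at h1
  have h2 : (x ^ (2 * k) * e r) ^ 2 = x ^ (4 * k) * e (2 * ((1 + ξ * ω) * r)) := by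
    calc (x ^ (2 * k) * e r) ^ 2
        = x ^ (2 * k) * x ^ (2 * k) * ((x ^ (2 * k))⁻¹ * e r * x ^ (2 * k)) * e r := by
          rw [pow_two]; group
      _ = _ := by
        rw [h1, ← pow_add, mul_assoc, ← h.e_add]; congr 2 <;> ring
  rw [h2] at hu2
  have h3 : x ^ (4 * k) = e (-(2 * ((1 + ξ * ω) * r))) := by
    rw [h.e_neg]; exact eq_inv_of_mul_eq_one_left hu2
  obtain ⟨j, η, hj, hxj⟩ := h.x_pow_dvd (h.dvd_of_x_pow _ _ h3)
  have hje : Even j := by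
    by_contra hc
    obtain ⟨i, rfl⟩ := Nat.not_even_iff_odd.1 hc
    have h4 := h.e_inj (hxj.symm.trans h3)
    refine h.ξ_ne (-((1 + ξ * ω) * r) - η - i * ξ) ?_
    push_cast at h4
    linear_combination h4
  obtain ⟨i, rfl⟩ := hje
  obtain ⟨j', η', -, hxj'⟩ := h.x_pow_dvd (k := 2 * k) ⟨i, by
    have : 4 * k = 2 * (2 ^ μ * i) := by rw [hj]; ring
    omega⟩
  exact ⟨_, by rw [hxj', ← h.e_add]⟩

theorem involution_mem_M {u : G} (hu : u ∈ P) (hu2 : u ^ 2 = 1) : u ∈ M := by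
  by_contra hM
  obtain ⟨k, r, hk⟩ := h.P_form hu hM
  obtain ⟨s, hs⟩ := h.pow_two_mul_form hk 1
  rw [mul_one, hu2] at hs
  have := h.dvd_of_x_pow _ (-s) (by rw [h.e_neg]; exact eq_inv_of_mul_eq_one_left hs.symm)
  have h4 : 2 ^ 2 ∣ (2 * k + 1) * 2 := (pow_dvd_pow 2 h.two_le).trans this
  omega

end elements

end BicyclicModel

namespace Subgroup

variable {G : Type*} [Group G] {A : Subgroup G}

theorem conj_mem_of_mem_normalizer {n a : G} (hn : n ∈ normalizer (A : Set G)) (ha : a ∈ A) :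
    n * a * n⁻¹ ∈ A := (mem_normalizer_iff.1 hn a).1 ha

theorem conj_mem_of_mem_normalizer' {n a : G} (hn : n ∈ normalizer (A : Set G)) (ha : a ∈ A) :
    n⁻¹ * a * n ∈ A := by
  simpa using conj_mem_of_mem_normalizer (inv_mem hn) ha

theorem mem_normalizer_of_conj_mem [Finite G] {n : G} (hn : ∀ a ∈ A, n * a * n⁻¹ ∈ A) :
    n ∈ normalizer (A : Set G) := by
  refine mem_normalizer_iff.2 fun a => ⟨hn a, fun ha => ?_⟩
  have h1 : A.map (MulAut.conj n).toMonoidHom = A := by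
    refine eq_of_le_of_card_ge ?_ ?_
    · rintro _ ⟨c, hc, rfl⟩
      exact hn c hc
    · exact (Nat.card_congr (A.equivMapOfInjective _ (MulAut.conj n).injective).toEquiv).le
  rw [← h1] at ha
  obtain ⟨c, hc, hca⟩ := ha
  have : c = a := (MulAut.conj n).injective hca
  exact this ▸ hc

/-- The central elements of `A` of order dividing two. -/
def centralInvolutions (A : Subgroup G) : Subgroup G where
  carrier := {a | a ∈ A ∧ a ^ 2 = 1 ∧ ∀ c ∈ A, a * c = c * a}
  one_mem' := ⟨one_mem _, by simp, by simp⟩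
  mul_mem' := by
    rintro a c ⟨ha, ha2, hac⟩ ⟨hc, hc2, hcc⟩
    refine ⟨mul_mem ha hc, ?_, fun d hd => ?_⟩
    · rw [pow_two, mul_assoc, ← mul_assoc c, ← hac c hc, mul_assoc a, ← mul_assoc a a,
        ← pow_two, ← pow_two, ha2, hc2, one_mul]
    · rw [mul_assoc, hcc d hd, ← mul_assoc, hac d hd, mul_assoc]
  inv_mem' := by
    rintro a ⟨ha, ha2, hac⟩
    have : a⁻¹ = a := inv_eq_of_mul_eq_one_left (by rw [← pow_two, ha2])
    rw [this]
    exact ⟨ha, ha2, hac⟩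

theorem conj_mem_centralInvolutions {n a : G} (hn : n ∈ normalizer (A : Set G))
    (ha : a ∈ A.centralInvolutions) : n * a * n⁻¹ ∈ A.centralInvolutions := by
  obtain ⟨ha, ha2, hac⟩ := ha
  refine ⟨conj_mem_of_mem_normalizer hn ha, ?_, fun c hc => ?_⟩
  · rw [conj_pow, ha2, mul_one, mul_inv_cancel]
  · have := hac _ (conj_mem_of_mem_normalizer' hn hc)
    calc n * a * n⁻¹ * c = n * (a * (n⁻¹ * c * n)) * n⁻¹ := by group
      _ = _ := by rw [this]; group

end Subgroup

namespace BicyclicModel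

variable {G R : Type*} [Group G] [CommRing R] {P M Φ A : Subgroup G} {e : R → G} {x b : G}
  {ξ : R} {μ : ℕ}

section

variable (h : BicyclicModel P M Φ e x b ξ μ)
include h

theorem mem_commutator_iff {g : G} : g ∈ ⁅P, P⁆ ↔ ∃ r, g = e r := by
  constructor
  · intro hg
    let E : Subgroup G :=
      { carrier := {g | ∃ r, g = e r}
        one_mem' := ⟨0, h.e_zero.symm⟩
        mul_mem' := by
          rintro _ _ ⟨r, rfl⟩ ⟨s, rfl⟩
          exact ⟨r + s, (h.e_add r s).symm⟩
        inv_mem' := by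
          rintro _ ⟨r, rfl⟩
          exact ⟨-r, (h.e_neg r).symm⟩ }
    have : ⁅P, P⁆ ≤ E := Subgroup.commutator_le.2 fun u hu v hv => h.comm u hu v hv
    exact this hg
  · rintro ⟨r, rfl⟩
    exact h.e_comm r

theorem normalizer_conj_e {n : G} (hn : n ∈ Subgroup.normalizer (P : Set G)) (r : R) :
    ∃ s, n * e r * n⁻¹ = e s := by
  rw [← h.mem_commutator_iff]
  have h1 : P.map (MulAut.conj n).toMonoidHom ≤ P := by
    rintro _ ⟨c, hc, rfl⟩
    exact Subgroup.conj_mem_of_mem_normalizer hn hc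
  have h2 : ⁅P, P⁆.map (MulAut.conj n).toMonoidHom ≤ ⁅P, P⁆ := by
    rw [Subgroup.map_commutator]
    exact Subgroup.commutator_mono h1 h1
  exact h2 ⟨e r, h.e_comm r, rfl⟩

theorem normalizer_conj_Φ {n : G} (hn : n ∈ Subgroup.normalizer (P : Set G)) {u : G}
    (hu : u ∈ Φ) : n * u * n⁻¹ ∈ Φ := by
  obtain ⟨k, r, rfl⟩ := h.Φ_form hu
  obtain ⟨s, hs⟩ := h.normalizer_conj_e hn r
  have h1 := h.sq_mem_Φ (Subgroup.conj_mem_of_mem_normalizer hn (pow_mem h.x_mem k))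
  have h2 : n * (x ^ (2 * k) * e r) * n⁻¹ = (n * x ^ k * n⁻¹) ^ 2 * (n * e r * n⁻¹) := by
    rw [conj_pow, mul_comm 2 k, pow_mul]; group
  rw [h2, hs]
  exact mul_mem h1 (h.e_mem s)

theorem mem_M_iff {u : G} (hu : u ∈ P) : u ∈ M ↔ ∃ r, u ^ 2 ^ (μ - 1) = e r := by
  obtain ⟨ν, rfl⟩ := Nat.exists_eq_add_of_le h.two_le
  have hν : 2 ^ (2 + ν - 1) = 2 * 2 ^ ν := by
    rw [show 2 + ν - 1 = ν + 1 by omega, pow_succ, mul_comm]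
  have hν2 : 2 ^ (2 + ν) = 2 * (2 * 2 ^ ν) := by
    rw [show 2 + ν = ν + 1 + 1 by omega, pow_succ, pow_succ]; ring
  rw [hν]
  constructor
  · intro hM
    have : ∃ (k : ℕ) (r : R), u = x ^ (2 * k) * e r ∨ u = x ^ (2 * k) * b * e r := by
      by_cases hΦ : u ∈ Φ
      · obtain ⟨k, r, hk⟩ := h.Φ_form hΦ
        exact ⟨k, r, .inl hk⟩
      · obtain ⟨k, r, hk⟩ := h.M_form hM hΦ
        exact ⟨k, r, .inr hk⟩
    obtain ⟨k, r, hk⟩ := this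
    obtain ⟨s, hs⟩ := h.pow_two_mul_form hk (2 ^ ν)
    obtain ⟨j, η, -, hj⟩ := h.x_pow_dvd (k := 2 * k * (2 * 2 ^ ν)) ⟨k, by rw [hν2]; ring⟩
    exact ⟨_, by rw [hs, hj, ← h.e_add]⟩
  · rintro ⟨r, hr⟩
    by_contra hM
    obtain ⟨k, s, hk⟩ := h.P_form hu hM
    obtain ⟨t, ht⟩ := h.pow_two_mul_form hk (2 ^ ν)
    have h1 := h.dvd_of_x_pow ((2 * k + 1) * (2 * 2 ^ ν)) (r + -t) (by
      rw [h.e_add, h.e_neg, ← hr, ht, mul_inv_cancel_right])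
    rw [hν2] at h1
    have := Nat.dvd_of_mul_dvd_mul_right (by positivity) h1
    omega

theorem normalizer_conj_M {n : G} (hn : n ∈ Subgroup.normalizer (P : Set G)) {u : G}
    (hu : u ∈ M) : n * u * n⁻¹ ∈ M := by
  have hnu := Subgroup.conj_mem_of_mem_normalizer hn (h.M_le hu)
  obtain ⟨r, hr⟩ := (h.mem_M_iff (h.M_le hu)).1 hu
  rw [h.mem_M_iff hnu, conj_pow, hr]
  exact h.normalizer_conj_e hn r

theorem normalizer_sq {n u : G} (hn : n ∈ Subgroup.normalizer (P : Set G)) (hu : u ∈ P) :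
    u⁻¹ * (n ^ 2 * u * (n ^ 2)⁻¹) ∈ Φ := by
  have hinv {u : G} (hu : u ∈ P) := Subgroup.conj_mem_of_mem_normalizer hn hu
  have hback {Y : Subgroup G} (hY : ∀ u ∈ Y, n⁻¹ * u * n⁻¹⁻¹ ∈ Y) {u : G}
      (hu : n * u * n⁻¹ ∈ Y) : u ∈ Y := by
    have := hY _ hu
    simpa [mul_assoc] using this
  have hM : ∀ {u : G}, u ∈ M → u⁻¹ * (n * u * n⁻¹) ∈ Φ := by
    intro u hu
    by_cases hΦ : u ∈ Φ
    · exact mul_mem (inv_mem hΦ) (h.normalizer_conj_Φ hn hΦ)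
    · exact h.index_Φ u hu _ (h.normalizer_conj_M hn hu) hΦ fun hc =>
        hΦ (hback (fun u hu => h.normalizer_conj_Φ (inv_mem hn) hu) hc)
  have hv : u⁻¹ * (n * u * n⁻¹) ∈ M := by
    by_cases hM : u ∈ M
    · exact mul_mem (inv_mem hM) (h.normalizer_conj_M hn hM)
    · exact h.index_M u hu _ (hinv hu) hM fun hc =>
        hM (hback (fun u hu => h.normalizer_conj_M (inv_mem hn) hu) hc)
  have h1 := hM hv
  have h2 := h.sq_mem_Φ (h.M_le hv)
  have := mul_mem h2 h1
  convert this using 1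
  rw [pow_two, pow_two]
  group

variable [Finite G]

theorem normalizer_le_of_eq (L : LocalFusion P Φ P) :
    Subgroup.normalizer (P : Set G) ≤ P.actsTriviallyMod Φ := by
  intro n hn
  have hP : P ≤ P.actsTriviallyMod Φ := fun u hu =>
    ⟨Subgroup.le_normalizer hu, fun a ha => L.conj_mem a ha u hu⟩
  obtain ⟨k, m, hm, hkm⟩ := Nat.exists_eq_two_pow_mul_odd (orderOf_pos n).ne'
  have h1 : n ^ m ∈ P := by
    obtain ⟨g, hg, hgn⟩ := L.exists_conj_mem le_rfl
      (fun n hn m hm => mul_mem (mul_mem hn hm) (inv_mem hn)) (pow_mem hn m) (k := k) (by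
        rw [← pow_mul, mul_comm, ← hkm, pow_orderOf_eq_one])
    simpa [mul_assoc] using Subgroup.conj_mem_of_mem_normalizer' hg hgn
  have h2 : n ^ 2 ∈ P.actsTriviallyMod Φ := ⟨pow_mem hn 2, fun u hu => h.normalizer_sq hn hu⟩
  obtain ⟨j, rfl⟩ := hm
  have h3 := mul_mem (inv_mem (pow_mem h2 j)) (hP h1)
  rwa [pow_succ n (2 * j), pow_mul, inv_mul_cancel_left] at h3

end

end BicyclicModel

theorem not_dvd_relIndex_of_inf_le {G : Type*} [Group G] {p : ℕ} {P N K : Subgroup G}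
    (hN : ¬ p ∣ P.relIndex N) (hK : K ≤ N) (hPK : P ⊓ N ≤ K) : ¬ p ∣ P.relIndex K := by
  intro hp
  refine hN (hp.trans ?_)
  have h1 := Subgroup.relIndex_mul_relIndex (P ⊓ N) K N hPK hK
  rw [Subgroup.inf_relIndex_right] at h1
  suffices h2 : P.relIndex K = (P ⊓ N).relIndex K from h1 ▸ h2 ▸ dvd_mul_right _ _
  rw [← Subgroup.inf_relIndex_right P K, ← Subgroup.inf_relIndex_right (P ⊓ N) K]
  congr 1
  ext g
  simp only [Subgroup.mem_inf]
  exact ⟨fun hg => ⟨⟨hg.1, hK hg.2⟩, hg.2⟩, fun hg => ⟨hg.1.1, hg.2⟩⟩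

theorem IsPGroup.exists_conj_conj_mem {G : Type*} [Group G] [Finite G] {p : ℕ} [Fact p.Prime]
    {P K : Subgroup G} (hP : IsPGroup p P) (hi : ¬ p ∣ P.relIndex K) {s g : G} (hs : s ∈ P)
    (hg : g * s * g⁻¹ ∈ K) : ∃ m ∈ K, m * (g * s * g⁻¹) * m⁻¹ ∈ P := by
  obtain ⟨m, hm, hm'⟩ := hP.exists_conj_mem_of_relIndex hi
    (K := (Subgroup.zpowers s).map (MulAut.conj g).toMonoidHom)
    ((hP.to_le (by simpa using hs)).map _) (by
      rw [MonoidHom.map_zpowers]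
      simpa using hg)
  exact ⟨m, hm, hm' _ ⟨s, Subgroup.mem_zpowers s, rfl⟩⟩

namespace BicyclicModel

variable {G R : Type*} [Group G] [CommRing R] {P M Φ A : Subgroup G} {e : R → G} {x b : G}
  {ξ : R} {μ : ℕ}

section

variable (h : BicyclicModel P M Φ e x b ξ μ)
include h

theorem conj_e_of_mul_eq_zero {z : R} (hz2 : 2 * z = 0) (hzξ : ξ * z = 0) {u : G} (hu : u ∈ P) :
    u * e z * u⁻¹ = e z := by
  obtain ⟨s, t, hst⟩ := h.conj_form hu
  rw [hst]; congr 1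
  linear_combination s * hz2 + t * hzξ

theorem finite_ring [Finite G] : Finite R := Finite.of_injective e h.e_inj

/-- The elements of `R` killed by two form a group of order four. -/
theorem card_ann_two [Finite G] : Nat.card (AddMonoidHom.mulLeft (2 : R)).ker = 4 := by
  have := h.finite_ring
  have h1 : Nat.card (R ⧸ (AddMonoidHom.mulLeft (2 : R)).range) = 4 := by
    let f : ZMod 2 × ZMod 2 → R ⧸ (AddMonoidHom.mulLeft (2 : R)).range :=
      fun p => ((p.1.val + p.2.val * ξ : R) : R ⧸ (AddMonoidHom.mulLeft (2 : R)).range)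
    have hf : Function.Bijective f := by
      constructor
      · rintro ⟨m, n⟩ ⟨m', n'⟩ hmn
        obtain ⟨s, hs⟩ := QuotientAddGroup.eq.1 hmn
        have hs' : 2 * s = -((m.val : R) + n.val * ξ) + (m'.val + n'.val * ξ) := hs
        obtain ⟨h1, h2⟩ := h.indep ((m'.val : ℤ) - m.val) ((n'.val : ℤ) - n.val) s (by
          rw [hs']; push_cast; ring)
        have hm := ZMod.val_lt m
        have hm' := ZMod.val_lt m'
        have hn := ZMod.val_lt n
        have hn' := ZMod.val_lt n'
        have e1 : m = m' := ZMod.val_injective 2 (by omega)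
        have e2 : n = n' := ZMod.val_injective 2 (by omega)
        rw [e1, e2]
      · intro q
        obtain ⟨r, rfl⟩ := QuotientAddGroup.mk_surjective q
        obtain ⟨m, n, rfl⟩ := h.span r
        refine ⟨(m, n), QuotientAddGroup.eq.2 ?_⟩
        have key : ∀ k : ℤ, ∃ l : ℤ, k = ((k : ZMod 2).val : ℤ) + 2 * l := by
          intro k
          refine ⟨k / 2, ?_⟩
          rw [ZMod.val_intCast]
          push_cast; omega
        obtain ⟨i, hi⟩ := key m
        obtain ⟨j, hj⟩ := key n
        refine ⟨i + j * ξ, ?_⟩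
        change 2 * (i + j * ξ : R) = -(((m : ZMod 2).val : R) + (n : ZMod 2).val * ξ) + (m + n * ξ)
        have hi' := congrArg (Int.cast : ℤ → R) hi
        have hj' := congrArg (Int.cast : ℤ → R) hj
        push_cast at hi' hj'
        linear_combination -hi' - hj' * ξ
    rw [← Nat.card_congr (Equiv.ofBijective f hf)]
    simp
  have h2 := AddSubgroup.card_mul_index (AddMonoidHom.mulLeft (2 : R)).ker
  have h3 := AddSubgroup.card_mul_index (AddMonoidHom.mulLeft (2 : R)).range
  rw [AddSubgroup.index_ker] at h2
  rw [AddSubgroup.index, h1] at h3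
  have h4 : 0 < Nat.card (AddMonoidHom.mulLeft (2 : R)).range := Nat.card_pos
  nlinarith

theorem ann_two [Finite G] {r s t : R} (hr : 2 * r = 0) (hs : 2 * s = 0) (ht : 2 * t = 0)
    (hr0 : r ≠ 0) (hs0 : s ≠ 0) (hrs : r ≠ s) : t = 0 ∨ t = r ∨ t = s ∨ t = r + s := by
  classical
  have := h.finite_ring
  by_contra! hc
  obtain ⟨h0, h1, h2, h3⟩ := hc
  have h4 : ({0, r, s, r + s, t} : Finset R).card = 5 := by
    have e1 : r + s ≠ 0 := fun hh => hrs (by linear_combination hh - hs)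
    rw [Finset.card_insert_of_notMem, Finset.card_insert_of_notMem,
      Finset.card_insert_of_notMem, Finset.card_insert_of_notMem, Finset.card_singleton]
    all_goals simp; tauto
  have h5 : ((({0, r, s, r + s, t} : Finset R) : Set R)).ncard ≤
      ((AddMonoidHom.mulLeft (2 : R)).ker : Set R).ncard := by
    refine Set.ncard_le_ncard ?_ (Set.toFinite _)
    intro q hq
    simp only [Finset.coe_insert, Finset.coe_singleton, Set.mem_insert_iff,
      Set.mem_singleton_iff] at hq
    change 2 * q = 0
    rcases hq with rfl | rfl | rfl | rfl | rfl
    · simp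
    · exact hr
    · exact hs
    · rw [mul_add, hr, hs, add_zero]
    · exact ht
  rw [Set.ncard_coe_finset, h4] at h5
  have h6 : ((AddMonoidHom.mulLeft (2 : R)).ker : Set R).ncard = 4 := h.card_ann_two
  omega

theorem exists_ann_two_ne [Finite G] (z : R) : ∃ r : R, 2 * r = 0 ∧ r ≠ 0 ∧ r ≠ z := by
  classical
  have := h.finite_ring
  by_contra! hc
  have h5 : ((AddMonoidHom.mulLeft (2 : R)).ker : Set R).ncard ≤ ({0, z} : Set R).ncard := by
    refine Set.ncard_le_ncard ?_ (Set.toFinite _)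
    intro q hq
    by_cases hq0 : q = 0
    · simp [hq0]
    · simp [hc q hq hq0]
  have h6 : ((AddMonoidHom.mulLeft (2 : R)).ker : Set R).ncard = 4 := h.card_ann_two
  have h7 := Set.ncard_insert_le (0 : R) {z}
  rw [Set.ncard_singleton] at h7
  omega

theorem commutator_Φ {u v : G} (hu : u ∈ Φ) (hv : v ∈ Φ) :
    ∃ w, u * v * u⁻¹ * v⁻¹ = e (2 * (ξ * w)) := by
  obtain ⟨k, r, rfl⟩ := h.Φ_form hu
  obtain ⟨l, s, rfl⟩ := h.Φ_form hv
  obtain ⟨i, hi⟩ := h.one_add_pow_two_mul k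
  obtain ⟨j, hj⟩ := h.one_add_pow_two_mul l
  have hk := h.x_pow_conj (2 * k)
  have hl := h.x_pow_conj (2 * l)
  have e1 : ∀ (k l : ℕ) (r s : R), x ^ k * e r * (x ^ l * e s) =
      e ((1 + ξ) ^ k * r + (1 + ξ) ^ k * ((1 + ξ) ^ l * s)) * x ^ (k + l) := by
    intro k l r s
    rw [h.e_add, ← h.x_pow_conj, ← h.x_pow_conj k, ← h.x_pow_conj l, pow_add]
    group
  have e2 : ∀ a c : G, a * c * a⁻¹ * c⁻¹ = (a * c) * (c * a)⁻¹ := fun a c => by group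
  rw [e2, e1, e1, add_comm (2 * l) (2 * k), mul_inv_rev, mul_assoc, mul_inv_cancel_left,
    ← h.e_neg, ← h.e_add]
  refine ⟨(1 + 2 * ξ * j) * i * s - (1 + 2 * ξ * i) * j * r, ?_⟩
  congr 1
  rw [hi, hj]; ring

theorem commutator_M {u v : G} (hu : u ∈ M) (hv : v ∈ M) :
    ∃ s t, u * v * u⁻¹ * v⁻¹ = e (2 * s + ξ * t) := by
  have key : ∀ {u v : G}, u ∈ M → v ∈ M → v ∉ Φ → ∃ s t, u * v * u⁻¹ * v⁻¹ = e (2 * s + ξ * t) := by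
    intro u v hu hv hvΦ
    obtain ⟨t, ht, htM⟩ := h.conj_M hv hvΦ (h.M_le hu)
    rcases h.isUnit_or t with ⟨s, t, rfl⟩ | hunit
    · exact ⟨s, t, by rw [ht, mul_inv_cancel_right]⟩
    · exact absurd hu (htM.1 hunit)
  by_cases hvΦ : v ∈ Φ
  · by_cases huΦ : u ∈ Φ
    · obtain ⟨w, hw⟩ := h.commutator_Φ huΦ hvΦ
      exact ⟨ξ * w, 0, by rw [hw]; congr 1; ring⟩
    · obtain ⟨s, t, hst⟩ := key hv hu huΦ
      refine ⟨-s, -t, ?_⟩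
      have : 2 * -s + ξ * -t = -(2 * s + ξ * t) := by ring
      rw [this, h.e_neg, ← hst]; group
  · exact key hu hv hvΦ

theorem normalizer_M_conj_e {n : G} (hn : n ∈ Subgroup.normalizer (M : Set G)) (s t : R) :
    ∃ s' t', n * e (2 * s + ξ * t) * n⁻¹ = e (2 * s' + ξ * t') := by
  obtain ⟨v, hv, hvb⟩ := h.exists_conj_M h.b_mem h.b_not_mem (2 * s + ξ * t)
  obtain ⟨t₁, ht₁, ht₁M⟩ := h.conj_M h.b_mem h.b_not_mem hv
  have e1 : t₁ = 2 * s + ξ * t := h.e_inj (mul_right_cancel (ht₁.symm.trans hvb))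
  have hvM : v ∈ M := by
    by_contra hvM
    exact h.not_isUnit s t (e1 ▸ ht₁M.2 hvM)
  obtain ⟨s', t', hst⟩ := h.commutator_M (Subgroup.conj_mem_of_mem_normalizer hn hvM)
    (Subgroup.conj_mem_of_mem_normalizer hn h.b_mem)
  refine ⟨s', t', ?_⟩
  rw [← hst, eq_mul_inv_of_mul_eq hvb.symm]; group

theorem commutator_x_sq_mul_ne {u : G} (hu : u ∈ M) (hu' : u ∉ Φ) (r s : R) :
    u * (x ^ 2 * e r) * u⁻¹ * (x ^ 2 * e r)⁻¹ ≠ e (2 * s) := by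
  obtain ⟨ω, hω⟩ := h.conj_of_mem_M hu hu'
  obtain ⟨t, ht, hxu⟩ := h.x_conj_M hu hu'
  have h1 := h.x_sq_conj_M hxu
  have h3 : u * x ^ 2 * u⁻¹ = e (-((2 + ξ) * t)) * x ^ 2 := by
    rw [h.e_neg, eq_inv_mul_iff_mul_eq, ← mul_assoc, ← mul_assoc, ← h1]; group
  have h4 : u * (x ^ 2 * e r) * u⁻¹ * (x ^ 2 * e r)⁻¹ =
      (u * x ^ 2 * u⁻¹) * (u * e r * u⁻¹ * (e r)⁻¹) * (x ^ 2)⁻¹ := by group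
  rw [h4, h3, hω, ← h.e_neg, ← h.e_add, mul_assoc, mul_assoc, ← mul_assoc (x ^ 2), h.x_pow_conj,
    ← h.e_add]
  intro h5
  have h6 := h.e_inj h5
  refine h.ξ_mul_unit_ne ht (-s - t + (1 + ξ) ^ 2 * (-r + ξ * ω * r)) ?_
  linear_combination -h6

theorem commutator_e_one_ne (h2 : (2 : R) ≠ 0) {u : G} (hu : u ∈ M) (hu' : u ∉ Φ) (s t : R) :
    u * e 1 * u⁻¹ * (e 1)⁻¹ ≠ e (2 * (2 * s + ξ * t)) := by
  obtain ⟨ω, hω⟩ := h.conj_of_mem_M hu hu'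
  rw [hω, ← h.e_neg, ← h.e_add]
  intro h5
  have h6 := h.e_inj h5
  have hunit := h.isUnit_add isUnit_one s (t - ω)
  refine h2 ((hunit.mul_left_eq_zero).1 ?_)
  linear_combination -h6

theorem normalizer_M_conj_Φ (h2 : (2 : R) ≠ 0) {n : G}
    (hn : n ∈ Subgroup.normalizer (M : Set G)) {u : G} (hu : u ∈ Φ) : n * u * n⁻¹ ∈ Φ := by
  by_contra hc
  have hcM := Subgroup.conj_mem_of_mem_normalizer hn (h.Φ_le hu)
  have key : ∀ w, n⁻¹ * w * n ∈ Φ → ∃ s t, (n * u * n⁻¹) * w * (n * u * n⁻¹)⁻¹ * w⁻¹ =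
      e (2 * (2 * s + ξ * t)) := by
    intro w hw
    obtain ⟨v, hv⟩ := h.commutator_Φ hu hw
    obtain ⟨s, t, hst⟩ := h.normalizer_M_conj_e hn 0 v
    refine ⟨s, t, ?_⟩
    have e1 : 2 * (ξ * v) = (2 : ℕ) * (2 * 0 + ξ * v) := by push_cast; ring
    have e2 : 2 * (2 * s + ξ * t) = (2 : ℕ) * (2 * s + ξ * t) := by push_cast; ring
    rw [e1, h.e_nsmul] at hv
    rw [e2, h.e_nsmul, ← hst, conj_pow, ← hv]
    group
  have hx : n⁻¹ * (x ^ 2) * n ∉ Φ := fun hw => by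
    obtain ⟨s, t, hst⟩ := key _ hw
    exact h.commutator_x_sq_mul_ne hcM hc 0 (2 * s + ξ * t) (by
      rw [h.e_zero, mul_one, hst])
  have he : n⁻¹ * e 1 * n ∉ Φ := fun hw => by
    obtain ⟨s, t, hst⟩ := key _ hw
    exact h.commutator_e_one_ne h2 hcM hc s t hst
  have hxM : x ^ 2 ∈ M := h.Φ_le (h.sq_mem_Φ h.x_mem)
  have h1 := h.index_Φ _ (inv_mem (Subgroup.conj_mem_of_mem_normalizer' hn hxM)) _
    (Subgroup.conj_mem_of_mem_normalizer' hn (h.Φ_le (h.e_mem 1)))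
    (fun hh => hx (by simpa using inv_mem hh)) he
  obtain ⟨s, t, hst⟩ := key (x ^ 2 * e 1) (by convert h1 using 1; group)
  exact h.commutator_x_sq_mul_ne hcM hc 1 _ hst

/-- The centraliser in `P` of an element of `M` outside `Φ` meets `Φ` in an abelian group. -/
theorem commute_of_commute_Φ {u v w : G} (hu : u ∈ M) (hu' : u ∉ Φ) (hv : v ∈ Φ) (hw : w ∈ Φ)
    (huv : v * u = u * v) (huw : w * u = u * w) : v * w = w * v := by
  obtain ⟨k, r, rfl⟩ := h.Φ_form hv
  obtain ⟨l, s, rfl⟩ := h.Φ_form hw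
  obtain ⟨ω, hω⟩ := h.conj_of_mem_M hu hu'
  obtain ⟨t, ht, hxu⟩ := h.x_conj_M hu hu'
  obtain ⟨σ, hσ⟩ := h.ξ_sq
  obtain ⟨i, hi', hi⟩ := h.x_pow_even_conj_M k
  obtain ⟨j, hj', hj⟩ := h.x_pow_even_conj_M l
  have hes : ∀ r, e r * u * (e r)⁻¹ = e (2 * ((1 - ξ * ω) * r)) * u := by
    intro r
    have h1 := hω (-r)
    have h2 : e r * (u * e (-r) * u⁻¹) = e r * u * (e r)⁻¹ * u⁻¹ := by rw [h.e_neg]; group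
    rw [h1, ← h.e_add] at h2
    rw [eq_mul_of_mul_inv_eq h2.symm]
    congr 2; ring
  have key : ∀ (k : ℕ) (r i : R), x ^ (2 * k) * u * (x ^ (2 * k))⁻¹ = e ((2 + ξ) * i * t) * u →
      x ^ (2 * k) * e r * u = u * (x ^ (2 * k) * e r) →
      (1 + ξ) ^ (2 * k) * (2 * ((1 - ξ * ω) * r)) = - ((2 + ξ) * i * t) := by
    intro k r i hki hkr
    have h1 : x ^ (2 * k) * e r * u * (x ^ (2 * k) * e r)⁻¹ = u := by
      rw [hkr, mul_inv_cancel_right]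
    have h2 : x ^ (2 * k) * e r * u * (x ^ (2 * k) * e r)⁻¹ =
        (x ^ (2 * k) * e (2 * ((1 - ξ * ω) * r)) * (x ^ (2 * k))⁻¹) *
          (x ^ (2 * k) * u * (x ^ (2 * k))⁻¹) := by
      calc _ = x ^ (2 * k) * (e r * u * (e r)⁻¹) * (x ^ (2 * k))⁻¹ := by group
        _ = _ := by rw [hes]; group
    rw [h2, h.x_pow_conj, hki, ← mul_assoc, ← h.e_add] at h1
    have h3 := h.e_eq_one.1 (mul_eq_right.1 h1)
    linear_combination h3
  have hk := key k r i (hi u t hxu) huv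
  have hl := key l s j (hj u t hxu) huw
  have e1 : ∀ (k l : ℕ) (r s : R), x ^ k * e r * (x ^ l * e s) =
      e ((1 + ξ) ^ k * r + (1 + ξ) ^ k * ((1 + ξ) ^ l * s)) * x ^ (k + l) := by
    intro k l r s
    rw [h.e_add, ← h.x_pow_conj, ← h.x_pow_conj k, ← h.x_pow_conj l, pow_add]
    group
  rw [e1, e1, add_comm (2 * l) (2 * k)]
  congr 2
  have hunit : IsUnit (1 + (2 * 0 + ξ * (-ω))) := h.isUnit_add isUnit_one _ _
  refine hunit.mul_left_cancel ?_
  linear_combination (-(1 - ξ * ω) * (1 + ξ) ^ (2 * k) * r) * hj' +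
    ((1 - ξ * ω) * (1 + ξ) ^ (2 * l) * s) * hi' +
    ((1 - ξ * ω) * ((1 + ξ) ^ (2 * l) * s * i - (1 + ξ) ^ (2 * k) * r * j)) * hσ -
    ξ * (1 + σ) * j * hk + ξ * (1 + σ) * i * hl

end

end BicyclicModel

theorem Subgroup.normalizer_le_actsTriviallyMod {G : Type*} [Group G] {A Φ : Subgroup G}
    (hA : A ≤ Φ) : normalizer (A : Set G) ≤ A.actsTriviallyMod Φ := fun _ hn =>
  ⟨hn, fun _ ha => mul_mem (inv_mem (hA ha)) (hA (conj_mem_of_mem_normalizer hn ha))⟩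

theorem LocalFusion.mem_actsTriviallyMod {G : Type*} [Group G] {P A Φ : Subgroup G}
    (L : LocalFusion P Φ A) {n : G} (hn : n ∈ Subgroup.normalizer (A : Set G))
    (h : ∀ u ∈ P, n * u * n⁻¹ ∈ P → u⁻¹ * (n * u * n⁻¹) ∈ Φ) : n ∈ A.actsTriviallyMod Φ :=
  ⟨hn, fun a ha => h a (L.le ha) (L.le (Subgroup.conj_mem_of_mem_normalizer hn ha))⟩

namespace BicyclicModel

variable {G R : Type*} [Group G] [CommRing R] {P M Φ A : Subgroup G} {e : R → G} {x b : G}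
  {ξ : R} {μ : ℕ}

section

variable (h : BicyclicModel P M Φ e x b ξ μ)
include h

theorem centralInvolutions_mem_Φ {a : G} (ha : a ∈ A.centralInvolutions) (haΦ : a ∈ Φ) :
    ∃ r, 2 * r = 0 ∧ a = e r := h.involution_Φ haΦ ha.2.1

theorem e_mem_centralInvolutions {r : R} (hr : 2 * r = 0) (hrA : e r ∈ A)
    (hc : ∀ a ∈ A, e r * a = a * e r) : e r ∈ A.centralInvolutions := by
  refine ⟨hrA, ?_, hc⟩
  rw [← h.e_nsmul, h.e_eq_one]; exact_mod_cast hr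

end

section

variable [Finite G] (h : BicyclicModel P M Φ e x b ξ μ) (L : LocalFusion P Φ A)
include h L

section odd

variable {z : R} (hz2 : 2 * z = 0)
  (hfix : ∀ g, g * e z * g⁻¹ = e z → ∀ u ∈ P, g * u * g⁻¹ ∈ P → u⁻¹ * (g * u * g⁻¹) ∈ Φ)
include hz2 hfix

omit h in
/-- If the normaliser of `A` preserves the group of involutions of the commutator subgroup,
then it acts trivially as soon as some element outside `A` centralises these involutions. -/
theorem normalizer_le_of_ann_invariant
    (hinv : ∀ n ∈ Subgroup.normalizer (A : Set G), ∀ r, 2 * r = 0 →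
      ∃ s, 2 * s = 0 ∧ n * e r * n⁻¹ = e s) {s : G} (hsP : s ∈ P) (hsA : s ∉ A)
    (hsN : s ∈ Subgroup.normalizer (A : Set G)) (hs : ∀ r, 2 * r = 0 → s * e r * s⁻¹ = e r) :
    Subgroup.normalizer (A : Set G) ≤ A.actsTriviallyMod Φ := by
  let K : Subgroup G :=
    { carrier := {n | n ∈ Subgroup.normalizer (A : Set G) ∧ ∀ r, 2 * r = 0 → n * e r * n⁻¹ = e r}
      one_mem' := ⟨one_mem _, by simp⟩
      mul_mem' := by
        rintro m n ⟨hm, hm'⟩ ⟨hn, hn'⟩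
        refine ⟨mul_mem hm hn, fun r hr => ?_⟩
        calc m * n * e r * (m * n)⁻¹ = m * (n * e r * n⁻¹) * m⁻¹ := by group
          _ = e r := by rw [hn' r hr, hm' r hr]
      inv_mem' := by
        rintro m ⟨hm, hm'⟩
        refine ⟨inv_mem hm, fun r hr => ?_⟩
        nth_rewrite 1 [← hm' r hr]
        group }
  refine L.of_normal (K := K) (fun n hn => L.mem_actsTriviallyMod hn.1 (hfix n (hn.2 z hz2)))
    ?_ hsP ⟨hsN, hs⟩ hsA
  rintro n hn m ⟨hm, hm'⟩
  refine ⟨mul_mem (mul_mem hn hm) (inv_mem hn), fun r hr => ?_⟩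
  obtain ⟨t, ht, htn⟩ := hinv _ (inv_mem hn) r hr
  calc n * m * n⁻¹ * e r * (n * m * n⁻¹)⁻¹ = n * (m * (n⁻¹ * e r * n⁻¹⁻¹) * m⁻¹) * n⁻¹ := by group
    _ = n * (n⁻¹ * e r * n⁻¹⁻¹) * n⁻¹ := by rw [htn, hm' t ht]
    _ = e r := by group

theorem normalizer_le_of_not_le_M (hz0 : z ≠ 0) (hzξ : ξ * z = 0)
    (hC : ∀ s ∈ P, (∀ a ∈ A, s * a = a * s) → s ∈ A) (hAM : ¬ A ≤ M) {s : G} (hsP : s ∈ P) (hsA : s ∉ A)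
    (hsN : s ∈ Subgroup.normalizer (A : Set G)) :
    Subgroup.normalizer (A : Set G) ≤ A.actsTriviallyMod Φ := by
  obtain ⟨g, hgA, hgM⟩ := SetLike.not_le_iff_exists.1 hAM
  have hE : ∀ a ∈ A.centralInvolutions, ∃ r, 2 * r = 0 ∧ a = e r := by
    intro a ha
    have haM := h.involution_mem_M (L.le ha.1) ha.2.1
    refine h.centralInvolutions_mem_Φ ha ?_
    by_contra haΦ
    obtain ⟨t, ht, htM⟩ := h.conj_M haM haΦ (L.le hgA)
    rw [← ha.2.2 g hgA, mul_inv_cancel_right] at ht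
    have ht0 : t = 0 := h.e_eq_one.1 (mul_eq_right.1 ht.symm)
    have hu := htM.2 hgM
    exact h.not_isUnit 0 0 (by simpa [ht0] using hu)
  have hze : ∀ u ∈ P, e z * u = u * e z := fun u hu =>
    (mul_inv_eq_iff_eq_mul.1 (h.conj_e_of_mul_eq_zero hz2 hzξ hu)).symm
  have hzE : e z ∈ A.centralInvolutions :=
    h.e_mem_centralInvolutions hz2 (hC _ (h.Φ_le_P (h.e_mem z)) fun a ha => hze a (L.le ha))
      fun a ha => hze a (L.le ha)
  by_cases hall : ∀ r, 2 * r = 0 → e r ∈ A.centralInvolutions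
  · have hξ : ∀ r, 2 * r = 0 → ξ * r = 0 := by
      intro r hr
      have h3 : g * e r * g⁻¹ = e r := by rw [← (hall r hr).2.2 g hgA, mul_inv_cancel_right]
      obtain ⟨ω, hω, hgr⟩ := h.conj_of_not_mem_M (L.le hgA) hgM
      have h4 : ω * (ξ * r) = 0 := by
        rcases hgr with hgr | hgr
        · rw [hgr] at h3
          linear_combination h.e_inj h3
        · rw [hgr] at h3
          linear_combination -h.e_inj h3 - hr
      exact (hω.mul_right_eq_zero).1 h4
    refine normalizer_le_of_ann_invariant L hz2 hfix (fun n hn r hr => ?_) hsP hsA hsN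
      fun r hr => h.conj_e_of_mul_eq_zero hr (hξ r hr) hsP
    exact hE _ (Subgroup.conj_mem_centralInvolutions hn (hall r hr))
  · push Not at hall
    obtain ⟨r, hr, hrE⟩ := hall
    intro n hn
    refine L.mem_actsTriviallyMod hn (hfix n ?_)
    have hnE := Subgroup.conj_mem_centralInvolutions hn hzE
    obtain ⟨t, ht, hnt⟩ := hE _ hnE
    rw [hnt] at hnE ⊢
    by_contra hne
    have ht0 : t ≠ 0 := by
      rintro rfl
      rw [h.e_zero, conj_eq_one_iff, h.e_eq_one] at hnt
      exact hz0 hnt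
    rcases h.ann_two hz2 ht hr hz0 ht0 (fun hh => hne (hh ▸ rfl)) with h0 | h0 | h0 | h0
    · exact hrE (h0 ▸ h.e_zero ▸ one_mem _)
    · exact hrE (h0 ▸ hzE)
    · exact hrE (h0 ▸ hnE)
    · exact hrE (h0 ▸ h.e_add z t ▸ mul_mem hzE hnE)

omit [Finite G] L hz2 hfix in
theorem normalizer_le_of_eq_M (h2 : (2 : R) ≠ 0) (hAM : A = M) :
    Subgroup.normalizer (A : Set G) ≤ A.actsTriviallyMod Φ := by
  intro n hn
  refine ⟨hn, fun u hu => ?_⟩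
  have hnu := Subgroup.conj_mem_of_mem_normalizer hn hu
  rw [hAM] at hn hu hnu
  by_cases hΦ : u ∈ Φ
  · exact mul_mem (inv_mem hΦ) (h.normalizer_M_conj_Φ h2 hn hΦ)
  · refine h.index_Φ u hu _ hnu hΦ fun hc => hΦ ?_
    have := h.normalizer_M_conj_Φ h2 (inv_mem hn) hc
    simpa [mul_assoc] using this

theorem normalizer_le_of_lt_M (h2 : (2 : R) ≠ 0)
    (hC : ∀ s ∈ P, (∀ a ∈ A, s * a = a * s) → s ∈ A) (hAM : A < M) :
    Subgroup.normalizer (A : Set G) ≤ A.actsTriviallyMod Φ := by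
  have hcM : ∀ r, 2 * r = 0 → ∀ u ∈ M, u * e r * u⁻¹ = e r := fun r hr u hu => by
    rw [h.commute_of_two_mul hu hr, mul_inv_cancel_right]
  have hI : ∀ r, 2 * r = 0 → e r ∈ A.centralInvolutions := by
    intro r hr
    have hc : ∀ a ∈ A, e r * a = a * e r := fun a ha =>
      (h.commute_of_two_mul (hAM.le ha) hr).symm
    exact h.e_mem_centralInvolutions hr (hC _ (h.Φ_le_P (h.e_mem r)) hc) hc
  suffices hinv : ∀ n ∈ Subgroup.normalizer (A : Set G), ∀ r, 2 * r = 0 → n * e r * n⁻¹ ∈ Φ by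
    have hlt := Subgroup.card_lt_card_inf_normalizer (L.isPGroup.to_le h.M_le) hAM
    obtain ⟨s, ⟨hsM, hsN⟩, hsA⟩ : ∃ s ∈ M ⊓ Subgroup.normalizer (A : Set G), s ∉ A := by
      by_contra! hc
      exact hlt.not_ge (Subgroup.card_le_of_le hc)
    exact normalizer_le_of_ann_invariant L hz2 hfix (fun n hn r hr =>
      h.centralInvolutions_mem_Φ (Subgroup.conj_mem_centralInvolutions hn (hI r hr))
        (hinv n hn r hr)) (h.M_le hsM) hsA hsN fun r hr => hcM r hr s hsM
  by_cases hEΦ : A.centralInvolutions ≤ Φ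
  · exact fun n hn r hr => hEΦ (Subgroup.conj_mem_centralInvolutions hn (hI r hr))
  obtain ⟨c, hcE, hcΦ⟩ := SetLike.not_le_iff_exists.1 hEΦ
  have hcMm : c ∈ M := hAM.le hcE.1
  have hEc : ∀ a ∈ A.centralInvolutions, a ∉ Φ → ∃ r, 2 * r = 0 ∧ a = c * e r := by
    intro a ha haΦ
    obtain ⟨r, hr, har⟩ := h.centralInvolutions_mem_Φ (mul_mem (inv_mem hcE) ha)
      (h.index_Φ c hcMm a (hAM.le ha.1) hcΦ haΦ)
    exact ⟨r, hr, by rw [← har, mul_inv_cancel_left]⟩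
  have hcM' : ∀ u ∈ P, u * c = c * u → u ∈ M := by
    intro u hu huc
    obtain ⟨t, ht, htM⟩ := h.conj_M hcMm hcΦ hu
    by_contra huM
    rw [huc, mul_inv_cancel_right] at ht
    have ht0 : t = 0 := h.e_eq_one.1 (mul_eq_right.1 ht.symm)
    have hu := htM.2 huM
    exact h.not_isUnit 0 0 (by simpa [ht0] using hu)
  have hcomm : ∀ u ∈ M, ∀ v ∈ Φ, u * c = c * u → v * c = c * v → u * v = v * u := by
    intro u hu v hv huc hvc
    by_cases huΦ : u ∈ Φ
    · exact h.commute_of_commute_Φ hcMm hcΦ huΦ hv huc hvc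
    · have h1 := h.commute_of_commute_Φ hcMm hcΦ (h.index_Φ c hcMm u hu hcΦ huΦ) hv
        (by rw [mul_assoc, huc]; group) hvc
      calc u * v = c * (c⁻¹ * u * v) := by group
        _ = (c * v) * (c⁻¹ * u) := by rw [h1]; group
        _ = v * u := by rw [← hvc]; group
  have hmemA : ∀ u ∈ P, u * c = c * u → u ∈ A := by
    intro u hu huc
    refine hC u hu fun a ha => ?_
    have huM := hcM' u hu huc
    have hac := (hcE.2.2 a ha).symm
    by_cases haΦ : a ∈ Φ
    · exact hcomm u huM a haΦ huc hac
    · have h1 := hcomm u huM _ (h.index_Φ c hcMm a (hAM.le ha) hcΦ haΦ) huc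
        (by rw [mul_assoc, hac]; group)
      calc u * a = (u * c) * (c⁻¹ * a) := by group
        _ = c * (u * (c⁻¹ * a)) := by rw [huc]; group
        _ = a * u := by rw [h1]; group
  have hPN : P ⊓ Subgroup.normalizer (A : Set G) ≤ M := by
    rintro s ⟨hsP, hsN⟩
    obtain ⟨t, ht, htM⟩ := h.conj_M hcMm hcΦ hsP
    by_contra hsM
    have h1 := Subgroup.conj_mem_centralInvolutions hsN hcE
    rw [ht] at h1
    have h3 := (mul_mem_cancel_right hcE.1).1 h1.1
    have h4 := h.two_mul_of_commute hcMm hcΦ (hcE.2.2 _ h3)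
    exact h2 (((htM.2 hsM).mul_left_eq_zero).1 h4)
  have hinv : ∀ n ∈ Subgroup.normalizer (A : Set G), ∀ r, 2 * r = 0 → n⁻¹ * e r * n ∈ Φ := by
    intro n hn v hv
    have hnE : ∀ r, 2 * r = 0 → n⁻¹ * e r * n ∈ A.centralInvolutions := fun r hr => by
      simpa using Subgroup.conj_mem_centralInvolutions (inv_mem hn) (hI r hr)
    by_contra hvΦ
    obtain ⟨q, hq, hq0, hqΦ⟩ : ∃ q, 2 * q = 0 ∧ q ≠ 0 ∧ n⁻¹ * e q * n ∈ Φ := by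
      obtain ⟨w, hw, hw0, hwv⟩ := h.exists_ann_two_ne v
      by_cases hwΦ : n⁻¹ * e w * n ∈ Φ
      · exact ⟨w, hw, hw0, hwΦ⟩
      · refine ⟨-w + v, by rw [mul_add, mul_neg, hw, hv]; simp, fun hh => hwv ?_, ?_⟩
        · linear_combination -hh
        · have := h.index_Φ _ (hAM.le (hnE w hw).1) _ (hAM.le (hnE v hv).1) hwΦ hvΦ
          rw [h.e_add, h.e_neg]
          convert this using 1
          group
    obtain ⟨p, hp, hpq⟩ := h.centralInvolutions_mem_Φ (hnE q hq) hqΦ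
    obtain ⟨s, hsP, hsc⟩ := h.exists_conj_M hcMm hcΦ p
    have hsM : s ∈ M := by
      obtain ⟨t, ht, htM⟩ := h.conj_M hcMm hcΦ hsP
      have htp : t = p := h.e_inj (mul_right_cancel (ht.symm.trans hsc))
      by_contra hsM
      exact h2 (((htM.2 hsM).mul_left_eq_zero).1 (htp ▸ hp))
    have hsN : s ∈ Subgroup.normalizer (A : Set G) := by
      refine Subgroup.mem_normalizer_of_conj_mem fun a ha => ?_
      have haM : s * a * s⁻¹ ∈ M := mul_mem (mul_mem hsM (hAM.le ha)) (inv_mem hsM)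
      refine hmemA _ (h.M_le haM) ?_
      have h1 : (s * a * s⁻¹) * (s * c * s⁻¹) = (s * c * s⁻¹) * (s * a * s⁻¹) := by
        have := hcE.2.2 a ha
        calc _ = s * (a * c) * s⁻¹ := by group
          _ = _ := by rw [← this]; group
      have h4 := h.commute_of_two_mul haM hp
      generalize s * a * s⁻¹ = d at h1 h4 ⊢
      rw [hsc, ← mul_assoc, h4, mul_assoc, mul_assoc] at h1
      exact mul_left_cancel h1
    have hn' : ∀ r, 2 * r = 0 → n * s * n⁻¹ * e r * (n * s * n⁻¹)⁻¹ =
        n * (s * (n⁻¹ * e r * n) * s⁻¹) * n⁻¹ := fun r _ => by group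
    have hn'Φ : ∀ r, 2 * r = 0 → n⁻¹ * e r * n ∈ Φ →
        n * s * n⁻¹ * e r * (n * s * n⁻¹)⁻¹ = e r := by
      intro r hr hrΦ
      obtain ⟨t, ht, hrt⟩ := h.centralInvolutions_mem_Φ (hnE r hr) hrΦ
      rw [hn' r hr, hrt, hcM t ht s hsM, ← hrt]; group
    have hn'M : ∀ r, 2 * r = 0 → n⁻¹ * e r * n ∉ Φ →
        n * s * n⁻¹ * e r * (n * s * n⁻¹)⁻¹ = e (q + r) := by
      intro r hr hrΦ
      obtain ⟨t, ht, hrt⟩ := hEc _ (hnE r hr) hrΦ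
      have h1 : s * (c * e t) * s⁻¹ = e p * (c * e t) := by
        calc s * (c * e t) * s⁻¹ = (s * c * s⁻¹) * (s * e t * s⁻¹) := by group
          _ = _ := by rw [hsc, hcM t ht s hsM, mul_assoc]
      rw [hn' r hr, hrt, h1, ← hrt, ← hpq, h.e_add]; group
    let D : Subgroup G :=
      { carrier := {g | ∃ r, 2 * r = 0 ∧ g = e r}
        one_mem' := ⟨0, by simp, h.e_zero.symm⟩
        mul_mem' := by
          rintro _ _ ⟨r, hr, rfl⟩ ⟨s, hs, rfl⟩
          exact ⟨r + s, by rw [mul_add, hr, hs, add_zero], (h.e_add r s).symm⟩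
        inv_mem' := by
          rintro _ ⟨r, hr, rfl⟩
          exact ⟨-r, by rw [mul_neg, hr, neg_zero], (h.e_neg r).symm⟩ }
    let K : Subgroup G := Subgroup.normalizer (A : Set G) ⊓ Subgroup.normalizer (D : Set G)
    have hn'K : n * s * n⁻¹ ∈ K := by
      have h1 := mul_mem (mul_mem hn hsN) (inv_mem hn)
      refine ⟨h1, Subgroup.mem_normalizer_of_conj_mem ?_⟩
      rintro _ ⟨r, hr, rfl⟩
      by_cases hrΦ : n⁻¹ * e r * n ∈ Φ
      · exact ⟨r, hr, hn'Φ r hr hrΦ⟩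
      · exact ⟨q + r, by rw [mul_add, hq, hr, add_zero], hn'M r hr hrΦ⟩
    have hPK : P ⊓ Subgroup.normalizer (A : Set G) ≤ K := by
      refine fun t ht => ⟨ht.2, Subgroup.mem_normalizer_of_conj_mem ?_⟩
      rintro _ ⟨r, hr, rfl⟩
      exact ⟨r, hr, hcM r hr t (hPN ht)⟩
    obtain ⟨m, hm, hmP⟩ := L.isPGroup.exists_conj_conj_mem
      (not_dvd_relIndex_of_inf_le L.not_dvd inf_le_left hPK) hsP hn'K
    obtain ⟨w, hw, hmw⟩ := Subgroup.conj_mem_of_mem_normalizer hm.2 ⟨v, hv, rfl⟩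
    have hmK := mul_mem (mul_mem hm hn'K) (inv_mem hm)
    have hmM := hPN ⟨hmP, hmK.1⟩
    have h1 : n * s * n⁻¹ * e v * (n * s * n⁻¹)⁻¹ = e v := by
      have h3 := hcM w hw _ hmM
      rw [← hmw] at h3
      calc n * s * n⁻¹ * e v * (n * s * n⁻¹)⁻¹ = m⁻¹ * (m * (n * s * n⁻¹) * m⁻¹ *
            (m * e v * m⁻¹) * (m * (n * s * n⁻¹) * m⁻¹)⁻¹) * m := by group
        _ = e v := by rw [h3]; group
    rw [hn'M v hv hvΦ] at h1
    exact hq0 (by linear_combination h.e_inj h1)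
  intro n hn r hr
  simpa using hinv n⁻¹ (inv_mem hn) r hr

end odd

end

end BicyclicModel

namespace BicyclicModel

variable {G R : Type*} [Group G] [CommRing R] {P M Φ A : Subgroup G} {e : R → G} {x b : G}
  {ξ : R} {μ : ℕ}

section

variable (h : BicyclicModel P M Φ e x b ξ μ) (h2 : (2 : R) = 0)
include h h2

theorem ξ_ne_zero_of_two_eq_zero : ξ ≠ 0 := by simpa [h2] using h.ξ_ne 0

theorem ξ_mul_unit_of_two_eq_zero {t : R} (ht : IsUnit t) : ξ * t = ξ := by
  obtain ⟨s, hs⟩ := h.ξ_mul_unit ht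
  rw [hs, h2, zero_mul, add_zero]

theorem eq_zero_or_eq_ξ_of_not_isUnit {t : R} (ht : ¬ IsUnit t) : t = 0 ∨ t = ξ := by
  obtain ⟨s, v, rfl⟩ := (h.isUnit_or t).resolve_right ht
  rw [h2, zero_mul, zero_add]
  rcases h.isUnit_or v with ⟨q, w, rfl⟩ | hv
  · obtain ⟨σ, hσ⟩ := h.ξ_sq
    left
    linear_combination (ξ * q + ξ * σ * w) * h2 + w * hσ
  · exact Or.inr (h.ξ_mul_unit_of_two_eq_zero h2 hv)

theorem commute_e_of_two_eq_zero {u : G} (hu : u ∈ M) (r : R) : u * e r = e r * u :=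
  h.commute_of_two_mul hu (by rw [h2, zero_mul])

theorem x_sq_conj_of_two_eq_zero {u : G} (hu : u ∈ M) (hu' : u ∉ Φ) :
    x ^ 2 * u * (x ^ 2)⁻¹ = e ξ * u := by
  obtain ⟨t, ht, hxu⟩ := h.x_conj_M hu hu'
  rw [h.x_sq_conj_M hxu, h2, zero_add, h.ξ_mul_unit_of_two_eq_zero h2 ht]

theorem mem_M_iff_of_two_eq_zero {u : G} (hu : u ∈ P) : u ∈ M ↔ u ^ 2 ^ μ = 1 := by
  obtain ⟨ν, hν⟩ := Nat.exists_eq_add_of_le h.two_le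
  have hμ : 2 ^ μ = 2 * 2 ^ ν * 2 := by rw [hν, pow_add]; ring
  have hμ' : 2 ^ (μ - 1) * 2 = 2 ^ μ := by
    rw [← pow_succ]; congr 1; omega
  constructor
  · intro huM
    obtain ⟨r, hr⟩ := (h.mem_M_iff hu).1 huM
    rw [← hμ', pow_mul, hr, ← h.e_nsmul, h.e_eq_one, Nat.cast_two, h2, zero_mul]
  · intro hu1
    by_contra huM
    obtain ⟨k, r, hk⟩ := h.P_form hu huM
    obtain ⟨s, hs⟩ := h.pow_two_mul_form hk (2 ^ ν)
    obtain ⟨η, hη⟩ := h.x_pow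
    have hc : x ^ ((2 * k + 1) * (2 * 2 ^ ν)) * e s = e s * x ^ ((2 * k + 1) * (2 * 2 ^ ν)) := by
      refine h.commute_e_of_two_eq_zero h2 (h.Φ_le ?_) s
      have := h.x_pow_even_mem ((2 * k + 1) * 2 ^ ν)
      convert this using 2
      ring
    have h3 : x ^ ((2 * k + 1) * 2 ^ μ) = e ξ := by
      rw [mul_comm, pow_mul, hη, ← h.e_nsmul]
      congr 1
      push_cast
      linear_combination (k * ξ + (2 * k + 1) * η) * h2
    have h4 : u ^ 2 ^ μ = e ξ := by
      rw [hμ, pow_mul, hs, (show Commute _ _ from hc).mul_pow, ← h.e_nsmul, ← pow_mul,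
        mul_assoc _ _ 2, ← hμ, h3, Nat.cast_two, h2, zero_mul, h.e_zero, mul_one]
    rw [h4, h.e_eq_one] at hu1
    exact h.ξ_ne_zero_of_two_eq_zero h2 hu1

end

section

variable [Finite G] (h : BicyclicModel P M Φ e x b ξ μ) (L : LocalFusion P Φ A)
  (h2 : (2 : R) = 0)
include h L h2

omit [Finite G] in
theorem normalizer_le_of_not_le_M_of_two_eq_zero (hAM : ¬ A ≤ M) (hAP : A ≠ P) :
    Subgroup.normalizer (A : Set G) ≤ A.actsTriviallyMod Φ := by
  obtain ⟨g, hgA, hgM⟩ := SetLike.not_le_iff_exists.1 hAM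
  have hAΦ : ∀ a ∈ A, a ∈ M → a ∈ Φ := by
    intro a ha haM
    by_contra haΦ
    refine hAP (le_antisymm L.le (h.frattini A L.le fun u hu => ?_))
    have hM : ∀ u ∈ M, u ∈ A ⊔ Φ := by
      intro u hu
      by_cases huΦ : u ∈ Φ
      · exact Subgroup.mem_sup_right huΦ
      · have := mul_mem (Subgroup.mem_sup_left ha)
          (Subgroup.mem_sup_right (S := A) (h.index_Φ a haM u hu haΦ huΦ))
        simpa using this
    by_cases huM : u ∈ M
    · exact hM u huM
    · have := mul_mem (Subgroup.mem_sup_left hgA) (hM _ (h.index_M g (L.le hgA) u hu hgM huM))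
      simpa using this
  intro n hn
  refine ⟨hn, fun a ha => ?_⟩
  have hna := Subgroup.conj_mem_of_mem_normalizer hn ha
  have hiff : n * a * n⁻¹ ∈ M ↔ a ∈ M := by
    rw [h.mem_M_iff_of_two_eq_zero h2 (L.le hna), h.mem_M_iff_of_two_eq_zero h2 (L.le ha),
      conj_pow, conj_eq_one_iff]
  have hm := mul_mem (inv_mem ha) hna
  by_cases haM : a ∈ M
  · exact hAΦ _ hm (mul_mem (inv_mem haM) (hiff.2 haM))
  · exact hAΦ _ hm (h.index_M a (L.le ha) _ (L.le hna) haM fun hc => haM (hiff.1 hc))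

theorem normalizer_le_of_eq_M_of_two_eq_zero (hAM : A = M) :
    Subgroup.normalizer (A : Set G) ≤ A.actsTriviallyMod Φ := by
  subst hAM
  have hcomm : ∀ a ∈ A, ∃ r, a⁻¹ * (x * a * x⁻¹) = e r := by
    intro a ha
    obtain ⟨r, hr⟩ := h.comm x h.x_mem a (L.le ha)
    refine ⟨r, ?_⟩
    rw [mul_inv_eq_iff_eq_mul] at hr
    rw [hr, ← h.commute_e_of_two_eq_zero h2 ha, inv_mul_cancel_left]
  refine L.of_invariant (Y := A ⊓ Subgroup.centralizer A) (fun u hu => ?_) (fun n hn y hy => ?_)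
    h.x_mem h.x_not_mem (Subgroup.mem_normalizer_of_conj_mem fun a ha => ?_) fun a ha => ?_
  · obtain ⟨huA, huc⟩ := hu
    by_contra huΦ
    have h3 := h.x_sq_conj_of_two_eq_zero h2 huA huΦ
    have hx2 : x ^ 2 ∈ A := h.Φ_le (h.x_pow_even_mem 1)
    rw [Subgroup.mem_centralizer_iff.1 huc _ hx2, mul_inv_cancel_right, right_eq_mul,
      h.e_eq_one] at h3
    exact h.ξ_ne_zero_of_two_eq_zero h2 h3
  · refine ⟨Subgroup.conj_mem_of_mem_normalizer hn hy.1, Subgroup.mem_centralizer_iff.2 fun c hc => ?_⟩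
    have := Subgroup.mem_centralizer_iff.1 hy.2 _ (Subgroup.conj_mem_of_mem_normalizer' hn hc)
    calc c * (n * y * n⁻¹) = n * (n⁻¹ * c * n * y) * n⁻¹ := by group
      _ = n * y * n⁻¹ * c := by rw [this]; group
  · obtain ⟨r, hr⟩ := hcomm a ha
    rw [inv_mul_eq_iff_eq_mul] at hr
    exact hr ▸ mul_mem ha (h.Φ_le (h.e_mem r))
  · obtain ⟨r, hr⟩ := hcomm a ha
    rw [hr]
    exact ⟨h.Φ_le (h.e_mem r), Subgroup.mem_centralizer_iff.2
      fun c hc => h.commute_e_of_two_eq_zero h2 hc r⟩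

theorem normalizer_le_of_lt_M_of_two_eq_zero
    (hC : ∀ s ∈ P, (∀ a ∈ A, s * a = a * s) → s ∈ A) (hAM : A < M) :
    Subgroup.normalizer (A : Set G) ≤ A.actsTriviallyMod Φ := by
  by_cases hAΦ : A ≤ Φ
  · exact Subgroup.normalizer_le_actsTriviallyMod hAΦ
  obtain ⟨g, hgA, hgΦ⟩ := SetLike.not_le_iff_exists.1 hAΦ
  have hc : ∀ r, ∀ a ∈ A, e r * a = a * e r := fun r a ha =>
    (h.commute_e_of_two_eq_zero h2 (hAM.le ha) r).symm
  have heA : ∀ r, e r ∈ A := fun r => hC _ (h.Φ_le_P (h.e_mem r)) (hc r)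
  have heE : ∀ r, e r ∈ A.centralInvolutions := fun r =>
    h.e_mem_centralInvolutions (by rw [h2, zero_mul]) (heA r) (hc r)
  have hPN : P ≤ Subgroup.normalizer (A : Set G) := by
    refine fun s hs => Subgroup.mem_normalizer_of_conj_mem fun a ha => ?_
    obtain ⟨r, hr⟩ := h.comm s hs a (L.le ha)
    rw [mul_inv_eq_iff_eq_mul] at hr
    exact hr ▸ mul_mem (heA r) ha
  have hx2Φ : x ^ 2 ∈ Φ := h.x_pow_even_mem 1
  have hx2P := h.Φ_le_P hx2Φ
  have hx2c : ∀ r, x ^ 2 * e r * (x ^ 2)⁻¹ = e r := fun r => by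
    rw [h.commute_e_of_two_eq_zero h2 (h.Φ_le hx2Φ), mul_inv_cancel_right]
  have hx2A : x ^ 2 ∉ A := by
    intro hx
    have hΦA : Φ ≤ A := by
      intro u hu
      obtain ⟨k, r, rfl⟩ := h.Φ_form hu
      rw [pow_mul]
      exact mul_mem (pow_mem hx k) (heA r)
    refine hAM.not_ge fun u hu => ?_
    by_cases huΦ : u ∈ Φ
    · exact hΦA huΦ
    · have := mul_mem hgA (hΦA (h.index_Φ g (hAM.le hgA) u hu hgΦ huΦ))
      simpa using this
  have hx2 : ∀ a ∈ A, a⁻¹ * (x ^ 2 * a * (x ^ 2)⁻¹) = 1 ∨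
      a⁻¹ * (x ^ 2 * a * (x ^ 2)⁻¹) = e ξ := by
    intro a ha
    by_cases haΦ : a ∈ Φ
    · left
      obtain ⟨k, r, rfl⟩ := h.Φ_form haΦ
      have h1 := hx2c r
      rw [mul_inv_eq_iff_eq_mul] at h1
      rw [inv_mul_eq_one, eq_mul_inv_iff_mul_eq, mul_assoc, ← h1, ← mul_assoc, ← mul_assoc,
        ← pow_add, ← pow_add, add_comm]
    · right
      rw [h.x_sq_conj_of_two_eq_zero h2 (hAM.le ha) haΦ, hc ξ a ha, inv_mul_cancel_left]
  by_cases hEΦ : A.centralInvolutions ≤ Φ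
  · refine L.of_invariant hEΦ (fun n hn y hy => Subgroup.conj_mem_centralInvolutions hn hy)
      hx2P hx2A (hPN hx2P) fun a ha => ?_
    rcases hx2 a ha with h3 | h3 <;> rw [h3]
    · exact one_mem _
    · exact heE ξ
  suffices hfix : ∀ n ∈ Subgroup.normalizer (A : Set G), n * e ξ * n⁻¹ = e ξ by
    refine L.of_invariant (Y := Subgroup.zpowers (e ξ)) (by simpa using h.e_mem ξ)
      (fun n hn y hy => ?_) hx2P hx2A (hPN hx2P) fun a ha => ?_
    · obtain ⟨i, rfl⟩ := hy
      refine ⟨i, ?_⟩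
      change e ξ ^ i = n * e ξ ^ i * n⁻¹
      rw [← conj_zpow, hfix n hn]
    · rcases hx2 a ha with h3 | h3 <;> rw [h3]
      · exact one_mem _
      · exact Subgroup.mem_zpowers _
  obtain ⟨c, hcE, hcΦ⟩ := SetLike.not_le_iff_exists.1 hEΦ
  have hEe : ∀ a ∈ A.centralInvolutions, a ∈ Φ → ∃ r, a = e r := fun a ha haΦ => by
    obtain ⟨r, -, hr⟩ := h.centralInvolutions_mem_Φ ha haΦ
    exact ⟨r, hr⟩
  have hEM : A.centralInvolutions ≤ M := fun a ha => hAM.le ha.1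
  have hD : ∀ n ∈ Subgroup.normalizer (A : Set G), (∀ r, ∃ s, n * e r * n⁻¹ = e s) →
      n ∈ Subgroup.normalizer ((⁅P, P⁆ : Subgroup G) : Set G) := by
    intro n _ hne
    refine Subgroup.mem_normalizer_of_conj_mem fun a ha => ?_
    obtain ⟨r, rfl⟩ := h.mem_commutator_iff.1 ha
    exact h.mem_commutator_iff.2 (hne r)
  have hPD : P ≤ Subgroup.normalizer ((⁅P, P⁆ : Subgroup G) : Set G) := fun s hs => hD s (hPN hs) fun r => by
    obtain ⟨t, ht⟩ := h.conj_e_exists hs r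
    exact ⟨t, by rw [ht, mul_inv_cancel_right]⟩
  have hxE : ∀ a ∈ A.centralInvolutions, a ∉ Φ → x ^ 2 * a * (x ^ 2)⁻¹ = e ξ * a :=
    fun a ha => h.x_sq_conj_of_two_eq_zero h2 (hEM ha)
  have hconj : ∀ n d : G, n * x ^ 2 * n⁻¹ * d * (n * x ^ 2 * n⁻¹)⁻¹ =
      n * (x ^ 2 * (n⁻¹ * d * n) * (x ^ 2)⁻¹) * n⁻¹ := fun n d => by
    generalize x ^ 2 = y; group
  have hE' : ∀ n ∈ Subgroup.normalizer (A : Set G), ∀ d ∈ A.centralInvolutions,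
      n⁻¹ * d * n ∈ A.centralInvolutions := fun n hn d hd => by
    simpa using Subgroup.conj_mem_centralInvolutions (inv_mem hn) hd
  have key₁ : ∀ n ∈ Subgroup.normalizer (A : Set G), (∀ r, ∃ s, n * e r * n⁻¹ = e s) →
      n * e ξ * n⁻¹ = e ξ := by
    intro n hn hne
    have hnD := hD n hn hne
    have hne' : ∀ r, ∃ s, n⁻¹ * e r * n = e s := fun r => by
      exact h.mem_commutator_iff.1
        (Subgroup.conj_mem_of_mem_normalizer' hnD (h.mem_commutator_iff.2 ⟨r, rfl⟩))
    let N : Subgroup G := Subgroup.normalizer (A : Set G) ⊓ Subgroup.normalizer ((⁅P, P⁆ : Subgroup G) : Set G)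
    let K : Subgroup G := N ⊓ Subgroup.centralizer ((⁅P, P⁆ : Subgroup G) : Set G)
    have hKc : ∀ m ∈ K, ∀ r, m * e r * m⁻¹ = e r := fun m hm r => by
      rw [← Subgroup.mem_centralizer_iff.1 hm.2 _ (h.mem_commutator_iff.2 ⟨r, rfl⟩),
        mul_inv_cancel_right]
    have hK : ∀ m ∈ N, (∀ r, m * e r * m⁻¹ = e r) → m ∈ K := fun m hm hmr => by
      refine ⟨hm, Subgroup.mem_centralizer_iff.2 fun a ha => ?_⟩
      obtain ⟨r, rfl⟩ := h.mem_commutator_iff.1 ha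
      rw [← mul_inv_eq_iff_eq_mul.1 (hmr r)]
    have hNdvd : ¬ 2 ∣ P.relIndex N :=
      not_dvd_relIndex_of_inf_le L.not_dvd inf_le_left fun s hs => ⟨hs.2, hPD hs.1⟩
    have hKdvd : ¬ 2 ∣ P.relIndex K := by
      refine not_dvd_relIndex_of_normalized L.isPGroup hNdvd inf_le_left fun m hm k hk =>
        hK _ (mul_mem (mul_mem hm hk.1) (inv_mem hm)) fun r => ?_
      obtain ⟨s, hs⟩ := h.mem_commutator_iff.1
        (Subgroup.conj_mem_of_mem_normalizer' hm.2 (h.mem_commutator_iff.2 ⟨r, rfl⟩))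
      calc m * k * m⁻¹ * e r * (m * k * m⁻¹)⁻¹ = m * (k * (m⁻¹ * e r * m) * k⁻¹) * m⁻¹ := by
            group
        _ = e r := by rw [hs, hKc k hk s, ← hs]; group
    have hn'K : n * x ^ 2 * n⁻¹ ∈ K := by
      have h3 : n * x ^ 2 * n⁻¹ ∈ N := by
        have hnN : n ∈ N := ⟨hn, hnD⟩
        exact mul_mem (mul_mem hnN ⟨hPN hx2P, hPD hx2P⟩) (inv_mem hnN)
      refine hK _ h3 fun r => ?_
      obtain ⟨s, hs⟩ := hne' r
      rw [hconj, hs, hx2c, ← hs]; group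
    obtain ⟨m, hm, hmP⟩ := L.isPGroup.exists_conj_conj_mem hKdvd hx2P hn'K
    set t := m * (n * x ^ 2 * n⁻¹) * m⁻¹ with ht
    have htK : t ∈ K := mul_mem (mul_mem hm hn'K) (inv_mem hm)
    have htM : t ∈ M := by
      by_contra htM
      obtain ⟨ω, hω, hωt⟩ := h.conj_of_not_mem_M hmP htM
      refine h.ξ_mul_unit_ne hω 0 ?_
      have h3 := hKc t htK 1
      rcases hωt with hωt | hωt <;> rw [hωt] at h3
      · linear_combination h.e_inj h3
      · linear_combination -h.e_inj h3 - h2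
    have hmc : m * c * m⁻¹ ∈ A.centralInvolutions :=
      Subgroup.conj_mem_centralInvolutions hm.1.1 hcE
    have hmcΦ : m * c * m⁻¹ ∉ Φ := by
      intro hcon
      obtain ⟨r, hr⟩ := hEe _ hmc hcon
      rw [← hKc m hm r] at hr
      exact hcΦ (mul_left_cancel (mul_right_cancel hr) ▸ h.e_mem r)
    obtain ⟨r, hr⟩ := hEe _ (mul_mem (inv_mem hcE) hmc) (h.index_Φ c (hEM hcE) _ (hEM hmc) hcΦ hmcΦ)
    rw [inv_mul_eq_iff_eq_mul] at hr
    obtain ⟨f, hf, hfM⟩ := h.conj_M (hEM hcE) hcΦ hmP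
    have h3 : n * x ^ 2 * n⁻¹ * c * (n * x ^ 2 * n⁻¹)⁻¹ = e f * c := by
      have h4 := hKc t htK r
      have h5 := hKc m hm f
      calc n * x ^ 2 * n⁻¹ * c * (n * x ^ 2 * n⁻¹)⁻¹ =
            m⁻¹ * (t * (m * c * m⁻¹) * t⁻¹) * m := by
              rw [ht]; generalize x ^ 2 = y; group
        _ = m⁻¹ * ((t * c * t⁻¹) * (t * e r * t⁻¹)) * m := by rw [hr]; group
        _ = m⁻¹ * (m * e f * m⁻¹ * (c * e r)) * m := by rw [hf, h4, h5]; simp only [mul_assoc]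
        _ = e f * c := by rw [← hr]; group
    have hd := hE' n hn c hcE
    have hdΦ : n⁻¹ * c * n ∉ Φ := by
      intro hcon
      obtain ⟨q, hq⟩ := hEe _ hd hcon
      obtain ⟨s, hs⟩ := hne q
      refine hcΦ ?_
      have : c = e s := by rw [← hs, ← hq]; group
      exact this ▸ h.e_mem s
    rw [hconj, hxE _ hd hdΦ] at h3
    have h6 : n * e ξ * n⁻¹ = e f := by
      refine mul_right_cancel (b := c) ?_
      rw [← h3]; group
    rcases h.eq_zero_or_eq_ξ_of_not_isUnit h2 (fun hu => hfM.1 hu htM) with rfl | rfl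
    · rw [h.e_zero, conj_eq_one_iff, h.e_eq_one] at h6
      exact absurd h6 (h.ξ_ne_zero_of_two_eq_zero h2)
    · exact h6
  have key₂ : ∀ n ∈ Subgroup.normalizer (A : Set G), ∀ r, n * e ξ * n⁻¹ = e r → r = ξ := by
    intro n hn r hr
    have hr0 : r ≠ 0 := by
      rintro rfl
      rw [h.e_zero, conj_eq_one_iff, h.e_eq_one] at hr
      exact h.ξ_ne_zero_of_two_eq_zero h2 hr
    have hin : ∀ v, n⁻¹ * e v * n ∈ Φ →
        n * x ^ 2 * n⁻¹ * e v * (n * x ^ 2 * n⁻¹)⁻¹ = e v := by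
      intro v hv
      obtain ⟨t, ht⟩ := hEe _ (hE' n hn _ (heE v)) hv
      rw [hconj, ht, hx2c, ← ht]; group
    have hout : ∀ v, n⁻¹ * e v * n ∉ Φ →
        n * x ^ 2 * n⁻¹ * e v * (n * x ^ 2 * n⁻¹)⁻¹ = e (r + v) := by
      intro v hv
      rw [hconj, hxE _ (hE' n hn _ (heE v)) hv, h.e_add, ← hr]; group
    have h3 := key₁ _ (mul_mem (mul_mem hn (hPN hx2P)) (inv_mem hn)) fun v => by
      by_cases hv : n⁻¹ * e v * n ∈ Φ
      · exact ⟨v, hin v hv⟩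
      · exact ⟨r + v, hout v hv⟩
    have h4 : n⁻¹ * e ξ * n ∈ Φ := by
      by_contra hcon
      rw [hout ξ hcon] at h3
      exact hr0 (by linear_combination h.e_inj h3)
    obtain ⟨q, hq⟩ := hEe _ (hE' n hn _ (heE ξ)) h4
    have h5 : n⁻¹ * e r * n = e ξ := by rw [← hr]; group
    by_contra hne
    have h6 := key₁ n⁻¹ (inv_mem hn) fun v => by
      rw [inv_inv]
      have h20 : ∀ w : R, 2 * w = 0 := fun w => by rw [h2, zero_mul]
      rcases h.ann_two (h20 r) (h20 ξ) (h20 v) hr0 (h.ξ_ne_zero_of_two_eq_zero h2) hne with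
        rfl | rfl | rfl | rfl
      · exact ⟨0, by simp [h.e_zero]⟩
      · exact ⟨ξ, h5⟩
      · exact ⟨q, hq⟩
      · refine ⟨ξ + q, ?_⟩
        rw [h.e_add, h.e_add, ← hq, ← h5]; group
    rw [inv_inv] at h6
    exact hne (h.e_inj (by rw [← hr, ← h6]; nth_rewrite 1 [← h6]; group))
  intro n hn
  have hv := Subgroup.conj_mem_centralInvolutions hn (heE ξ)
  suffices hvΦ : n * e ξ * n⁻¹ ∈ Φ by
    obtain ⟨r, hr⟩ := hEe _ hv hvΦ
    rw [hr, key₂ n hn r hr]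
  by_contra hvΦ
  have hp : ∀ p, p ≠ 0 → n⁻¹ * e p * n ∉ Φ := by
    intro p hp hpΦ
    obtain ⟨r, hr⟩ := hEe _ (hE' n hn _ (heE p)) hpΦ
    obtain ⟨w, hw, hwv⟩ := h.exists_conj_M (hEM hv) hvΦ p
    have h3 := key₂ (n⁻¹ * w * n) (mul_mem (mul_mem (inv_mem hn) (hPN hw)) hn) (r + ξ) (by
      rw [h.e_add, ← hr]
      calc n⁻¹ * w * n * e ξ * (n⁻¹ * w * n)⁻¹ = n⁻¹ * (w * (n * e ξ * n⁻¹) * w⁻¹) * n := by group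
        _ = _ := by rw [hwv]; group)
    have hr0 : r = 0 := by linear_combination h3
    rw [hr0, h.e_zero] at hr
    refine hp (h.e_eq_one.1 ?_)
    calc e p = n * (n⁻¹ * e p * n) * n⁻¹ := by group
      _ = 1 := by rw [hr]; group
  have hnt := h.nontrivial
  have h1 := hE' n hn _ (heE 1)
  have hξ := hE' n hn _ (heE ξ)
  refine hp (-1 + ξ) ?_ ?_
  · intro hcon
    have := h.not_isUnit 0 1
    rw [mul_zero, zero_add, mul_one, show ξ = 1 by linear_combination hcon] at this
    exact this isUnit_one
  · have := h.index_Φ _ (hEM h1) _ (hEM hξ) (hp 1 one_ne_zero)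
      (hp ξ (h.ξ_ne_zero_of_two_eq_zero h2))
    rw [h.e_add, h.e_neg]
    convert this using 1
    group

end

/-- The local step: the fusion of a fully normalised subgroup by its normaliser is trivial modulo
the Frattini subgroup. -/
theorem normalizer_le_actsTriviallyMod [Finite G] (h : BicyclicModel P M Φ e x b ξ μ)
    (L : LocalFusion P Φ A)
    (hζ : (2 : R) ≠ 0 → ∃ z : R, z ≠ 0 ∧ 2 * z = 0 ∧ ξ * z = 0 ∧
      ∀ g, g * e z * g⁻¹ = e z → ∀ u ∈ P, g * u * g⁻¹ ∈ P → u⁻¹ * (g * u * g⁻¹) ∈ Φ) :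
    Subgroup.normalizer (A : Set G) ≤ A.actsTriviallyMod Φ := by
  by_cases hAP : A = P
  · subst hAP; exact h.normalizer_le_of_eq L
  by_cases hC : ∀ s ∈ P, (∀ a ∈ A, s * a = a * s) → s ∈ A
  swap
  · push Not at hC
    obtain ⟨s, hsP, hs, hsA⟩ := hC
    exact L.of_centralizer hsP hsA hs
  have hM : A ≤ M → A = M ∨ A < M := fun hAM => eq_or_lt_of_le hAM
  by_cases h2 : (2 : R) = 0
  · by_cases hAM : A ≤ M
    · rcases hM hAM with hAM | hAM
      · exact h.normalizer_le_of_eq_M_of_two_eq_zero L h2 hAM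
      · exact h.normalizer_le_of_lt_M_of_two_eq_zero L h2 hC hAM
    · exact h.normalizer_le_of_not_le_M_of_two_eq_zero L h2 hAM hAP
  · obtain ⟨z, hz0, hz2, hzξ, hfix⟩ := hζ h2
    by_cases hAM : A ≤ M
    · rcases hM hAM with hAM | hAM
      · exact h.normalizer_le_of_eq_M h2 hAM
      · exact h.normalizer_le_of_lt_M L hz2 hfix h2 hC hAM
    · have hlt := Subgroup.card_lt_card_inf_normalizer L.isPGroup (lt_of_le_of_ne L.le hAP)
      obtain ⟨s, ⟨hsP, hsN⟩, hsA⟩ : ∃ s ∈ P ⊓ Subgroup.normalizer (A : Set G), s ∉ A := by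
        by_contra! hc
        exact hlt.not_ge (Subgroup.card_le_of_le hc)
      exact h.normalizer_le_of_not_le_M L hz2 hfix hz0 hzξ hC hAM hsP hsA hsN

end BicyclicModel

/-- Every element is a power of `x` times a power of `y`. -/
def IsBicyclicPair {P : Type*} [Group P] (x y : P) : Prop :=
  ∀ g : P, ∃ i j : ℤ, g = x ^ i * y ^ j

namespace IsBicyclicPair

variable {P : Type*} [Group P] {x y : P}

open scoped commutatorElement

theorem commutator_le (h : IsBicyclicPair x y) {N : Subgroup P} [N.Normal]
    (hN : x * y * x⁻¹ * y⁻¹ ∈ N) : commutator P ≤ N := by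
  have hc : Commute (x : P ⧸ N) (y : P ⧸ N) := by
    have h1 : (((x * y * x⁻¹ * y⁻¹ : P)) : P ⧸ N) = 1 := (QuotientGroup.eq_one_iff _).2 hN
    simp only [QuotientGroup.mk_mul, QuotientGroup.mk_inv] at h1
    rwa [mul_inv_eq_one, mul_inv_eq_iff_eq_mul] at h1
  rw [commutator_def, Subgroup.commutator_le]
  intro g _ k _
  rw [← QuotientGroup.eq_one_iff]
  obtain ⟨i, j, rfl⟩ := h g
  obtain ⟨m, n, rfl⟩ := h k
  change ⁅(x : P ⧸ N) ^ i * (y : P ⧸ N) ^ j, (x : P ⧸ N) ^ m * (y : P ⧸ N) ^ n⁆ = 1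
  rw [commutatorElement_eq_one_iff_commute]
  exact Commute.mul_left
    (((Commute.refl _).zpow_zpow i m).mul_right (hc.zpow_zpow i n))
    ((hc.symm.zpow_zpow j m).mul_right ((Commute.refl _).zpow_zpow j n))

theorem symm_form (h : IsBicyclicPair x y) (g : P) : ∃ i j : ℤ, g = y ^ j * x ^ i := by
  obtain ⟨i, j, hij⟩ := h g⁻¹
  exact ⟨-i, -j, by rw [zpow_neg, zpow_neg, ← mul_inv_rev, ← hij, inv_inv]⟩

/-- Itô's theorem on products of two abelian subgroups, for cyclic factors. -/
theorem commute_of_mem_commutator (h : IsBicyclicPair x y) {g k : P} (hg : g ∈ commutator P)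
    (hk : k ∈ commutator P) : g * k = k * g := by
  let S : Set P := {c | ∃ i j : ℤ, c = ⁅x ^ i, y ^ j⁆}
  have hcl : ∀ i j m : ℤ, x ^ m * ⁅x ^ i, y ^ j⁆ * (x ^ m)⁻¹ ∈ Subgroup.closure S := by
    intro i j m
    have h1 : x ^ m * ⁅x ^ i, y ^ j⁆ * (x ^ m)⁻¹ = ⁅x ^ (m + i), y ^ j⁆ * ⁅x ^ m, y ^ j⁆⁻¹ := by
      simp only [commutatorElement_def]; group
    rw [h1]
    exact mul_mem (Subgroup.subset_closure ⟨_, _, rfl⟩)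
      (inv_mem (Subgroup.subset_closure ⟨_, _, rfl⟩))
  have hcl' : ∀ i j m : ℤ, y ^ m * ⁅x ^ i, y ^ j⁆ * (y ^ m)⁻¹ ∈ Subgroup.closure S := by
    intro i j m
    have h1 : y ^ m * ⁅x ^ i, y ^ j⁆ * (y ^ m)⁻¹ = ⁅x ^ i, y ^ m⁆⁻¹ * ⁅x ^ i, y ^ (m + j)⁆ := by
      simp only [commutatorElement_def]; group
    rw [h1]
    exact mul_mem (inv_mem (Subgroup.subset_closure ⟨_, _, rfl⟩))
      (Subgroup.subset_closure ⟨_, _, rfl⟩)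
  have hconj : ∀ z : P, (∀ c ∈ S, z * c * z⁻¹ ∈ Subgroup.closure S) →
      ∀ c ∈ Subgroup.closure S, z * c * z⁻¹ ∈ Subgroup.closure S := by
    intro z hz c hc
    have : Subgroup.closure S ≤ (Subgroup.closure S).comap (MulAut.conj z).toMonoidHom :=
      (Subgroup.closure_le _).2 fun c hc => hz c hc
    exact this hc
  have hnormal : (Subgroup.closure S).Normal := by
    refine ⟨fun c hc z => ?_⟩
    obtain ⟨m, n, rfl⟩ := h z
    have h1 := hconj (x ^ m) (by rintro _ ⟨i, j, rfl⟩; exact hcl i j m) _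
      (hconj (y ^ n) (by rintro _ ⟨i, j, rfl⟩; exact hcl' i j n) c hc)
    convert h1 using 1
    group
  have hle : commutator P ≤ Subgroup.closure S :=
    h.commutator_le (Subgroup.subset_closure ⟨1, 1, by simp [commutatorElement_def]⟩)
  have key : ∀ i j m n : ℤ, x ^ m * (y ^ n * ⁅x ^ i, y ^ j⁆ * (y ^ n)⁻¹) * (x ^ m)⁻¹ =
      y ^ n * (x ^ m * ⁅x ^ i, y ^ j⁆ * (x ^ m)⁻¹) * (y ^ n)⁻¹ := by
    intro i j m n
    obtain ⟨a₁, b₁, hb⟩ := h.symm_form (x ^ m * y ^ j * (x ^ m)⁻¹)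
    obtain ⟨a₂, b₂, ha⟩ := h (y ^ n * x ^ i * (y ^ n)⁻¹)
    have hcomm : ∀ g u v : P, g * ⁅u, v⁆ * g⁻¹ = ⁅g * u * g⁻¹, g * v * g⁻¹⁆ := by
      intro g u v; simp only [commutatorElement_def]; group
    have hxx : ∀ p q : ℤ, x ^ p * x ^ q * (x ^ p)⁻¹ = x ^ q := by intro p q; group
    have hyy : ∀ p q : ℤ, y ^ p * y ^ q * (y ^ p)⁻¹ = y ^ q := by intro p q; group
    have h1 : ∀ a b c : ℤ, ⁅x ^ a, y ^ b * x ^ c⁆ = ⁅x ^ a, y ^ b⁆ := by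
      intro a b c; simp only [commutatorElement_def]; group
    have h2 : ∀ a b c : ℤ, ⁅x ^ a * y ^ b, y ^ c⁆ = ⁅x ^ a, y ^ c⁆ := by
      intro a b c; simp only [commutatorElement_def]; group
    rw [hcomm (y ^ n), hyy, ha, h2, hcomm (x ^ m) (x ^ i), hxx, hb, h1, hcomm, hxx, hb, h1, hcomm,
      hyy, ha, h2]
  have hS : ∀ c ∈ S, ∀ d ∈ S, c * d = d * c := by
    rintro _ ⟨m, n, rfl⟩ _ ⟨i, j, rfl⟩
    have h1 := key i j (-m) (-n)
    generalize ⁅x ^ i, y ^ j⁆ = d at h1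
    calc ⁅x ^ m, y ^ n⁆ * d
        = x ^ m * y ^ n * (x ^ (-m) * (y ^ (-n) * d * (y ^ (-n))⁻¹) * (x ^ (-m))⁻¹) *
          (x ^ (-m) * y ^ (-n)) := by rw [commutatorElement_def]; group
      _ = d * ⁅x ^ m, y ^ n⁆ := by rw [h1, commutatorElement_def]; group
  have := Subgroup.isMulCommutative_closure hS
  exact setLike_mul_comm (hle hg) (hle hk)

end IsBicyclicPair

universe u

/-- The commutator subgroup `e R` of a group `P` generated by `x` and `y` as a bicyclic pair,
viewed as a free module of rank one over a commutative ring `R` in which `1 + ξ` and `1 + υ`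
describe conjugation by `x` and `y`. -/
structure BicyclicRing {P R : Type*} [Group P] [CommRing R] (x y : P) (e : R → P) (ξ υ : R) :
    Prop where
  pair : IsBicyclicPair x y
  e_add : ∀ r s, e (r + s) = e r * e s
  e_inj : Function.Injective e
  mem_commutator : ∀ g, g ∈ commutator P ↔ ∃ r, g = e r
  e_one : e 1 = x * y * x⁻¹ * y⁻¹
  x_conj : ∀ r, x * e r * x⁻¹ = e ((1 + ξ) * r)
  y_conj : ∀ r, y * e r * y⁻¹ = e ((1 + υ) * r)
  span : ∀ r : R, ∃ (m : ℤ) (s t : R), r = m + ξ * s + υ * t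
  nil_two : IsNilpotent (2 : R)
  nil_ξ : IsNilpotent ξ
  nil_υ : IsNilpotent υ

theorem exists_zpow_eq_pow {P : Type*} [Group P] [Finite P] (x : P) (i : ℤ) :
    ∃ k : ℕ, x ^ i = x ^ k := by
  obtain ⟨k, hk⟩ := mem_powers_iff_mem_zpowers.2 (⟨i, rfl⟩ : x ^ i ∈ Subgroup.zpowers x)
  exact ⟨k, hk.symm⟩

theorem isNilpotent_of_one_add_pow_eq_one {R : Type*} [CommRing R] {ξ : R} {n : ℕ}
    (h2 : IsNilpotent (2 : R)) (h : (1 + ξ) ^ 2 ^ n = 1) : IsNilpotent ξ := by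
  obtain ⟨r, hr⟩ := exists_add_pow_prime_pow_eq Nat.prime_two 1 ξ n
  rw [h, one_pow] at hr
  have h1 : IsNilpotent (ξ ^ 2 ^ n) := by
    have : ξ ^ 2 ^ n = 2 * (-(ξ * r)) := by push_cast at hr; linear_combination -hr
    rw [this]
    exact (Commute.all _ _).isNilpotent_mul_right h2
  exact (IsNilpotent.pow_iff_pos (by positivity)).1 h1

open scoped commutatorElement in
theorem IsBicyclicPair.exists_ring {P : Type u} [Group P] [Finite P] (hP : IsPGroup 2 P) {x y : P}
    (h : IsBicyclicPair x y) :
    ∃ (R : Type u) (_ : CommRing R) (e : R → P) (ξ υ : R), BicyclicRing x y e ξ υ := by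
  let _ : CommGroup (commutator P) :=
    { (inferInstance : Group (commutator P)) with
      mul_comm := fun a b => Subtype.ext (h.commute_of_mem_commutator a.2 b.2) }
  let A := Additive (commutator P)
  let T : P → AddMonoid.End A := fun g =>
    MonoidHom.toAdditive (MulAut.conjNormal g : MulAut (commutator P)).toMonoidHom
  have hT : ∀ (g : P) (a : commutator P), ((T g (Additive.ofMul a)).toMul : P) = g * a * g⁻¹ :=
    fun g a => MulAut.conjNormal_apply g a
  have hext : ∀ f k : AddMonoid.End A,
      (∀ a : commutator P, ((f (Additive.ofMul a)).toMul : P) = (k (Additive.ofMul a)).toMul) →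
        f = k := fun f k hfk => AddMonoidHom.ext fun a => Subtype.ext (hfk a.toMul)
  have hTmul : ∀ g k, T (g * k) = T g * T k := by
    intro g k
    refine hext _ _ fun a => ?_
    change _ = ((T g (Additive.ofMul (T k (Additive.ofMul a)).toMul)).toMul : P)
    rw [hT, hT, hT]; group
  have hT1 : T 1 = 1 := hext _ _ fun a => by rw [hT]; simp
  have hTcomm : ∀ g ∈ Set.range T, ∀ k ∈ Set.range T, g * k = k * g := by
    rintro _ ⟨g, rfl⟩ _ ⟨k, rfl⟩
    rw [← hTmul, ← hTmul]
    refine hext _ _ fun a => ?_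
    rw [hT, hT]
    have hm : (k * g)⁻¹ * (g * k) ∈ commutator P := by
      have := Subgroup.commutator_mem_commutator (Subgroup.mem_top g⁻¹) (Subgroup.mem_top k⁻¹)
      rw [← commutator_def, commutatorElement_def] at this
      convert this using 1; group
    have := h.commute_of_mem_commutator hm a.2
    calc g * k * a * (g * k)⁻¹ = (k * g) * ((k * g)⁻¹ * (g * k) * a) * (g * k)⁻¹ := by group
      _ = k * g * a * (k * g)⁻¹ := by rw [this]; group
  let R := Subring.closure (Set.range T)
  have hR : IsMulCommutative R := Subring.isMulCommutative_closure hTcomm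
  let _ : CommRing R := { (inferInstance : Ring R) with mul_comm := hR.is_comm.comm }
  have hTR : ∀ g, T g ∈ R := fun g => Subring.subset_closure ⟨g, rfl⟩
  let τ : P → R := fun g => ⟨T g, hTR g⟩
  have hτmul : ∀ g k, τ (g * k) = τ g * τ k := fun g k => Subtype.ext (hTmul g k)
  have hτ1 : τ 1 = 1 := Subtype.ext hT1
  have hτpow : ∀ g (n : ℕ), τ (g ^ n) = τ g ^ n := by
    intro g n
    induction n with
    | zero => simp [hτ1]
    | succ n ih => rw [pow_succ, hτmul, ih, pow_succ]
  have hcmem : x * y * x⁻¹ * y⁻¹ ∈ commutator P := by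
    have := Subgroup.commutator_mem_commutator (Subgroup.mem_top x) (Subgroup.mem_top y)
    rwa [← commutator_def, commutatorElement_def] at this
  let c : commutator P := ⟨_, hcmem⟩
  let e : R → P := fun r => ((r : AddMonoid.End A) (Additive.ofMul c)).toMul
  have he_add : ∀ r s, e (r + s) = e r * e s := fun r s => rfl
  have he_neg : ∀ r, e (-r) = (e r)⁻¹ := fun r => rfl
  have he_conj : ∀ g r, g * e r * g⁻¹ = e (τ g * r) := fun g r => (hT g _).symm
  have he_mem : ∀ r, e r ∈ commutator P := fun r => Subtype.prop _
  have he_one : e 1 = x * y * x⁻¹ * y⁻¹ := rfl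
  have he_zero : e 0 = 1 := rfl
  let E : Subgroup P :=
    { carrier := Set.range e
      one_mem' := ⟨0, he_zero⟩
      mul_mem' := by rintro _ _ ⟨r, rfl⟩ ⟨s, rfl⟩; exact ⟨r + s, he_add r s⟩
      inv_mem' := by rintro _ ⟨r, rfl⟩; exact ⟨-r, he_neg r⟩ }
  have hE : E.Normal := ⟨by rintro _ ⟨r, rfl⟩ g; exact ⟨τ g * r, (he_conj g r).symm⟩⟩
  have hle : commutator P ≤ E := h.commutator_le ⟨1, he_one⟩
  have he_inj : Function.Injective e := by
    have key : ∀ r, e r = 1 → r = 0 := by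
      intro r hr
      refine Subtype.ext (hext _ _ fun a => ?_)
      obtain ⟨s, hs⟩ := hle a.2
      have h1 : e (r * s) = 1 := by
        rw [mul_comm]
        change (((s : AddMonoid.End A) ((r : AddMonoid.End A) (Additive.ofMul c))).toMul : P) = 1
        have : (r : AddMonoid.End A) (Additive.ofMul c) = 0 := Subtype.ext hr
        rw [this, map_zero]; rfl
      have h2 : (s : AddMonoid.End A) (Additive.ofMul c) = Additive.ofMul a := Subtype.ext hs
      rw [← h2]
      exact h1
    intro r s hrs
    have := key (r - s) (by rw [sub_eq_add_neg, he_add, he_neg, hrs, mul_inv_cancel])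
    exact sub_eq_zero.1 this
  have h2 : IsNilpotent (2 : R) := by
    obtain ⟨n, hn⟩ := IsPGroup.iff_card.1 (hP.to_subgroup (commutator P))
    refine ⟨n, he_inj ?_⟩
    have hsm : ∀ k : ℕ, e (k : R) = e 1 ^ k := by
      intro k
      induction k with
      | zero => simp [he_zero]
      | succ k ih => rw [Nat.cast_succ, he_add, ih, pow_succ]
    have h1 := hsm (2 ^ n)
    push_cast at h1
    rw [h1, he_zero, ← hn]
    exact congrArg Subtype.val (pow_card_eq_one' (x := c))
  have hnil : ∀ g, IsNilpotent (τ g - 1) := by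
    intro g
    obtain ⟨n, hn⟩ := hP g
    refine isNilpotent_of_one_add_pow_eq_one (n := n) h2 ?_
    rw [add_sub_cancel, ← hτpow, hn, hτ1]
  let ξ := τ x - 1
  let υ := τ y - 1
  let S : R → Prop := fun r => ∃ (m : ℤ) (s t : R), r = m + ξ * s + υ * t
  have hSadd : ∀ r s, S r → S s → S (r + s) := by
    rintro _ _ ⟨m, s, t, rfl⟩ ⟨m', s', t', rfl⟩
    exact ⟨m + m', s + s', t + t', by push_cast; ring⟩
  have hSmul : ∀ r s, S r → S s → S (r * s) := by
    rintro _ _ ⟨m, s, t, rfl⟩ ⟨m', s', t', rfl⟩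
    exact ⟨m * m', s * (m' + ξ * s' + υ * t') + m * s', t * (m' + ξ * s' + υ * t') + m * t',
      by push_cast; ring⟩
  have hSneg : ∀ r, S r → S (-r) := by
    rintro _ ⟨m, s, t, rfl⟩
    exact ⟨-m, -s, -t, by push_cast; ring⟩
  have hS1 : S 1 := ⟨1, 0, 0, by simp⟩
  have hSpow : ∀ r (n : ℕ), S r → S (r ^ n) := by
    intro r n hr
    induction n with
    | zero => simpa using hS1
    | succ n ih => rw [pow_succ]; exact hSmul _ _ ih hr
  have hSτ : ∀ g, S (τ g) := by
    intro g
    obtain ⟨i, j, rfl⟩ := h g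
    obtain ⟨i', hi⟩ := exists_zpow_eq_pow x i
    obtain ⟨j', hj⟩ := exists_zpow_eq_pow y j
    rw [hi, hj, hτmul, hτpow, hτpow]
    exact hSmul _ _ (hSpow _ _ ⟨1, 1, 0, by simp [ξ]⟩) (hSpow _ _ ⟨1, 0, 1, by simp [υ]⟩)
  refine ⟨R, inferInstance, e, ξ, υ, h, he_add, he_inj,
    fun g => ⟨fun hg => (hle hg).imp fun _ => Eq.symm, by rintro ⟨r, rfl⟩; exact he_mem r⟩,
    he_one, fun r => ?_, fun r => ?_, ?_, h2, hnil x, hnil y⟩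
  · rw [he_conj]; congr 2; simp [ξ]
  · rw [he_conj]; congr 2; simp [υ]
  · rintro ⟨r, hr⟩
    refine Subring.closure_induction (p := fun r hr => S ⟨r, hr⟩) ?_ ⟨0, 0, 0, by simp⟩ hS1
      (fun r s _ _ => hSadd _ _) (fun r _ => hSneg _) (fun r s _ _ => hSmul _ _) hr
    rintro _ ⟨g, rfl⟩
    exact hSτ g

namespace IsPGroup

theorem exists_index_two {P : Type*} [Group P] [Finite P] (hP : IsPGroup 2 P) {K : Subgroup P}
    (hK : K ≠ ⊤) : ∃ H : Subgroup P, H.index = 2 ∧ K ≤ H := by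
  obtain ⟨n, hn⟩ := IsPGroup.iff_card.1 hP
  obtain ⟨k, hk⟩ := IsPGroup.iff_card.1 (hP.to_subgroup K)
  have hkn : k < n := by
    by_contra! h
    apply hK
    apply Subgroup.eq_top_of_le_card
    rw [hn, hk]
    exact Nat.pow_le_pow_right two_pos h
  obtain ⟨H, hH, hKH⟩ := Sylow.exists_subgroup_card_pow_prime_le (p := 2) (m := n - 1)
    (by rw [hn]; exact pow_dvd_pow _ (by omega)) K hk (by omega)
  refine ⟨H, ?_, hKH⟩
  have := H.card_mul_index
  rw [hH, hn, show n = n - 1 + 1 by omega, pow_succ, Nat.add_sub_cancel] at this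
  exact Nat.eq_of_mul_eq_mul_left (by positivity) this

end IsPGroup

namespace IsBicyclicPair

variable {P : Type*} [Group P] {x y : P}

theorem commutator_eq_bot (h : IsBicyclicPair x y) (hxy : x * y = y * x) : commutator P = ⊥ :=
  le_bot_iff.1 (h.commutator_le (Subgroup.mem_bot.2 (by rw [hxy]; group)))

theorem eq_top (h : IsBicyclicPair x y) {K : Subgroup P} (hx : x ∈ K) (hy : y ∈ K) : K = ⊤ := by
  refine eq_top_iff.2 fun g _ => ?_
  obtain ⟨i, j, rfl⟩ := h g
  exact mul_mem (zpow_mem hx i) (zpow_mem hy j)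

theorem exists_index_two [Finite P] (hP : IsPGroup 2 P) (h : IsBicyclicPair x y)
    (hc : commutator P ≠ ⊥) : ∃ H K : Subgroup P, H.index = 2 ∧ K.index = 2 ∧
      x ∈ H ∧ y ∉ H ∧ y ∈ K ∧ x ∉ K := by
  have hx : Subgroup.zpowers x ≠ ⊤ := fun ht => hc (h.commutator_eq_bot (by
    obtain ⟨k, rfl⟩ := Subgroup.mem_zpowers_iff.1 (ht ▸ Subgroup.mem_top y)
    exact ((Commute.refl x).zpow_right k).eq))
  have hy : Subgroup.zpowers y ≠ ⊤ := fun ht => hc (h.commutator_eq_bot (by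
    obtain ⟨k, rfl⟩ := Subgroup.mem_zpowers_iff.1 (ht ▸ Subgroup.mem_top x)
    exact ((Commute.refl y).zpow_left k).eq))
  obtain ⟨H, hH, hxH⟩ := hP.exists_index_two hx
  obtain ⟨K, hK, hyK⟩ := hP.exists_index_two hy
  have hxH := hxH (Subgroup.mem_zpowers x)
  have hyK := hyK (Subgroup.mem_zpowers y)
  refine ⟨H, K, hH, hK, hxH, fun hyH => ?_, hyK, fun hxK => ?_⟩
  · rw [h.eq_top hxH hyH, Subgroup.index_top] at hH; omega
  · rw [h.eq_top hxK hyK, Subgroup.index_top] at hK; omega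

theorem _root_.Subgroup.even_of_pow_mem {G : Type*} [Group G] {H : Subgroup G} (hH : H.index = 2) {g : G}
    (hg : g ∉ H) {n : ℕ} (hn : g ^ n ∈ H) : Even n := by
  by_contra hc
  obtain ⟨k, rfl⟩ := Nat.not_even_iff_odd.1 hc
  rw [pow_succ, pow_mul] at hn
  exact hg ((Subgroup.mul_mem_cancel_left H
    (pow_mem (Subgroup.sq_mem_of_index_two hH g) k)).1 hn)

theorem _root_.Subgroup.commutator_le_of_index_two {G : Type*} [Group G] {H : Subgroup G} (hH : H.index = 2) :
    commutator G ≤ H := by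
  rw [commutator_def, Subgroup.commutator_le]
  intro u _ v _
  rw [commutatorElement_def]
  simp only [Subgroup.mul_mem_iff_of_index_two hH, inv_mem_iff]
  tauto

theorem exists_pow [Finite P] (h : IsBicyclicPair x y) (g : P) :
    ∃ i j : ℕ, g = x ^ i * y ^ j := by
  obtain ⟨i, j, rfl⟩ := h g
  obtain ⟨i', hi⟩ := exists_zpow_eq_pow x i
  obtain ⟨j', hj⟩ := exists_zpow_eq_pow y j
  exact ⟨i', j', by rw [hi, hj]⟩

theorem exists_even_pow [Finite P] (h : IsBicyclicPair x y) {H K : Subgroup P} (hH : H.index = 2)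
    (hK : K.index = 2) (hxH : x ∈ H) (hyH : y ∉ H) (hyK : y ∈ K) (hxK : x ∉ K) {g : P}
    (hg : g ∈ H ⊓ K) : ∃ i j : ℕ, g = x ^ (2 * i) * y ^ (2 * j) := by
  obtain ⟨i, j, rfl⟩ := h.exists_pow g
  obtain ⟨hg1, hg2⟩ := hg
  obtain ⟨j', rfl⟩ :=
    (Subgroup.even_of_pow_mem hH hyH ((Subgroup.mul_mem_cancel_left H (pow_mem hxH i)).1 hg1)).two_dvd
  obtain ⟨i', rfl⟩ :=
    (Subgroup.even_of_pow_mem hK hxK ((Subgroup.mul_mem_cancel_right K (pow_mem hyK _)).1 hg2)).two_dvd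
  exact ⟨i', j', rfl⟩

/-- `H ⊓ K` is contained in the Frattini subgroup. -/
theorem eq_top_of_sup_eq_top [Finite P] (hP : IsPGroup 2 P) (h : IsBicyclicPair x y)
    {H K : Subgroup P} (hH : H.index = 2)
    (hK : K.index = 2) (hxH : x ∈ H) (hyH : y ∉ H) (hyK : y ∈ K) (hxK : x ∉ K) {L : Subgroup P}
    (hL : L ⊔ (H ⊓ K) = ⊤) : L = ⊤ := by
  by_contra hne
  obtain ⟨N, hN, hLN⟩ := hP.exists_index_two hne
  have hle : H ⊓ K ≤ N := by
    intro g hg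
    obtain ⟨i, j, rfl⟩ := h.exists_even_pow hH hK hxH hyH hyK hxK hg
    rw [pow_mul, pow_mul]
    exact mul_mem (pow_mem (Subgroup.sq_mem_of_index_two hN x) i)
      (pow_mem (Subgroup.sq_mem_of_index_two hN y) j)
  have : N = ⊤ := top_le_iff.1 (hL ▸ sup_le hLN hle)
  rw [this, Subgroup.index_top] at hN
  omega

theorem pow_odd [Finite P] (hP : IsPGroup 2 P) (h : IsBicyclicPair x y) {i j : ℕ} (hi : Odd i)
    (hj : Odd j) : IsBicyclicPair (x ^ i) (y ^ j) := by
  have key : ∀ (z : P) {n : ℕ}, Odd n → ∃ m : ℕ, (z ^ n) ^ m = z := by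
    intro z n hn
    apply exists_pow_eq_self_of_coprime
    obtain ⟨k, hk⟩ := (IsPGroup.iff_orderOf (p := 2)).1 hP z
    rw [hk]
    exact (Nat.coprime_two_right.2 hn).pow_right k
  obtain ⟨m, hm⟩ := key x hi
  obtain ⟨n, hn⟩ := key y hj
  intro g
  obtain ⟨a, b, rfl⟩ := h g
  refine ⟨m * a, n * b, ?_⟩
  rw [zpow_mul, zpow_mul, zpow_natCast, zpow_natCast, hm, hn]

end IsBicyclicPair

theorem geom_sum_two_mul {R : Type*} [CommRing R] (τ : R) (n : ℕ) :
    ∑ k ∈ Finset.range (2 * n), (1 + τ) ^ k =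
      (2 + τ) * ∑ k ∈ Finset.range n, ((1 + τ) ^ 2) ^ k := by
  induction n with
  | zero => simp
  | succ n ih =>
    rw [mul_add, Finset.sum_range_succ, Finset.sum_range_succ, ih, Finset.sum_range_succ, mul_add,
      pow_succ (1 + τ) (2 * n), pow_mul]
    ring

theorem geom_sum_four_mul {R : Type*} [CommRing R] (τ : R) (n : ℕ) :
    ∃ a b : R, ∑ k ∈ Finset.range (2 * (2 * n)), (1 + τ) ^ k = 2 * a + τ ^ 3 * b := by
  have h1 : (1 + τ) ^ 2 = 1 + (2 * τ + τ ^ 2) := by ring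
  rw [geom_sum_two_mul, h1, geom_sum_two_mul]
  exact ⟨(2 + 3 * τ + 2 * τ ^ 2) * ∑ k ∈ Finset.range n, ((1 + (2 * τ + τ ^ 2)) ^ 2) ^ k,
    ∑ k ∈ Finset.range n, ((1 + (2 * τ + τ ^ 2)) ^ 2) ^ k, by ring⟩

theorem dvd_two_of_mem {R : Type*} [CommRing R] {ξ υ a b c d : R} (hξ : IsNilpotent ξ)
    (h1 : ξ = 2 * a + υ * b) (h2 : υ = 2 * c + ξ ^ 3 * d) : 2 ∣ ξ ∧ 2 ∣ υ := by
  have hu : IsUnit (1 - ξ ^ 2 * d * b) := by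
    apply IsNilpotent.isUnit_one_sub
    rw [mul_assoc]
    exact (Commute.all _ _).isNilpotent_mul_right (hξ.pow_of_pos two_ne_zero)
  have h3 : 2 ∣ ξ := by
    rw [← hu.dvd_mul_right]
    exact ⟨a + c * b, by linear_combination h1 + b * h2⟩
  refine ⟨h3, ?_⟩
  rw [h2]
  exact dvd_add (dvd_mul_right _ _) (((h3.trans (dvd_pow_self ξ three_ne_zero))).mul_right _)

theorem exists_intCast_of_nilpotent {R : Type*} [CommRing R] (h2 : IsNilpotent (2 : R)) (ξ : R)
    (h : ∀ r : R, ∃ (m n : ℤ) (s : R), r = m + n * ξ + 2 * s) (r : R) :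
    ∃ m n : ℤ, r = m + n * ξ := by
  obtain ⟨k, hk⟩ := h2
  have key : ∀ k : ℕ, ∃ (m n : ℤ) (s : R), r = m + n * ξ + 2 ^ k * s := by
    intro k
    induction k with
    | zero => exact ⟨0, 0, r, by simp⟩
    | succ k ih =>
      obtain ⟨m, n, s, hr⟩ := ih
      obtain ⟨m', n', s', hs⟩ := h s
      exact ⟨m + 2 ^ k * m', n + 2 ^ k * n', s', by rw [hr, hs]; push_cast; ring⟩
  obtain ⟨m, n, s, hr⟩ := key k
  exact ⟨m, n, by rw [hr, hk]; ring⟩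

namespace BicyclicRing

variable {P R : Type*} [Group P] [CommRing R] {x y : P} {e : R → P} {ξ υ : R}

section

variable (h : BicyclicRing x y e ξ υ)
include h

theorem e_zero : e 0 = 1 := by
  have := h.e_add 0 0
  simpa using this

theorem e_neg (r : R) : e (-r) = (e r)⁻¹ := by
  rw [eq_inv_iff_mul_eq_one, ← h.e_add, neg_add_cancel, h.e_zero]

theorem e_zsmul (n : ℤ) (r : R) : e (n * r) = e r ^ n := by
  have key : ∀ n : ℕ, e (n * r) = e r ^ n := by
    intro n
    induction n with
    | zero => simp [h.e_zero]
    | succ n ih => rw [pow_succ, ← ih, ← h.e_add]; congr 1; push_cast; ring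
  rcases n.eq_nat_or_neg with ⟨k, rfl | rfl⟩
  · simpa using key k
  · rw [Int.cast_neg, neg_mul, h.e_neg, zpow_neg]; simpa using key k

theorem e_mem (r : R) : e r ∈ commutator P := (h.mem_commutator _).2 ⟨r, rfl⟩

omit h in
theorem conj_mul {u v : P} {a c : R} (hu : ∀ r, u * e r * u⁻¹ = e (a * r))
    (hv : ∀ r, v * e r * v⁻¹ = e (c * r)) (r : R) :
    (u * v) * e r * (u * v)⁻¹ = e (a * c * r) := by
  rw [mul_assoc a, ← hu, ← hv]; group

omit h in
theorem conj_pow {u : P} {a : R} (hu : ∀ r, u * e r * u⁻¹ = e (a * r)) (n : ℕ) (r : R) :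
    u ^ n * e r * (u ^ n)⁻¹ = e (a ^ n * r) := by
  induction n generalizing r with
  | zero => simp
  | succ n ih => rw [pow_succ u, pow_succ a, conj_mul ih hu]

theorem e_mul_pow {v : P} {a : R} (hv : ∀ r, v * e r * v⁻¹ = e (a * r)) (s : R) (n : ℕ) :
    (e s * v) ^ n = e ((∑ k ∈ Finset.range n, a ^ k) * s) * v ^ n := by
  induction n with
  | zero => simp [h.e_zero]
  | succ n ih =>
    rw [pow_succ, ih, Finset.sum_range_succ, add_mul, h.e_add, ← conj_pow hv]
    rw [pow_succ]
    group

theorem x_conj_y_pow (n : ℕ) :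
    x * y ^ n * x⁻¹ = e (∑ k ∈ Finset.range n, (1 + υ) ^ k) * y ^ n := by
  have h1 : x * y * x⁻¹ = e 1 * y := by rw [h.e_one]; group
  have h2 : x * y ^ n * x⁻¹ = (x * y * x⁻¹) ^ n := _root_.conj_pow.symm
  rw [h2, h1, h.e_mul_pow h.y_conj, mul_one]

theorem y_conj_x_pow (n : ℕ) :
    y * x ^ n * y⁻¹ = e (-∑ k ∈ Finset.range n, (1 + ξ) ^ k) * x ^ n := by
  have h1 : y * x * y⁻¹ = e (-1) * x := by rw [h.e_neg, h.e_one]; group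
  have h2 : y * x ^ n * y⁻¹ = (y * x * y⁻¹) ^ n := _root_.conj_pow.symm
  rw [h2, h1, h.e_mul_pow h.x_conj, mul_neg_one]

theorem x_mul_pow_mul_pow {i j : ℕ} {s : R} (hs : x ^ i * y ^ j = e s) :
    ξ * s = (1 + ξ) ^ i * ∑ k ∈ Finset.range j, (1 + υ) ^ k := by
  apply h.e_inj
  rw [← conj_pow h.x_conj]
  calc e (ξ * s) = (x * e s * x⁻¹) * (e s)⁻¹ := by
        rw [h.x_conj, ← h.e_neg, ← h.e_add]; congr 1; ring
    _ = x ^ i * (x * y ^ j * x⁻¹) * (y ^ j)⁻¹ * (x ^ i)⁻¹ := by rw [← hs]; group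
    _ = _ := by rw [h.x_conj_y_pow]; group

theorem y_mul_pow_mul_pow {i j : ℕ} {s : R} (hs : x ^ i * y ^ j = e s) :
    υ * s = -∑ k ∈ Finset.range i, (1 + ξ) ^ k := by
  apply h.e_inj
  calc e (υ * s) = (y * e s * y⁻¹) * (e s)⁻¹ := by
        rw [h.y_conj, ← h.e_neg, ← h.e_add]; congr 1; ring
    _ = (y * x ^ i * y⁻¹) * (x ^ i)⁻¹ := by rw [← hs]; group
    _ = _ := by rw [h.y_conj_x_pow]; group

theorem not_two_dvd (hc : ¬ IsCyclic (commutator P)) : ¬ (2 ∣ ξ ∧ 2 ∣ υ) := by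
  rintro ⟨⟨a, ha⟩, b, hb⟩
  apply hc
  refine ⟨⟨e 1, h.e_mem 1⟩, fun ⟨g, hg⟩ => ?_⟩
  obtain ⟨r, rfl⟩ := (h.mem_commutator _).1 hg
  obtain ⟨m, n, hr⟩ := exists_intCast_of_nilpotent h.nil_two 0 (fun r => by
    obtain ⟨m, s, t, hr⟩ := h.span r
    exact ⟨m, 0, a * s + b * t, by rw [hr, ha, hb]; push_cast; ring⟩) r
  refine ⟨m, Subtype.ext ?_⟩
  change e 1 ^ m = e r
  rw [← h.e_zsmul, hr]; simp

end

end BicyclicRing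

open BicyclicRing in
/-- The generators of a bicyclic `2`-group whose commutator subgroup is not cyclic can be chosen
such that `x ^ 2 * y ^ 2` generates the commutator subgroup as a normal subgroup. -/
theorem IsBicyclicPair.exists_ring_isUnit {P : Type u} [Group P] [Finite P] (hP : IsPGroup 2 P)
    {x y : P} (h : IsBicyclicPair x y) (hc : ¬ IsCyclic (commutator P)) :
    ∃ (x y : P) (R : Type u) (_ : CommRing R) (e : R → P) (ξ υ u : R),
      BicyclicRing x y e ξ υ ∧ IsUnit u ∧ x ^ 2 * y ^ 2 = e u := by
  have hc' : commutator P ≠ ⊥ := fun hbot => hc (by rw [hbot]; infer_instance)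
  obtain ⟨R, _, e, ξ, υ, hR⟩ := h.exists_ring hP
  obtain ⟨H, K, hH, hK, hxH, hyH, hyK, hxK⟩ := h.exists_index_two hP hc'
  obtain ⟨i, j, hij⟩ := h.exists_even_pow hH hK hxH hyH hyK hxK (g := e 1)
    ⟨Subgroup.commutator_le_of_index_two hH (hR.e_mem 1),
      Subgroup.commutator_le_of_index_two hK (hR.e_mem 1)⟩
  have h1 := hR.x_mul_pow_mul_pow hij.symm
  have h2 := hR.y_mul_pow_mul_pow hij.symm
  rw [mul_one] at h1 h2
  have hi : Odd i := by
    by_contra hi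
    obtain ⟨n, rfl⟩ := (Nat.not_odd_iff_even.1 hi).two_dvd
    obtain ⟨a, b, hab⟩ := geom_sum_four_mul ξ n
    rw [hab] at h2
    rw [geom_sum_two_mul] at h1
    refine hR.not_two_dvd hc (dvd_two_of_mem (a := (1 + ξ) ^ (2 * (2 * n)) *
      ∑ k ∈ Finset.range j, ((1 + υ) ^ 2) ^ k) (b := (1 + ξ) ^ (2 * (2 * n)) *
      ∑ k ∈ Finset.range j, ((1 + υ) ^ 2) ^ k) (c := -a) (d := -b) hR.nil_ξ ?_ ?_)
    · exact h1.trans (by ring)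
    · exact h2.trans (by ring)
  have hj : Odd j := by
    by_contra hj
    obtain ⟨n, rfl⟩ := (Nat.not_odd_iff_even.1 hj).two_dvd
    obtain ⟨a, b, hab⟩ := geom_sum_four_mul υ n
    rw [hab] at h1
    rw [geom_sum_two_mul] at h2
    refine hR.not_two_dvd hc (dvd_two_of_mem (a := -∑ k ∈ Finset.range i, ((1 + ξ) ^ 2) ^ k)
      (b := -∑ k ∈ Finset.range i, ((1 + ξ) ^ 2) ^ k) (c := (1 + ξ) ^ (2 * i) * a)
      (d := (1 + ξ) ^ (2 * i) * b) hR.nil_υ ?_ ?_).symm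
    · exact h2.trans (by ring)
    · exact h1.trans (by ring)
  have h' := h.pow_odd hP hi hj
  obtain ⟨R', _, e', ξ', υ', hR'⟩ := h'.exists_ring hP
  rw [pow_mul', pow_mul'] at hij
  obtain ⟨u, hu⟩ := (hR'.mem_commutator _).1 (hij ▸ hR.e_mem 1)
  refine ⟨_, _, R', _, e', ξ', υ', u, hR', ?_, hu⟩
  let E : Subgroup P :=
    { carrier := Set.range fun r => e' (u * r)
      one_mem' := ⟨0, by simp [hR'.e_zero]⟩
      mul_mem' := by
        rintro _ _ ⟨r, rfl⟩ ⟨s, rfl⟩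
        exact ⟨r + s, by simp only [mul_add, hR'.e_add]⟩
      inv_mem' := by rintro _ ⟨r, rfl⟩; exact ⟨-r, by simp only [mul_neg, hR'.e_neg]⟩ }
  have hE : E.Normal := by
    refine ⟨?_⟩
    rintro _ ⟨r, rfl⟩ g
    obtain ⟨a, b, rfl⟩ := h'.exists_pow g
    refine ⟨(1 + ξ') ^ a * (1 + υ') ^ b * r, ?_⟩
    rw [conj_mul (conj_pow hR'.x_conj a) (conj_pow hR'.y_conj b)]
    simp only
    congr 1; ring
  have hle : commutator P ≤ E := h.commutator_le (by
    rw [← hR.e_one, hij, hu]; exact ⟨1, by simp⟩)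
  obtain ⟨v, hv⟩ := hle (hR'.e_mem 1)
  exact IsUnit.of_mul_eq_one v (hR'.e_inj hv)

namespace BicyclicRing

variable {P R : Type*} [Group P] [CommRing R] {x y : P} {e : R → P} {ξ υ u : R}

section

variable (h : BicyclicRing x y e ξ υ)
include h

theorem commutes_pow {s : R} {n : ℤ} (hs : x ^ n = e s) : ξ * s = 0 := by
  apply h.e_inj
  have h1 : x * e s * x⁻¹ = e s := by rw [← hs]; group
  rw [h.x_conj, add_mul, one_mul, h.e_add] at h1
  rw [h.e_zero]
  exact mul_eq_left.1 h1

theorem nil_two_mul_add (r s : R) : IsNilpotent (2 * r + ξ * s) :=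
  (Commute.all _ _).isNilpotent_add ((Commute.all _ _).isNilpotent_mul_right h.nil_two)
    ((Commute.all _ _).isNilpotent_mul_right h.nil_ξ)

theorem isUnit_add {t : R} (ht : IsUnit t) (r s : R) : IsUnit (t + (2 * r + ξ * s)) :=
  (h.nil_two_mul_add r s).isUnit_add_left_of_commute ht (Commute.all _ _)

theorem isUnit_X : IsUnit (1 + ξ) := by simpa using h.isUnit_add isUnit_one 0 1

omit [Group P] h in
theorem nontrivial_of_not_dvd (hξ : ¬ 2 ∣ ξ) : Nontrivial R := by
  refine ⟨1, 0, fun h1 => hξ ⟨0, ?_⟩⟩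
  rw [← mul_one ξ, h1]; simp

variable (hu : IsUnit u) (hxy : x ^ 2 * y ^ 2 = e u)
include hxy

theorem ξ_mul_u : ξ * u = (1 + ξ) ^ 2 * (2 + υ) := by
  rw [h.x_mul_pow_mul_pow hxy, Finset.sum_range_succ, Finset.sum_range_one]; ring

theorem υ_mul_u : υ * u = -(2 + ξ) := by
  rw [h.y_mul_pow_mul_pow hxy, Finset.sum_range_succ, Finset.sum_range_one]; ring

theorem pow_mul_pow (d : ℕ) :
    x ^ (2 * d) * y ^ (2 * d) = e ((∑ k ∈ Finset.range d, ((1 + ξ) ^ 2) ^ k) * u) := by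
  induction d with
  | zero => simp [h.e_zero]
  | succ d ih =>
    calc x ^ (2 * (d + 1)) * y ^ (2 * (d + 1))
        = x ^ 2 * (x ^ (2 * d) * y ^ (2 * d)) * (x ^ 2)⁻¹ * (x ^ 2 * y ^ 2) := by group
      _ = _ := by
        rw [ih, conj_pow h.x_conj, hxy, ← h.e_add, geom_sum_succ]
        congr 1; ring

include hu

theorem exists_υ : ∃ v w, υ = 2 * v + ξ * w := by
  obtain ⟨u', rfl⟩ := hu
  refine ⟨-((u'⁻¹ : Rˣ) : R), -((u'⁻¹ : Rˣ) : R), ?_⟩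
  rw [← mul_one υ, ← u'.mul_inv, ← mul_assoc, h.υ_mul_u hxy]; ring

theorem span_ξ (r : R) : ∃ (m : ℤ) (s t : R), r = m + ξ * s + 2 * t := by
  obtain ⟨m, s, t, rfl⟩ := h.span r
  obtain ⟨v, w, hυ⟩ := h.exists_υ hu hxy
  exact ⟨m, s + w * t, v * t, by rw [hυ]; ring⟩

theorem not_dvd_ξ (hc : ¬ IsCyclic (commutator P)) : ¬ 2 ∣ ξ := by
  rintro ⟨a, ha⟩
  obtain ⟨v, w, hυ⟩ := h.exists_υ hu hxy
  exact h.not_two_dvd hc ⟨⟨a, ha⟩, v + a * w, by rw [hυ, ha]; ring⟩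

theorem unit_form (hξ : ¬ 2 ∣ ξ) {t : R} (ht : IsUnit t) : ∃ s v, t = 1 + (2 * s + ξ * v) := by
  have := nontrivial_of_not_dvd hξ
  obtain ⟨m, s, v, rfl⟩ := h.span_ξ hu hxy t
  rcases Int.even_or_odd' m with ⟨k, rfl | rfl⟩
  · refine absurd ht (h.nil_two_mul_add (k + v) s |>.not_isUnit |> fun hn hu => hn ?_)
    convert hu using 1
    push_cast; ring
  · exact ⟨k + v, s, by push_cast; ring⟩

theorem exists_pow_eq (hξ : ¬ 2 ∣ ξ) {a d : ℕ}
    (had : e ξ = x ^ (2 * a) * y ^ (2 * d)) :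
    (∃ σ, ξ ^ 2 = 2 * ξ * σ) ∧ ∃ (n : ℤ) (τ : R), x ^ n = e (ξ + 2 * τ) := by
  set S := ∑ k ∈ Finset.range d, ((1 + ξ) ^ 2) ^ k with hS
  have hx : x ^ (2 * a - 2 * d : ℤ) = e (ξ - S * u) := by
    have h1 := h.pow_mul_pow hxy d
    rw [← hS] at h1
    rw [sub_eq_add_neg ξ, h.e_add, h.e_neg, ← h1, had]
    group
  have hθ := h.commutes_pow hx
  have hX : (1 + ξ) ^ 2 = 1 + (2 * ξ + ξ ^ 2) := by ring
  rcases Nat.even_or_odd' d with ⟨n, rfl | rfl⟩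
  · rw [hX, geom_sum_two_mul] at hS
    set s := ∑ k ∈ Finset.range n, ((1 + (2 * ξ + ξ ^ 2)) ^ 2) ^ k
    obtain ⟨w, hw⟩ : IsUnit (1 - ξ * (s * u)) := by
      simpa [sub_eq_add_neg] using h.isUnit_add isUnit_one 0 (-(s * u))
    have hσ : ξ ^ 2 = 2 * ξ * ((1 + ξ) * s * u * ((w⁻¹ : Rˣ) : R)) := by
      have h1 : ξ ^ 2 * w = 2 * ξ * ((1 + ξ) * s * u) := by
        rw [hw]; rw [hS] at hθ; linear_combination hθ
      have h2 : (w : R) * ((w⁻¹ : Rˣ) : R) = 1 := w.mul_inv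
      linear_combination ((w⁻¹ : Rˣ) : R) * h1 - ξ ^ 2 * h2
    refine ⟨⟨_, hσ⟩, _, -(1 + ξ + ξ * ((1 + ξ) * s * u * ((w⁻¹ : Rˣ) : R))) * (s * u),
      hx.trans ?_⟩
    congr 1
    rw [hS]
    linear_combination -(s * u) * hσ
  · exfalso
    obtain ⟨s, hs⟩ : ∃ s, S = ((1 + ξ) ^ 2) ^ (2 * n) + (2 * s + ξ * (2 * s + ξ * s)) := by
      refine ⟨∑ k ∈ Finset.range n, ((1 + (2 * ξ + ξ ^ 2)) ^ 2) ^ k, ?_⟩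
      rw [hS, Finset.sum_range_succ, hX, geom_sum_two_mul]; ring
    have hSu : IsUnit (S * u) := by
      rw [hs]
      exact (h.isUnit_add ((h.isUnit_X.pow 2).pow _) _ _).mul hu
    have h1 : IsUnit (ξ - S * u) := by
      convert h.isUnit_add hSu.neg 0 1 using 1; ring
    exact hξ ⟨0, by rw [h1.mul_left_eq_zero.1 hθ]; simp⟩

end

open IsBicyclicPair in
/-- A bicyclic `2`-group whose commutator subgroup is not cyclic carries a `BicyclicModel`. -/
theorem exists_model [Finite P] (hP : IsPGroup 2 P) (h : BicyclicRing x y e ξ υ) (hu : IsUnit u)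
    (hxy : x ^ 2 * y ^ 2 = e u) (hc : ¬ IsCyclic (commutator P)) :
    ∃ (M Φ : Subgroup P) (b : P) (μ : ℕ), BicyclicModel ⊤ M Φ e x b ξ μ := by
  have hc' : commutator P ≠ ⊥ := fun hbot => hc (by rw [hbot]; infer_instance)
  have hξ := h.not_dvd_ξ hu hxy hc
  have := nontrivial_of_not_dvd hξ
  obtain ⟨H, K, hH, hK, hxH, hyH, hyK, hxK⟩ := h.pair.exists_index_two hP hc'
  have hDΦ : commutator P ≤ H ⊓ K := le_inf (Subgroup.commutator_le_of_index_two hH)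
    (Subgroup.commutator_le_of_index_two hK)
  obtain ⟨a, d, had⟩ := h.pair.exists_even_pow hH hK hxH hyH hyK hxK (hDΦ (h.e_mem ξ))
  obtain ⟨⟨σ, hσ⟩, n, τ, hn⟩ := h.exists_pow_eq hu hxy hξ had
  let M : Subgroup P :=
    { carrier := {g | g ∈ H ↔ g ∈ K}
      one_mem' := by simp [one_mem]
      mul_mem' := fun {g k} hg hk => by
        simp only [Set.mem_ofPred_eq, Subgroup.mul_mem_iff_of_index_two hH,
          Subgroup.mul_mem_iff_of_index_two hK] at *
        tauto
      inv_mem' := fun {g} hg => by simpa using hg }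
  have hMmem : ∀ g, g ∈ M ↔ (g ∈ H ↔ g ∈ K) := fun g => Iff.rfl
  obtain ⟨μ, hμ⟩ := (IsPGroup.iff_orderOf (p := 2)).1
    (hP.to_quotient (commutator P)) (QuotientGroup.mk x)
  have hpow : ∀ k : ℕ, (QuotientGroup.mk x : P ⧸ commutator P) ^ k = 1 ↔ ∃ r, x ^ k = e r := by
    intro k
    rw [← QuotientGroup.mk_pow, QuotientGroup.eq_one_iff, h.mem_commutator]
  obtain ⟨η, hη⟩ := (hpow _).1 (hμ ▸ pow_orderOf_eq_one (QuotientGroup.mk x : P ⧸ commutator P))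
  have hη' : ∃ τ, η = ξ + 2 * τ := by
    have h1 : (QuotientGroup.mk x : P ⧸ commutator P) ^ n = 1 := by
      rw [← QuotientGroup.mk_zpow, QuotientGroup.eq_one_iff, hn]; exact h.e_mem _
    rw [← orderOf_dvd_iff_zpow_eq_one, hμ] at h1
    obtain ⟨k, rfl⟩ := h1
    have h2 : k * η = ξ + 2 * τ := by
      apply h.e_inj
      rw [h.e_zsmul, ← hη, ← hn, zpow_mul, ← zpow_natCast]
    rcases Int.even_or_odd' k with ⟨k', rfl | rfl⟩
    · exact absurd ⟨k' * η - τ, by push_cast at h2; linear_combination -h2⟩ hξ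
    · exact ⟨τ - k' * η, by push_cast at h2; linear_combination h2⟩
  obtain ⟨τ', rfl⟩ := hη'
  have hyx : y * x = e (-1) * x * y := by rw [h.e_neg, h.e_one]; group
  have hxb : x * (x * y) * x⁻¹ = e (1 + ξ) * (x * y) := by
    have h1 := h.x_conj 1
    rw [h.e_one, mul_one] at h1
    rw [← h1]; group
  have hbb : (x * y) * (x * y) = e (u - (1 + ξ)) := by
    have h1 := h.x_conj (-1)
    calc (x * y) * (x * y) = x * (y * x) * y := by group
      _ = (x * e (-1) * x⁻¹) * (x ^ 2 * y ^ 2) := by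
        rw [hyx, pow_two, pow_two]; group
      _ = _ := by rw [h1, hxy, ← h.e_add]; congr 1; ring
  have hB : ∃ ρ, (1 + ξ) * (1 + υ) = -1 + 2 * ξ * ρ := by
    obtain ⟨w, hw⟩ := h.isUnit_X
    obtain ⟨s, v, hsv⟩ := h.unit_form hu hxy hξ hu
    have h1 : ξ * (u - (1 + ξ)) = (1 + (1 + ξ) * (1 + υ)) * (1 + ξ) := by
      linear_combination h.ξ_mul_u hxy
    refine ⟨(s + σ * (v - 1)) * ((w⁻¹ : Rˣ) : R), ?_⟩
    have h2 : (1 + ξ) * ((w⁻¹ : Rˣ) : R) = 1 := by rw [← hw]; exact w.mul_inv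
    rw [hsv] at h1
    linear_combination ((w⁻¹ : Rˣ) : R) * (-h1 + (v - 1) * hσ) -
      (1 + (1 + ξ) * (1 + υ)) * h2
  have hbM : x * y ∈ M := by
    rw [hMmem, Subgroup.mul_mem_iff_of_index_two hH, Subgroup.mul_mem_iff_of_index_two hK]
    tauto
  have hbH : x * y ∉ H := fun hm => hyH ((Subgroup.mul_mem_cancel_left H hxH).1 hm)
  refine ⟨M, H ⊓ K, x * y, μ, ?_⟩
  exact
    { e_add := h.e_add
      e_inj := h.e_inj
      e_mem := fun r => hDΦ (h.e_mem r)
      M_le := le_top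
      Φ_le := fun g hg => iff_of_true hg.1 hg.2
      x_mem := Subgroup.mem_top x
      b_mem := hbM
      x_not_mem := fun hm => hxK (hm.1 hxH)
      b_not_mem := fun hm => hbH hm.1
      x_sq_mem := by
        have h1 := Subgroup.sq_mem_of_index_two hH x
        have h2 := Subgroup.sq_mem_of_index_two hK x
        rw [pow_two] at h1 h2
        exact ⟨h1, h2⟩
      index_M := by
        intro g _ k _ hg hk
        rw [hMmem] at *
        rw [Subgroup.mul_mem_iff_of_index_two hH, Subgroup.mul_mem_iff_of_index_two hK,
          inv_mem_iff, inv_mem_iff]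
        tauto
      index_Φ := by
        intro g hg k hk hg' hk'
        rw [hMmem] at hg hk
        rw [Subgroup.mem_inf] at *
        rw [Subgroup.mul_mem_iff_of_index_two hH, Subgroup.mul_mem_iff_of_index_two hK,
          inv_mem_iff, inv_mem_iff]
        tauto
      frattini := fun L _ hL => top_le_iff.2
        (h.pair.eq_top_of_sup_eq_top hP hH hK hxH hyH hyK hxK (top_le_iff.1 hL))
      comm := fun g _ k _ => (h.mem_commutator _).1 (by
        have := Subgroup.commutator_mem_commutator (Subgroup.mem_top g) (Subgroup.mem_top k)
        rwa [← commutator_def, commutatorElement_def] at this)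
      e_comm := fun r => h.e_mem r
      x_conj := h.x_conj
      b_conj := hB.imp fun ρ hρ r => by rw [conj_mul h.x_conj h.y_conj, hρ]
      x_b := ⟨1 + ξ, h.isUnit_X, hxb⟩
      b_sq := ⟨_, hbb⟩
      two_le := by
        by_contra! hlt
        interval_cases μ
        · rw [pow_zero, pow_one] at hη
          exact hxK (hη ▸ (hDΦ (h.e_mem _)).2)
        · rw [pow_one] at hη
          have hy2 : y ^ 2 = e (u - (ξ + 2 * τ')) := by
            rw [sub_eq_add_neg, add_comm, h.e_add, h.e_neg, ← hη, ← hxy]; group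
          have h1 : υ * (u - (ξ + 2 * τ')) = 0 := by
            have h2 := h.y_mul_pow_mul_pow (i := 0) (j := 2) (by rw [pow_zero, one_mul, hy2])
            simpa using h2
          have h2 : IsUnit (u - (ξ + 2 * τ')) := by
            convert h.isUnit_add hu (-τ') (-1) using 1; ring
          have h3 := h.υ_mul_u hxy
          rw [h2.mul_left_eq_zero.1 h1] at h3
          exact hξ ⟨-1, by linear_combination h3⟩
      x_pow := ⟨τ', hη⟩
      dvd_of_x_pow := fun k r hk => by
        rw [← hμ, orderOf_dvd_iff_pow_eq_one, hpow]; exact ⟨r, hk⟩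
      rep := by
        intro g _
        obtain ⟨i, j, rfl⟩ := h.pair.exists_pow g
        have hy : ∀ j : ℕ, ∃ r, y ^ (2 * j) = x ^ (-(2 * j) : ℤ) * e r := by
          intro j
          exact ⟨_, by rw [← h.pow_mul_pow hxy j]; group⟩
        rcases Nat.even_or_odd' j with ⟨j, rfl | rfl⟩
        · obtain ⟨r, hr⟩ := hy j
          obtain ⟨k, hk⟩ := exists_zpow_eq_pow x (i - 2 * j)
          refine ⟨k, r, Or.inl ?_⟩
          rw [hr, ← hk]; group
        · obtain ⟨r, hr⟩ := hy j
          obtain ⟨k, hk⟩ := exists_zpow_eq_pow x (i - 2 * j - 1)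
          have hnorm : (commutator P).Normal := inferInstance
          obtain ⟨s, hs⟩ := (h.mem_commutator _).1
            (hnorm.conj_mem _ (h.e_mem r) ((x * y)⁻¹ * x))
          refine ⟨k, s, Or.inr ?_⟩
          rw [pow_succ, hr, ← hk, ← hs]; group
      ξ_sq := ⟨σ, hσ⟩
      span := exists_intCast_of_nilpotent h.nil_two ξ fun r => by
        obtain ⟨m, s, t, rfl⟩ := h.span_ξ hu hxy r
        obtain ⟨m', s', t', rfl⟩ := h.span_ξ hu hxy s
        exact ⟨m, m', ξ * t' + ξ * σ * s' + t, by linear_combination s' * hσ⟩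
      indep := by
        intro m n s hmn
        have hm : 2 ∣ m := by
          rcases Int.even_or_odd' m with ⟨k, rfl | rfl⟩
          · exact dvd_mul_right _ _
          · exfalso
            have h1 : IsUnit (1 + (2 * (k - s) + ξ * n)) := h.isUnit_add isUnit_one _ _
            exact h1.ne_zero (by push_cast at hmn; linear_combination hmn)
        refine ⟨hm, ?_⟩
        obtain ⟨k, rfl⟩ := hm
        rcases Int.even_or_odd' n with ⟨l, rfl | rfl⟩
        · exact dvd_mul_right _ _
        · exact absurd ⟨s - k - l * ξ, by push_cast at hmn; linear_combination hmn⟩ hξ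
      nil := h.nil_two }

end BicyclicRing

/-- Transport of a `BicyclicModel` along an injective homomorphism. -/
theorem BicyclicModel.map {G H R : Type*} [Group G] [Group H] [CommRing R] {P M Φ : Subgroup G}
    {e : R → G} {x b : G} {ξ : R} {μ : ℕ} (h : BicyclicModel P M Φ e x b ξ μ) {f : G →* H}
    (hf : Function.Injective f) :
    BicyclicModel (P.map f) (M.map f) (Φ.map f) (f ∘ e) (f x) (f b) ξ μ := by
  have hmem : ∀ (K : Subgroup G) (g : G), f g ∈ K.map f ↔ g ∈ K :=
    fun K g => Subgroup.mem_map_iff_mem hf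
  exact
    { e_add := fun r s => by simp [h.e_add]
      e_inj := hf.comp h.e_inj
      e_mem := fun r => (hmem _ _).2 (h.e_mem r)
      M_le := Subgroup.map_mono h.M_le
      Φ_le := Subgroup.map_mono h.Φ_le
      x_mem := (hmem _ _).2 h.x_mem
      b_mem := (hmem _ _).2 h.b_mem
      x_not_mem := fun hm => h.x_not_mem ((hmem _ _).1 hm)
      b_not_mem := fun hm => h.b_not_mem ((hmem _ _).1 hm)
      x_sq_mem := by rw [← map_mul]; exact (hmem _ _).2 h.x_sq_mem
      index_M := by
        rintro _ ⟨u, hu, rfl⟩ _ ⟨v, hv, rfl⟩ hu' hv'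
        rw [hmem] at hu' hv'
        rw [← map_inv, ← map_mul, hmem]
        exact h.index_M u hu v hv hu' hv'
      index_Φ := by
        rintro _ ⟨u, hu, rfl⟩ _ ⟨v, hv, rfl⟩ hu' hv'
        rw [hmem] at hu' hv'
        rw [← map_inv, ← map_mul, hmem]
        exact h.index_Φ u hu v hv hu' hv'
      frattini := by
        intro K hK hPK
        have hKf : (K.comap f).map f = K :=
          Subgroup.map_comap_eq_self (hK.trans (Subgroup.map_le_range f P))
        rw [← hKf, ← Subgroup.map_sup, Subgroup.map_le_map_iff_of_injective hf] at hPK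
        rw [← hKf] at hK ⊢
        rw [Subgroup.map_le_map_iff_of_injective hf] at hK ⊢
        exact h.frattini _ hK hPK
      comm := by
        rintro _ ⟨u, hu, rfl⟩ _ ⟨v, hv, rfl⟩
        obtain ⟨r, hr⟩ := h.comm u hu v hv
        exact ⟨r, by simp [← hr]⟩
      e_comm := fun r => by
        rw [← Subgroup.map_commutator]; exact (hmem _ _).2 (h.e_comm r)
      x_conj := fun r => by simp [← h.x_conj]
      b_conj := h.b_conj.imp fun ρ hρ r => by simp [← hρ]
      x_b := h.x_b.imp fun t ht => ⟨ht.1, by simp [← map_inv, ← map_mul, ht.2]⟩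
      b_sq := h.b_sq.imp fun β hβ => by simp [← hβ]
      two_le := h.two_le
      x_pow := h.x_pow.imp fun η hη => by simp [← hη]
      dvd_of_x_pow := fun k r hk => h.dvd_of_x_pow k r (hf (by simpa using hk))
      rep := by
        rintro _ ⟨u, hu, rfl⟩
        obtain ⟨k, r, rfl | rfl⟩ := h.rep u hu
        · exact ⟨k, r, Or.inl (by simp)⟩
        · exact ⟨k, r, Or.inr (by simp)⟩
      ξ_sq := h.ξ_sq
      span := h.span
      indep := h.indep
      nil := h.nil }

/-- A bicyclic `2`-subgroup with noncyclic commutator subgroup carries a `BicyclicModel`. -/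
theorem BicyclicModel.exists_of_isBicyclic {G : Type u} [Group G] {P : Subgroup G} [Finite P]
    (hP : IsPGroup 2 P) (hbi : IsBicyclic P) (hc : ¬ IsCyclic (commutator P)) :
    ∃ (R : Type u) (_ : CommRing R) (M Φ : Subgroup G) (e : R → G) (x b : G) (ξ : R) (μ : ℕ),
      BicyclicModel P M Φ e x b ξ μ := by
  obtain ⟨x, y, hxy⟩ := hbi
  obtain ⟨x, y, R, _, e, ξ, υ, u, h, hu, he⟩ :=
    IsBicyclicPair.exists_ring_isUnit hP (x := x) (y := y) hxy hc
  obtain ⟨M, Φ, b, μ, hM⟩ := BicyclicRing.exists_model hP h hu he hc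
  have := hM.map P.subtype_injective
  rw [← MonoidHom.range_eq_map, Subgroup.range_subtype] at this
  exact ⟨R, _, _, _, _, _, _, _, _, this⟩

theorem IsBicyclic.of_surjective {P Q : Type*} [Group P] [Group Q] (h : IsBicyclic P) {f : P →* Q}
    (hf : Function.Surjective f) : IsBicyclic Q := by
  obtain ⟨x, y, hxy⟩ := h
  refine ⟨f x, f y, fun g => ?_⟩
  obtain ⟨g, rfl⟩ := hf g
  obtain ⟨i, j, rfl⟩ := hxy g
  exact ⟨i, j, by simp⟩

/-- Conjugation in a group with a normal complement to `P` modulo `Z` is realised inside `P`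
modulo `Z`. -/
theorem Subgroup.exists_mem_conj_mem_of_complement {C : Type*} [Group C] {Z P : Subgroup C}
    [Z.Normal] {N : Subgroup (C ⧸ Z)} [hN : N.Normal]
    (hbot : N ⊓ P.map (QuotientGroup.mk' Z) = ⊥) (htop : N ⊔ P.map (QuotientGroup.mk' Z) = ⊤)
    {g u : C} (hu : u ∈ P) (hg : g * u * g⁻¹ ∈ P) :
    ∃ s ∈ P, (s * u * s⁻¹)⁻¹ * (g * u * g⁻¹) ∈ Z := by
  have hgt : (g : C ⧸ Z) ∈ N ⊔ P.map (QuotientGroup.mk' Z) := htop ▸ Subgroup.mem_top _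
  obtain ⟨n, hn, _, ⟨s, hs, rfl⟩, hns⟩ := Subgroup.mem_sup_of_normal_left.1 hgt
  refine ⟨s, hs, ?_⟩
  have hv : s * u * s⁻¹ ∈ P := mul_mem (mul_mem hs hu) (inv_mem hs)
  rw [← QuotientGroup.eq_one_iff, ← Subgroup.mem_bot, ← hbot]
  have hm : (s * u * s⁻¹)⁻¹ * (g * u * g⁻¹) ∈ P := mul_mem (inv_mem hv) hg
  refine ⟨?_, ⟨_, hm, rfl⟩⟩
  have h1 : (((s * u * s⁻¹)⁻¹ * (g * u * g⁻¹) : C) : C ⧸ Z) =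
      (((s * u * s⁻¹ : C) : C ⧸ Z)⁻¹ * n * ((s * u * s⁻¹ : C) : C ⧸ Z)) * n⁻¹ := by
    simp only [QuotientGroup.mk_mul, QuotientGroup.mk_inv]
    rw [← hns]
    simp only [QuotientGroup.mk'_apply]
    group
  rw [h1]
  refine N.mul_mem ?_ (N.inv_mem hn)
  have := hN.conj_mem n hn (((s * u * s⁻¹ : C) : C ⧸ Z)⁻¹)
  rwa [inv_inv] at this

namespace BicyclicModel

variable {G R : Type*} [Group G] [CommRing R] {P M Φ : Subgroup G} {e : R → G}
  {x b : G} {ξ : R} {μ : ℕ}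

theorem e_zsmul (h : BicyclicModel P M Φ e x b ξ μ) (n : ℤ) (r : R) : e (n * r) = e r ^ n := by
  rcases n.eq_nat_or_neg with ⟨k, rfl | rfl⟩
  · simpa using h.e_nsmul k r
  · rw [Int.cast_neg, neg_mul, h.e_neg, zpow_neg]; simpa using h.e_nsmul k r

theorem exists_two_mul_annihilated (h : BicyclicModel P M Φ e x b ξ μ) (h2 : (2 : R) ≠ 0) :
    ∃ w : R, 2 * w ≠ 0 ∧ 2 * (2 * w) = 0 ∧ ξ * (2 * w) = 0 := by
  have key : ∀ a w : R, IsNilpotent a → w ≠ 0 → ∃ k : ℕ, a ^ k * w ≠ 0 ∧ a * (a ^ k * w) = 0 := by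
    intro a w ha hw
    obtain ⟨n, hn⟩ := ha
    have hex : ∃ k, a ^ k * w = 0 := ⟨n, by rw [hn, zero_mul]⟩
    classical
    have hpos : Nat.find hex ≠ 0 := fun h0 => hw (by
      have := Nat.find_spec hex
      rwa [h0, pow_zero, one_mul] at this)
    obtain ⟨k, hk⟩ := Nat.exists_eq_succ_of_ne_zero hpos
    refine ⟨k, Nat.find_min hex (by omega), ?_⟩
    rw [← mul_assoc, ← pow_succ', ← Nat.succ_eq_add_one, ← hk]
    exact Nat.find_spec hex
  obtain ⟨k, hk, hk'⟩ := key 2 2 h.nil h2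
  obtain ⟨l, hl, hl'⟩ := key ξ _ h.nil_ξ hk
  refine ⟨ξ ^ l * 2 ^ k, ?_, ?_, ?_⟩
  · convert hl using 1; ring
  · linear_combination ξ ^ l * hk'
  · linear_combination hl'

/-- Dividing by a square in the commutator subgroup does not make it cyclic. -/
theorem not_isCyclic_commutator_of_surjective (h : BicyclicModel P M Φ e x b ξ μ) {w : R}
    {Q : Type*} [Group Q] {f : P →* Q} (hf : Function.Surjective f)
    (hker : ∀ p : P, f p = 1 → (p : G) ∈ Subgroup.zpowers (e (2 * w))) :
    ¬ IsCyclic (commutator Q) := by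
  rintro ⟨⟨q, hq⟩, hgen⟩
  have hmap : (commutator P).map f = commutator Q := by
    rw [map_commutator_eq, MonoidHom.range_eq_top.2 hf, commutator_def]
  have hsub : (commutator P).map P.subtype = ⁅P, P⁆ := by
    rw [map_commutator_eq, Subgroup.range_subtype]
  have hel : ∀ r, ∃ p : P, (p : G) = e r ∧ p ∈ commutator P := by
    intro r
    have h1 : e r ∈ (commutator P).map P.subtype := hsub ▸ h.e_comm r
    obtain ⟨p, hp, hpr⟩ := h1
    exact ⟨p, hpr, hp⟩
  obtain ⟨p, hp, hpq⟩ : q ∈ (commutator P).map f := hmap ▸ hq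
  obtain ⟨s, hs⟩ : ∃ s, (p : G) = e s :=
    h.mem_commutator_iff.1 (hsub ▸ ⟨p, hp, rfl⟩)
  have key : ∀ r, ∃ (n : ℤ) (t : R), r = n * s + 2 * t := by
    intro r
    obtain ⟨k, hkr, hk⟩ := hel r
    obtain ⟨n, hn⟩ := hgen ⟨f k, hmap ▸ ⟨k, hk, rfl⟩⟩
    have hn : q ^ n = f k := congrArg Subtype.val hn
    obtain ⟨m, hm⟩ := hker (p ^ (-n) * k) (by rw [map_mul, map_zpow, hpq, ← hn]; group)
    refine ⟨n, m * w, h.e_inj ?_⟩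
    have h3 : (n * s + 2 * (m * w) : R) = n * s + m * (2 * w) := by ring
    rw [h3, h.e_add, h.e_zsmul, h.e_zsmul, ← hkr, ← hs]
    have hm : e (2 * w) ^ m = (p : G) ^ (-n) * k := by simpa using hm
    rw [hm]; group
  obtain ⟨n, t, h1⟩ := key 1
  obtain ⟨n', t', hξ⟩ := key ξ
  obtain ⟨h2, h3⟩ := h.indep n' (-n) (n' * t - n * t') (by
    push_cast; linear_combination (n' : R) * h1 - (n : R) * hξ)
  obtain ⟨m, rfl⟩ := (dvd_neg.1 h3)
  have := h.indep 1 0 (m * s + t) (by push_cast at h1 ⊢; linear_combination h1)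
  omega

end BicyclicModel

/-- Fusion in the centraliser of `e (2 * w)` is controlled by the quotient. -/
theorem BicyclicModel.fusion_centralizer {G : Type u} {R : Type*} [Group G] [Finite G] [CommRing R]
    {P : Sylow 2 G} {M Φ : Subgroup G} {e : R → G} {x b : G} {ξ : R} {μ : ℕ}
    (h : BicyclicModel P M Φ e x b ξ μ)
    (ih : ∀ (H : Type u) [Group H] [Finite H], Nat.card H < Nat.card G → ∀ Q : Sylow 2 H,
      IsBicyclic Q → ¬ IsCyclic (commutator Q) →
      ∃ N : Subgroup H, N.Normal ∧ N ⊓ (Q : Subgroup H) = ⊥ ∧ N ⊔ (Q : Subgroup H) = ⊤)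
    (hbi : IsBicyclic P) {w : R} (hw : 2 * w ≠ 0) (hw2 : 2 * (2 * w) = 0)
    (hwξ : ξ * (2 * w) = 0) {g : G} (hg : g * e (2 * w) * g⁻¹ = e (2 * w)) {u : G} (hu : u ∈ P)
    (hgu : g * u * g⁻¹ ∈ P) : u⁻¹ * (g * u * g⁻¹) ∈ Φ := by
  set ζ := e (2 * w) with hζdef
  let C : Subgroup G := Subgroup.centralizer {ζ}
  have hC : ∀ k, k ∈ C ↔ k * ζ * k⁻¹ = ζ := fun k => by
    rw [Subgroup.mem_centralizer_singleton_iff, mul_inv_eq_iff_eq_mul]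
  have hPC : (P : Subgroup G) ≤ C := fun k hk => (hC k).2 (h.conj_e_of_mul_eq_zero hw2 hwξ hk)
  have hζC : ζ ∈ C := (hC ζ).2 (by group)
  let Z : Subgroup C := Subgroup.zpowers ⟨ζ, hζC⟩
  have hZ : ∀ c : C, c ∈ Z ↔ (c : G) ∈ Subgroup.zpowers ζ := by
    intro c
    simp only [Z, Subgroup.mem_zpowers_iff, Subtype.ext_iff, Subgroup.coe_zpow]
  have hZn : Z.Normal := by
    refine ⟨fun c hc k => ?_⟩
    obtain ⟨n, rfl⟩ := Subgroup.mem_zpowers_iff.1 hc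
    have h1 : k * ⟨ζ, hζC⟩ * k⁻¹ = (⟨ζ, hζC⟩ : C) := Subtype.ext ((hC k).1 k.2)
    rw [← conj_zpow, h1]
    exact Subgroup.zpow_mem_zpowers _ n
  have hcard : Nat.card (C ⧸ Z) < Nat.card G := by
    have h1 : 1 < Nat.card Z := by
      rw [Subgroup.one_lt_card_iff_ne_bot]
      intro hbot
      refine hw (h.e_eq_one.1 ?_)
      have := Subgroup.zpowers_eq_bot.1 hbot
      exact congrArg Subtype.val this
    have h2 := Subgroup.card_eq_card_quotient_mul_card_subgroup Z
    have h3 := Subgroup.card_le_card_group C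
    have h4 : 0 < Nat.card (C ⧸ Z) := Nat.card_pos
    nlinarith
  let Q : Sylow 2 (C ⧸ Z) := (P.subtype hPC).mapSurjective (QuotientGroup.mk'_surjective Z)
  have hQ : (Q : Subgroup (C ⧸ Z)) = ((P : Subgroup G).subgroupOf C).map (QuotientGroup.mk' Z) :=
    rfl
  let f : P →* Q := ((QuotientGroup.mk' Z).comp (Subgroup.inclusion hPC)).codRestrict Q
    fun p => show _ ∈ ((P : Subgroup G).subgroupOf C).map (QuotientGroup.mk' Z) from
      ⟨Subgroup.inclusion hPC p, p.2, rfl⟩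
  have hf : Function.Surjective f := by
    rintro ⟨q, hq⟩
    obtain ⟨c, hc, rfl⟩ : q ∈ ((P : Subgroup G).subgroupOf C).map (QuotientGroup.mk' Z) := hQ ▸ hq
    exact ⟨⟨c, hc⟩, rfl⟩
  have hker : ∀ p : P, f p = 1 → (p : G) ∈ Subgroup.zpowers ζ := by
    intro p hp
    have h1 : ((Subgroup.inclusion hPC p : C) : C ⧸ Z) = 1 := congrArg Subtype.val hp
    exact (hZ _).1 ((QuotientGroup.eq_one_iff _).1 h1)
  obtain ⟨N, hN, hbot, htop⟩ := ih (C ⧸ Z) hcard Q (hbi.of_surjective hf)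
    (h.not_isCyclic_commutator_of_surjective hf hker)
  rw [hQ] at hbot htop
  obtain ⟨⟨s, hsC⟩, hs, hsZ⟩ := Subgroup.exists_mem_conj_mem_of_complement hbot htop
    (g := ⟨g, (hC g).2 hg⟩) (u := ⟨u, hPC hu⟩) hu hgu
  have hs : s ∈ (P : Subgroup G) := hs
  rw [hZ] at hsZ
  have h1 : (s * u * s⁻¹)⁻¹ * (g * u * g⁻¹) ∈ Φ :=
    (Subgroup.zpowers_le.2 (h.e_mem (2 * w))) hsZ
  obtain ⟨r, hr⟩ := h.comm u⁻¹ (inv_mem hu) s hs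
  have h2 : u⁻¹ * (s * u * s⁻¹) ∈ Φ := by
    have := h.e_mem r
    rw [← hr] at this
    convert this using 1; group
  convert mul_mem h2 h1 using 1
  group

theorem BicyclicModel.exists_normal_complement {G R : Type*} [Group G] [Finite G] [CommRing R]
    {P : Sylow 2 G} {M Φ : Subgroup G} {e : R → G} {x b : G} {ξ : R} {μ : ℕ}
    (h : BicyclicModel P M Φ e x b ξ μ)
    (hζ : (2 : R) ≠ 0 → ∃ z : R, z ≠ 0 ∧ 2 * z = 0 ∧ ξ * z = 0 ∧
      ∀ g, g * e z * g⁻¹ = e z → ∀ u ∈ P, g * u * g⁻¹ ∈ P → u⁻¹ * (g * u * g⁻¹) ∈ Φ) :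
    ∃ N : Subgroup G, N.Normal ∧ N ⊓ (P : Subgroup G) = ⊥ ∧ N ⊔ (P : Subgroup G) = ⊤ := by
  have hfus := P.fusion_of_normalizers Φ fun A hA hdvd hext n hn => by
    have L : LocalFusion (P : Subgroup G) Φ A :=
      { isPGroup := P.2
        le := hA
        conj_mem := by
          intro u hu s hs
          obtain ⟨r, hr⟩ := h.comm u⁻¹ (inv_mem hu) s hs
          have := h.e_mem r
          rw [← hr] at this
          convert this using 1; group
        not_dvd := hdvd
        extend := fun B hB hAB => hext B hB (by
          by_contra! hc
          exact hAB.ne (Subgroup.eq_of_le_of_card_ge hAB.le hc)) }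
    exact (h.normalizer_le_actsTriviallyMod L hζ hn).2
  refine P.exists_normal_complement_of_fusion (Φ.subgroupOf P) (fun K hK => ?_)
    fun u v g hg => ?_
  · have h1 := h.frattini (K.map (P : Subgroup G).subtype) (Subgroup.map_subtype_le K) (by
      have h2 := congrArg (Subgroup.map (P : Subgroup G).subtype) hK
      rw [Subgroup.map_sup, Subgroup.subgroupOf_map_subtype, inf_eq_left.2 h.Φ_le_P,
        ← MonoidHom.range_eq_map, Subgroup.range_subtype] at h2
      exact h2.ge)
    refine eq_top_iff.2 fun p _ => ?_
    obtain ⟨k, hk, hkp⟩ := h1 p.2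
    rwa [← Subtype.ext hkp]
  · have := hfus (Subgroup.zpowers (u : G)) (Subgroup.zpowers_le.2 u.2) g (by
      rintro _ ⟨n, rfl⟩
      change g * (u : G) ^ n * g⁻¹ ∈ P
      rw [← conj_zpow, hg]
      exact zpow_mem v.2 n) u (Subgroup.mem_zpowers _)
    rw [hg] at this
    exact this

theorem normal_complement_of_card_lt {n : ℕ} : ∀ (G : Type u) [Group G] [Finite G],
    Nat.card G < n → ∀ P : Sylow 2 G, IsBicyclic P → ¬ IsCyclic (commutator P) →
    ∃ N : Subgroup G, N.Normal ∧ N ⊓ (P : Subgroup G) = ⊥ ∧ N ⊔ (P : Subgroup G) = ⊤ := by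
  induction n with
  | zero => exact fun G _ _ hlt => absurd hlt (Nat.not_lt_zero _)
  | succ n ih =>
    intro G _ _ hlt P hbi hc
    obtain ⟨R, _, M, Φ, e, x, b, ξ, μ, h⟩ := BicyclicModel.exists_of_isBicyclic P.2 hbi hc
    refine h.exists_normal_complement fun h2 => ?_
    obtain ⟨w, hw, hw2, hwξ⟩ := h.exists_two_mul_annihilated h2
    refine ⟨2 * w, hw, hw2, hwξ, fun g hg u hu hgu => ?_⟩
    exact h.fusion_centralizer (fun H _ _ hH => ih H (by omega)) hbi hw hw2 hwξ hg hu hgu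

/-- If a finite group `G` has a bicyclic Sylow `2`-subgroup `P` whose commutator
subgroup is not cyclic, then `P` has a normal complement in `G`. -/
theorem normal_complement_of_bicyclic_sylow (G : Type*) [Group G] [Finite G]
    (P : Sylow 2 G) (hbi : IsBicyclic P)
    (hcomm : ¬ IsCyclic (commutator P)) :
    ∃ N : Subgroup G, N.Normal ∧ N ⊓ (P : Subgroup G) = ⊥ ∧
      N ⊔ (P : Subgroup G) = ⊤ := by
  exact normal_complement_of_card_lt G (Nat.lt_succ_self _) P hbi hcomm
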